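/- Let φ be subharmonic on ℂ with doubling Laplacian. For every ε > 0, all exponents 1 ≤ p, p' ≤ ∞, and all flat weights ω, ω̃ for φ: if Λ is an interpolating sequence for F^p_{φ,ω}, then Λ is an interpolating sequence for F^{p'}_{(1+ε)φ, ω̃}. -/

import Mathlib

open MeasureTheory Metric Filter Set
open scoped ENNReal NNReal Real Topology Classical

noncomputable section

/-- The Laplacian of a function on `ℂ ≅ ℝ²`, computed via the second Fréchet derivative. -/
def lap (v : ℂ → ℝ) (z : ℂ) : ℝ :=
  iteratedFDeriv ℝ 2 v z ![1, 1] + iteratedFDeriv ℝ 2 v z ![Complex.I, Complex.I]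

/-- `μ` is a doubling measure on `ℂ` with doubling constant `C`. -/
def IsDoubling (μ : Measure ℂ) (C : ℝ≥0) : Prop :=
  ∀ z : ℂ, ∀ r : ℝ, 0 < r → μ (ball z (2 * r)) ≤ C * μ (ball z r)

/-- `φ` is a (continuous) subharmonic function whose distributional Laplacian is the
doubling measure `μ` (not identically zero).  The distributional identity is expressed
by testing against smooth compactly supported functions. -/
structure HasDoublingLaplacian (φ : ℂ → ℝ) (μ : Measure ℂ) : Prop where
  continuous : Continuous φ
  lap_eq : ∀ v : ℂ → ℝ, ContDiff ℝ (⊤ : ℕ∞) v → HasCompactSupport v →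
    ∫ z, φ z * lap v z = ∫ z, v z ∂μ
  doubling : ∃ C : ℝ≥0, 0 < C ∧ IsDoubling μ C
  ne_zero : μ ≠ 0

/-- `ρ` assigns to every `z` the positive radius such that the disk `D(z, ρ z)` has
`μ`-mass `1`. -/
def IsRadius (μ : Measure ℂ) (ρ : ℂ → ℝ) : Prop :=
  ∀ z : ℂ, 0 < ρ z ∧ μ (ball z (ρ z)) = 1

/-- The distance induced by the metric `ρ(z)⁻² dz⊗d\bar z`: infimum of lengths of
`C¹` curves joining the two points. -/
def pathDist (ρ : ℂ → ℝ) (z ζ : ℂ) : ℝ :=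
  sInf { L : ℝ | ∃ γ : ℝ → ℂ, γ 0 = z ∧ γ 1 = ζ ∧ ContDiff ℝ 1 γ ∧
    L = ∫ t in (0:ℝ)..1, ‖deriv γ t‖ / ρ (γ t) }

/-- The `pathDist` from a point to a set. -/
def pathDistSet (ρ : ℂ → ℝ) (z : ℂ) (Λ : Set ℂ) : ℝ :=
  ⨅ l : Λ, pathDist ρ z l.1

/-- A flat weight for `φ`: a positive measurable function whose logarithm has slow
growth with respect to the induced distance. -/
def IsFlatWeight (ρ : ℂ → ℝ) (ω : ℂ → ℝ) : Prop :=
  (∀ z, 0 < ω z) ∧ Measurable ω ∧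
  ∃ C : ℝ, 0 < C ∧ ∀ z ζ : ℂ,
    |Real.log (ω z) - Real.log (ω ζ)| ≤ C * (1 + max (Real.log (pathDist ρ z ζ)) 0)

/-- The norm of the space `F^p_{φ,ω}` (with `p = ∞` giving the weighted sup norm). -/
def Fnorm (p : ℝ≥0∞) (φ ω ρ : ℂ → ℝ) (f : ℂ → ℂ) : ℝ≥0∞ :=
  if p = ∞ then ⨆ z : ℂ, ENNReal.ofReal (ω z * ‖f z‖ * Real.exp (-φ z))
  else (∫⁻ z, ENNReal.ofReal
      (‖f z‖ ^ p.toReal * Real.exp (-(p.toReal * φ z)) * ω z ^ p.toReal / ρ z ^ 2)) ^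
      (1 / p.toReal)

/-- Membership in `F^p_{φ,ω}`: entire with finite norm. -/
def MemF (p : ℝ≥0∞) (φ ω ρ : ℂ → ℝ) (f : ℂ → ℂ) : Prop :=
  Differentiable ℂ f ∧ Fnorm p φ ω ρ f < ∞

/-- The norm of the sequence space `ℓ^p_{φ,ω}(Λ)`. -/
def lnorm (p : ℝ≥0∞) (φ ω : ℂ → ℝ) (Λ : Set ℂ) (v : ℂ → ℂ) : ℝ≥0∞ :=
  if p = ∞ then ⨆ l : Λ, ENNReal.ofReal (ω l.1 * ‖v l.1‖ * Real.exp (-φ l.1))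
  else (∑' l : Λ, ENNReal.ofReal
      (ω l.1 ^ p.toReal * ‖v l.1‖ ^ p.toReal * Real.exp (-(p.toReal * φ l.1)))) ^
      (1 / p.toReal)

/-- `Λ` is a sampling sequence for `F^p_{φ,ω}`. -/
def IsSampling (p : ℝ≥0∞) (φ ω ρ : ℂ → ℝ) (Λ : Set ℂ) : Prop :=
  if p = ∞ then
    ∃ C : ℝ≥0, 0 < C ∧ ∀ f : ℂ → ℂ, MemF ∞ φ ω ρ f →
      Fnorm ∞ φ ω ρ f ≤ C * lnorm ∞ φ ω Λ f
  else
    ∃ C : ℝ≥0, 0 < C ∧ ∀ f : ℂ → ℂ, MemF p φ ω ρ f →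
      (C : ℝ≥0∞)⁻¹ * lnorm p φ ω Λ f ≤ Fnorm p φ ω ρ f ∧
      Fnorm p φ ω ρ f ≤ C * lnorm p φ ω Λ f

/-- `Λ` is an interpolating sequence for `F^p_{φ,ω}`. -/
def IsInterpolating (p : ℝ≥0∞) (φ ω ρ : ℂ → ℝ) (Λ : Set ℂ) : Prop :=
  ∀ v : ℂ → ℂ, lnorm p φ ω Λ v < ∞ →
    ∃ f : ℂ → ℂ, MemF p φ ω ρ f ∧ ∀ l ∈ Λ, f l = v l

/-- `Λ` is `ρ`-separated. -/
def RhoSeparated (ρ : ℂ → ℝ) (Λ : Set ℂ) : Prop :=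
  ∃ δ : ℝ, 0 < δ ∧ ∀ l ∈ Λ, ∀ l' ∈ Λ, l ≠ l' → δ * max (ρ l) (ρ l') ≤ dist l l'

/-- `Λ` is a finite union of `ρ`-separated sequences. -/
def FiniteUnionSeparated (ρ : ℂ → ℝ) (Λ : Set ℂ) : Prop :=
  ∃ n : ℕ, ∃ Λs : Fin n → Set ℂ, Λ = ⋃ i, Λs i ∧ ∀ i, RhoSeparated ρ (Λs i)

/-- Upper uniform density of `Λ` with respect to the doubling measure `μ`. -/
def upperUnifDensity (μ : Measure ℂ) (ρ : ℂ → ℝ) (Λ : Set ℂ) : ℝ≥0∞ :=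
  limsup (fun r : ℝ =>
    ⨆ z : ℂ, Measure.count (Λ ∩ closedBall z (r * ρ z)) / μ (ball z (r * ρ z))) atTop

/-- Lower uniform density of `Λ` with respect to the doubling measure `μ`. -/
def lowerUnifDensity (μ : Measure ℂ) (ρ : ℂ → ℝ) (Λ : Set ℂ) : ℝ≥0∞ :=
  liminf (fun r : ℝ =>
    ⨅ z : ℂ, Measure.count (Λ ∩ closedBall z (r * ρ z)) / μ (ball z (r * ρ z))) atTop

/-- The Cauchy–Riemann operator `∂̄` on `ℂ`-valued functions. -/
def dbar (v : ℂ → ℂ) (z : ℂ) : ℂ :=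
  (fderiv ℝ v z 1 + Complex.I • fderiv ℝ v z Complex.I) / 2

/-- `∂̄ u = f` in the sense of distributions. -/
def IsDistribDbarOf (u f : ℂ → ℂ) : Prop :=
  ∀ v : ℂ → ℂ, ContDiff ℝ (⊤ : ℕ∞) v → HasCompactSupport v →
    ∫ z, f z * v z = - ∫ z, u z * dbar v z

/-- Closed axis-parallel rectangle with centre `a` and half-sides `s, t`. -/
def axisRect (a : ℂ) (s t : ℝ) : Set ℂ :=
  {w : ℂ | |w.re - a.re| ≤ s ∧ |w.im - a.im| ≤ t}



/-! ### Calculus: integration by parts -/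

theorem ii_two_le : (2 : WithTop ℕ∞) ≤ ((⊤ : ℕ∞) : WithTop ℕ∞) := by
  exact WithTop.coe_le_coe.2 (le_top : (2 : ℕ∞) ≤ ⊤)

theorem ii_int_fderiv_zero {X : ℂ → ℝ} (h : ContDiff ℝ 1 X) (hc : HasCompactSupport X) (e : ℂ) :
    ∫ z, fderiv ℝ X z e = 0 := by
  have hd : Continuous fun z => fderiv ℝ X z e :=
    (h.continuous_fderiv (by norm_num)).clm_apply continuous_const
  have hi : Integrable fun z => fderiv ℝ X z e :=
    hd.integrable_of_hasCompactSupport (hc.fderiv_apply ℝ e)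
  have := integral_mul_fderiv_eq_neg_fderiv_mul_of_integrable (μ := (volume : Measure ℂ))
    (f := fun _ : ℂ => (1:ℝ)) (g := X) (v := e) (by simp) (by simpa using hi)
    (by simpa using h.continuous.integrable_of_hasCompactSupport hc)
    (fun x _ => differentiableAt_const _) (fun x _ => (h.differentiable (by norm_num)) x)
  simpa using this

theorem ii_lap_eq {v : ℂ → ℝ} (hv : ContDiff ℝ 2 v) (z : ℂ) :
    lap v z = fderiv ℝ (fun y => fderiv ℝ v y 1) z 1
      + fderiv ℝ (fun y => fderiv ℝ v y Complex.I) z Complex.I := by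
  have h1 : DifferentiableAt ℝ (fderiv ℝ v) z :=
    (hv.fderiv_right (m := 1) (by norm_num)).differentiable (by norm_num) z
  unfold lap
  rw [iteratedFDeriv_two_apply, iteratedFDeriv_two_apply,
    fderiv_clm_apply h1 (differentiableAt_const _), fderiv_clm_apply h1 (differentiableAt_const _)]
  simp

theorem ii_contDiff_dir {v : ℂ → ℝ} (hv : ContDiff ℝ (⊤ : ℕ∞) v) (e : ℂ) :
    ContDiff ℝ (⊤ : ℕ∞) (fun y => fderiv ℝ v y e) :=
  (hv.fderiv_right (m := (⊤ : ℕ∞)) (by norm_num)).clm_apply contDiff_const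

theorem ii_lap_cont {v : ℂ → ℝ} (hv : ContDiff ℝ (⊤ : ℕ∞) v) : Continuous (lap v) := by
  have : lap v = fun z => fderiv ℝ (fun y => fderiv ℝ v y 1) z 1
      + fderiv ℝ (fun y => fderiv ℝ v y Complex.I) z Complex.I := by
    funext z; exact ii_lap_eq (hv.of_le ii_two_le) z
  rw [this]
  exact (ii_contDiff_dir (ii_contDiff_dir hv 1) 1).continuous.add
    (ii_contDiff_dir (ii_contDiff_dir hv Complex.I) Complex.I).continuous

theorem ii_lap_supp {v : ℂ → ℝ} (hv : ContDiff ℝ (⊤ : ℕ∞) v) (hc : HasCompactSupport v) :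
    HasCompactSupport (lap v) := by
  have : lap v = fun z => fderiv ℝ (fun y => fderiv ℝ v y 1) z 1
      + fderiv ℝ (fun y => fderiv ℝ v y Complex.I) z Complex.I := by
    funext z; exact ii_lap_eq (hv.of_le ii_two_le) z
  rw [this]
  exact ((hc.fderiv_apply ℝ 1).fderiv_apply ℝ 1).add
    ((hc.fderiv_apply ℝ Complex.I).fderiv_apply ℝ Complex.I)

theorem ii_hasFDerivAt_normSq (w z : ℂ) :
    HasFDerivAt (fun z : ℂ => ‖z - w‖ ^ 2) (2 • innerSL ℝ (z - w)) z := by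
  have := ((hasStrictFDerivAt_norm_sq (z - w)).hasFDerivAt).comp z
    ((hasFDerivAt_id z).sub_const w)
  simpa [Function.comp_def] using this

theorem ii_ibp_dir {g k k' : ℝ → ℝ} (hg : ∀ t, 0 ≤ t → HasDerivAt g (k t) t)
    (hk : ∀ t, 0 ≤ t → HasDerivAt k (k' t) t) (hk' : ContinuousOn k' (Ici 0))
    {v : ℂ → ℝ} (hv : ContDiff ℝ (⊤ : ℕ∞) v) (hc : HasCompactSupport v) (w e : ℂ) :
    ∫ z, g (‖z - w‖ ^ 2) * fderiv ℝ (fun y => fderiv ℝ v y e) z e =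
      ∫ z, (4 * k' (‖z - w‖ ^ 2) * (inner ℝ (z - w) e) ^ 2
        + 2 * k (‖z - w‖ ^ 2) * ‖e‖ ^ 2) * v z := by
  have hsq : Continuous fun z : ℂ => ‖z - w‖ ^ 2 := by fun_prop
  have hin : Continuous fun z : ℂ => (inner ℝ (z - w) e : ℝ) := by fun_prop
  have cg : Continuous fun z : ℂ => g (‖z - w‖ ^ 2) := by
    have : ContinuousOn g (Ici 0) := fun t ht => (hg t ht).continuousAt.continuousWithinAt
    exact this.comp_continuous hsq (fun z => by simp)
  have ck : Continuous fun z : ℂ => k (‖z - w‖ ^ 2) := by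
    have : ContinuousOn k (Ici 0) := fun t ht => (hk t ht).continuousAt.continuousWithinAt
    exact this.comp_continuous hsq (fun z => by simp)
  have ck' : Continuous fun z : ℂ => k' (‖z - w‖ ^ 2) :=
    hk'.comp_continuous hsq (fun z => by simp)
  have dg : ∀ z : ℂ, HasFDerivAt (fun z : ℂ => g (‖z - w‖ ^ 2))
      (k (‖z - w‖ ^ 2) • (2 • innerSL ℝ (z - w))) z := fun z =>
    (hg _ (by positivity)).comp_hasFDerivAt z (ii_hasFDerivAt_normSq w z)
  have dg' : ∀ z : ℂ, fderiv ℝ (fun z : ℂ => g (‖z - w‖ ^ 2)) z e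
      = k (‖z - w‖ ^ 2) * (2 * inner ℝ (z - w) e) := fun z => by
    rw [(dg z).fderiv]
    simp only [_root_.smul_apply, innerSL_apply_apply, smul_eq_mul, nsmul_eq_mul,
      Nat.cast_ofNat]
  have dk : ∀ z : ℂ, HasFDerivAt (fun z : ℂ => k (‖z - w‖ ^ 2))
      (k' (‖z - w‖ ^ 2) • (2 • innerSL ℝ (z - w))) z := fun z =>
    (hk _ (by positivity)).comp_hasFDerivAt z (ii_hasFDerivAt_normSq w z)
  have din : ∀ z : ℂ, HasFDerivAt (fun z : ℂ => 2 * (inner ℝ (z - w) e : ℝ))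
      ((2:ℝ) • innerSL ℝ e) z := fun z => by
    have : (fun z : ℂ => 2 * (inner ℝ (z - w) e : ℝ))
        = fun z => 2 * (innerSL ℝ e z - innerSL ℝ e w) := by
      funext y; simp only [innerSL_apply_apply]
      rw [← inner_sub_right, real_inner_comm]
    rw [this]
    exact (((innerSL ℝ e).hasFDerivAt).sub_const _).const_mul 2
  have dkk : ∀ z : ℂ, HasFDerivAt (fun z : ℂ => k (‖z - w‖ ^ 2) * (2 * (inner ℝ (z - w) e : ℝ)))
      (k (‖z - w‖ ^ 2) • ((2:ℝ) • innerSL ℝ e) +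
        (2 * (inner ℝ (z - w) e : ℝ)) • (k' (‖z - w‖ ^ 2) • (2 • innerSL ℝ (z - w)))) z :=
    fun z => (dk z).mul (din z)
  have dkk' : ∀ z : ℂ, fderiv ℝ (fun z : ℂ => k (‖z - w‖ ^ 2) * (2 * (inner ℝ (z - w) e : ℝ))) z e
      = 4 * k' (‖z - w‖ ^ 2) * (inner ℝ (z - w) e) ^ 2 + 2 * k (‖z - w‖ ^ 2) * ‖e‖ ^ 2 :=
    fun z => by
      rw [(dkk z).fderiv]
      simp
      ring
  have v1 := ii_contDiff_dir hv e
  have v2 := ii_contDiff_dir v1 e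
  have c1 : HasCompactSupport fun y => fderiv ℝ v y e := hc.fderiv_apply ℝ e
  have c2 : HasCompactSupport fun z => fderiv ℝ (fun y => fderiv ℝ v y e) z e :=
    c1.fderiv_apply ℝ e
  have E1 := integral_mul_fderiv_eq_neg_fderiv_mul_of_integrable (μ := (volume : Measure ℂ))
    (f := fun z : ℂ => g (‖z - w‖ ^ 2)) (g := fun y => fderiv ℝ v y e) (v := e)
    (by
      simp only [dg']
      exact ((ck.mul (continuous_const.mul hin)).mul v1.continuous).integrable_of_hasCompactSupport
        c1.mul_left)
    ((cg.mul v2.continuous).integrable_of_hasCompactSupport c2.mul_left)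
    ((cg.mul v1.continuous).integrable_of_hasCompactSupport c1.mul_left)
    (fun x _ => (dg x).differentiableAt) (fun x _ => v1.differentiable (by simp) x)
  have E2 := integral_mul_fderiv_eq_neg_fderiv_mul_of_integrable (μ := (volume : Measure ℂ))
    (f := fun z : ℂ => k (‖z - w‖ ^ 2) * (2 * (inner ℝ (z - w) e : ℝ))) (g := v) (v := e)
    (by
      simp only [dkk']
      exact Continuous.integrable_of_hasCompactSupport
        ((((continuous_const.mul ck').mul (hin.pow 2)).add
          ((continuous_const.mul ck).mul continuous_const)).mul hv.continuous) hc.mul_left)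
    (((ck.mul (continuous_const.mul hin)).mul v1.continuous).integrable_of_hasCompactSupport
        c1.mul_left)
    (((ck.mul (continuous_const.mul hin)).mul hv.continuous).integrable_of_hasCompactSupport
        hc.mul_left)
    (fun x _ => (dkk x).differentiableAt) (fun x _ => hv.differentiable (by simp) x)
  rw [E1]
  simp only [dg', dkk'] at E2 ⊢
  rw [E2, neg_neg]

theorem ii_ibp_radial {g k k' : ℝ → ℝ} (hg : ∀ t, 0 ≤ t → HasDerivAt g (k t) t)
    (hk : ∀ t, 0 ≤ t → HasDerivAt k (k' t) t) (hk' : ContinuousOn k' (Ici 0))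
    {v : ℂ → ℝ} (hv : ContDiff ℝ (⊤ : ℕ∞) v) (hc : HasCompactSupport v) (w : ℂ) :
    ∫ z, g (‖z - w‖ ^ 2) * lap v z =
      ∫ z, (4 * (k (‖z - w‖ ^ 2) + ‖z - w‖ ^ 2 * k' (‖z - w‖ ^ 2))) * v z := by
  have hsq : Continuous fun z : ℂ => ‖z - w‖ ^ 2 := by fun_prop
  have cg : Continuous fun z : ℂ => g (‖z - w‖ ^ 2) := by
    have : ContinuousOn g (Ici 0) := fun t ht => (hg t ht).continuousAt.continuousWithinAt
    exact this.comp_continuous hsq (fun z => by simp)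
  have ck : Continuous fun z : ℂ => k (‖z - w‖ ^ 2) := by
    have : ContinuousOn k (Ici 0) := fun t ht => (hk t ht).continuousAt.continuousWithinAt
    exact this.comp_continuous hsq (fun z => by simp)
  have ck' : Continuous fun z : ℂ => k' (‖z - w‖ ^ 2) :=
    hk'.comp_continuous hsq (fun z => by simp)
  have cv := hv.continuous
  have i1 : ∀ e : ℂ, Integrable fun z => g (‖z - w‖ ^ 2) * fderiv ℝ (fun y => fderiv ℝ v y e) z e :=
    fun e => (cg.mul (ii_contDiff_dir (ii_contDiff_dir hv e) e).continuous
      ).integrable_of_hasCompactSupport ((hc.fderiv_apply ℝ e).fderiv_apply ℝ e).mul_left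
  have i2 : ∀ e : ℂ, Integrable fun z => (4 * k' (‖z - w‖ ^ 2) * (inner ℝ (z - w) e) ^ 2
        + 2 * k (‖z - w‖ ^ 2) * ‖e‖ ^ 2) * v z := fun e =>
    Continuous.integrable_of_hasCompactSupport
        ((((continuous_const.mul ck').mul
          ((by fun_prop : Continuous fun z : ℂ => (inner ℝ (z - w) e : ℝ)).pow 2)).add
          ((continuous_const.mul ck).mul continuous_const)).mul hv.continuous) hc.mul_left
  simp only [ii_lap_eq (hv.of_le ii_two_le), mul_add]
  rw [integral_add (i1 1) (i1 Complex.I), ii_ibp_dir hg hk hk' hv hc,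
    ii_ibp_dir hg hk hk' hv hc, ← integral_add (i2 1) (i2 Complex.I)]
  congr 1; funext z
  have : ‖z - w‖ ^ 2 = (z - w).re ^ 2 + (z - w).im ^ 2 := by
    rw [← Complex.normSq_eq_norm_sq, Complex.normSq_apply]; ring
  have h1 : (inner ℝ (z - w) 1 : ℝ) = (z - w).re := by simp [Complex.inner]
  have h2 : (inner ℝ (z - w) Complex.I : ℝ) = (z - w).im := by
    simp only [Complex.inner, map_sub, Complex.mul_re, Complex.I_re, Complex.I_im, Complex.sub_re,
      Complex.sub_im, Complex.conj_re, Complex.conj_im]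
    ring
  rw [h1, h2, norm_one, Complex.norm_I]
  linear_combination (-4 * k' (‖z - w‖ ^ 2) * v z) * this


/-! ### The logarithmic kernel -/

theorem ii_log_integrable_ball (R : ℝ) :
    Integrable (fun z : ℂ => (Iio R).indicator Real.log ‖z‖) := by
  rw [integrable_fun_norm_addHaar (volume : Measure ℂ) (f := (Iio R).indicator Real.log)]
  have h1 : IntegrableOn (fun y : ℝ => y * Real.log y) (Ioo 0 R) :=
    (Real.continuous_mul_log.continuousOn.integrableOn_compact isCompact_Icc).mono_set
      Ioo_subset_Icc_self
  have h2 : (fun y : ℝ => y ^ (Module.finrank ℝ ℂ - 1) • (Iio R).indicator Real.log y)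
      = (Iio R).indicator (fun y : ℝ => y * Real.log y) := by
    funext y
    by_cases hy : y ∈ Iio R
    · simp [hy]
    · simp [hy]
  rw [h2, IntegrableOn, integrable_indicator_iff measurableSet_Iio, IntegrableOn,
    Measure.restrict_restrict measurableSet_Iio]
  rw [show Iio R ∩ Ioi 0 = Ioo 0 R by ext; simp [and_comm]]
  exact h1

theorem ii_log_mul_integrable {u : ℂ → ℝ} (hu : Continuous u) (hc : HasCompactSupport u) (w : ℂ) :
    Integrable (fun z : ℂ => Real.log ‖z - w‖ * u z) := by
  obtain ⟨R, hR⟩ := (hc.isCompact.isBounded).subset_ball w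
  have h1 : Integrable (fun z : ℂ => (Iio R).indicator Real.log ‖z - w‖) :=
    (ii_log_integrable_ball R).comp_sub_right w
  obtain ⟨C, hC⟩ := hu.bounded_above_of_compact_support hc
  have h2 := h1.mul_bdd (c := C) hu.aestronglyMeasurable (Eventually.of_forall hC)
  refine h2.congr (Eventually.of_forall fun z => ?_)
  by_cases hz : z ∈ tsupport u
  · have := hR hz
    rw [mem_ball, dist_eq_norm] at this
    simp [this]
  · simp [image_eq_zero_of_notMem_tsupport hz]

theorem ii_int_kernel : ∫ y : ℂ, (1 / π) * (1 / (‖y‖ ^ 2 + 1) ^ 2) = 1 := by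
  rw [integral_const_mul]
  have := integral_fun_norm_addHaar (volume : Measure ℂ) (fun r : ℝ => 1 / (r ^ 2 + 1) ^ 2)
  rw [this]
  have h2 : ∫ y in Ioi (0:ℝ), y * (1 / (y ^ 2 + 1) ^ 2) = 0 - (-(1/2) * (0 ^ 2 + 1 : ℝ)⁻¹) := by
    refine integral_Ioi_of_hasDerivAt_of_nonneg (g := fun y : ℝ => -(1/2) * (y ^ 2 + 1)⁻¹)
      ?_ ?_ ?_ ?_
    · refine Continuous.continuousWithinAt ?_
      exact continuous_const.mul (Continuous.inv₀ (by fun_prop) (fun x => by positivity))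
    · intro x hx
      have h : HasDerivAt (fun y : ℝ => y ^ 2 + 1) (2 * x) x := by
        simpa using (hasDerivAt_pow 2 x).add_const 1
      convert! (h.inv (by positivity)).const_mul (-(1/2)) using 1
      field_simp
    · intro x hx
      have : 0 < x := hx
      positivity
    · have : Tendsto (fun y : ℝ => (y ^ 2 + 1)⁻¹) atTop (𝓝 0) :=
        tendsto_inv_atTop_zero.comp
          (tendsto_atTop_add_const_right _ _ (tendsto_pow_atTop two_ne_zero))
      (have t := this.const_mul (-(1/2)); rw [mul_zero] at t; exact t)
  simp only [Complex.finrank_real_complex, Nat.add_one_sub_one, pow_one, smul_eq_mul, Measure.real,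
    Complex.volume_ball]
  rw [h2]
  simp
  field_simp

theorem ii_fund (v : ℂ → ℝ) (hv : ContDiff ℝ (⊤ : ℕ∞) v) (hc : HasCompactSupport v) (w : ℂ) :
    ∫ z, Real.log (‖z - w‖ ^ 2) * lap v z = 4 * π * v w := by
  have hl := ii_lap_cont hv
  have hlc := ii_lap_supp hv hc
  -- left-hand sides converge
  have L : Tendsto (fun c : ℝ => ∫ z, Real.log (‖z - w‖ ^ 2 + (c ^ 2)⁻¹) * lap v z) atTop
      (𝓝 (∫ z, Real.log (‖z - w‖ ^ 2) * lap v z)) := by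
    refine tendsto_integral_filter_of_dominated_convergence
      (fun z => |2 * (Real.log ‖z - w‖ * lap v z)| + Real.log (‖z - w‖ ^ 2 + 1) * |lap v z|)
      ?_ ?_ ?_ ?_
    · filter_upwards [eventually_gt_atTop (0:ℝ)] with c hc0
      refine Continuous.aestronglyMeasurable (Continuous.mul ?_ hl)
      exact Continuous.log (by fun_prop) (fun z => by positivity)
    · filter_upwards [eventually_ge_atTop (1:ℝ)] with c hc0
      filter_upwards [compl_mem_ae_iff.2 (measure_singleton w)] with z hz
      have hz0 : 0 < ‖z - w‖ := norm_pos_iff.2 (sub_ne_zero.2 (by simpa using hz))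
      have e1 : Real.log (‖z - w‖ ^ 2) = 2 * Real.log ‖z - w‖ := by simp
      have hc1 : (c ^ 2)⁻¹ ≤ 1 := inv_le_one_of_one_le₀ (one_le_pow₀ hc0)
      have hc2 : 0 < (c ^ 2)⁻¹ := by positivity
      have a1 : Real.log (‖z - w‖ ^ 2) ≤ Real.log (‖z - w‖ ^ 2 + (c ^ 2)⁻¹) :=
        Real.log_le_log (by positivity) (by linarith)
      have a2 : Real.log (‖z - w‖ ^ 2 + (c ^ 2)⁻¹) ≤ Real.log (‖z - w‖ ^ 2 + 1) :=
        Real.log_le_log (by positivity) (by linarith)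
      have a3 : 0 ≤ Real.log (‖z - w‖ ^ 2 + 1) := Real.log_nonneg (by nlinarith)
      have a4 : |Real.log (‖z - w‖ ^ 2 + (c ^ 2)⁻¹)|
          ≤ |2 * Real.log ‖z - w‖| + Real.log (‖z - w‖ ^ 2 + 1) := by
        rw [← e1]
        refine abs_le.2 ⟨?_, ?_⟩
        · have := neg_abs_le (Real.log (‖z - w‖ ^ 2)); linarith
        · have := abs_nonneg (Real.log (‖z - w‖ ^ 2)); linarith
      rw [Real.norm_eq_abs, abs_mul, ← mul_assoc, abs_mul (2 * _), ← add_mul]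
      gcongr
    · refine ((ii_log_mul_integrable hl hlc w).const_mul 2).abs.add ?_
      refine Continuous.integrable_of_hasCompactSupport
        (Continuous.mul (Continuous.log (by fun_prop) (fun z => by positivity)) hl.abs) ?_
      exact HasCompactSupport.mul_left (hlc.comp_left (g := fun x : ℝ => |x|) abs_zero)
    · filter_upwards [compl_mem_ae_iff.2 (measure_singleton w)] with z hz
      have hz0 : 0 < ‖z - w‖ := norm_pos_iff.2 (sub_ne_zero.2 (by simpa using hz))
      refine Tendsto.mul_const _ ?_
      have : Tendsto (fun c : ℝ => ‖z - w‖ ^ 2 + (c ^ 2)⁻¹) atTop (𝓝 (‖z - w‖ ^ 2 + 0)) :=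
        tendsto_const_nhds.add (tendsto_inv_atTop_zero.comp (tendsto_pow_atTop two_ne_zero))
      rw [add_zero] at this
      exact this.log (by positivity)
  have R : Tendsto (fun c : ℝ => ∫ z, Real.log (‖z - w‖ ^ 2 + (c ^ 2)⁻¹) * lap v z) atTop
      (𝓝 (4 * π * v w)) := by
    have P := tendsto_integral_comp_smul_smul_of_integrable' (μ := (volume : Measure ℂ))
      (φ := fun y : ℂ => (1 / π) * (1 / (‖y‖ ^ 2 + 1) ^ 2)) (fun y => by positivity) ii_int_kernel
      (by
        have h1 : Tendsto (fun y : ℂ => ‖y‖ ^ 2) (Bornology.cobounded ℂ) atTop :=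
          (tendsto_pow_atTop two_ne_zero).comp tendsto_norm_cobounded_atTop
        have h2 : Tendsto (fun t : ℝ => (1 / π) * (t + 1)⁻¹) atTop (𝓝 ((1 / π) * 0)) :=
          (tendsto_inv_atTop_zero.comp (tendsto_atTop_add_const_right _ _ tendsto_id)).const_mul _
        rw [mul_zero] at h2
        refine squeeze_zero (fun y => by positivity) (fun y => ?_) (h2.comp h1)
        simp only [Complex.finrank_real_complex, Function.comp]
        rw [mul_left_comm]
        gcongr
        rw [mul_one_div, div_le_iff₀ (by positivity), sq (‖y‖ ^ 2 + 1), inv_mul_cancel_left₀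
          (by positivity)]
        linarith)
      (g := v) (x₀ := w) (hv.continuous.integrable_of_hasCompactSupport hc)
      hv.continuous.continuousAt
    refine (P.const_mul (4 * π)).congr' ?_
    filter_upwards [eventually_gt_atTop (0:ℝ)] with c hc0
    have I := ii_ibp_radial (g := fun t => Real.log (t + (c ^ 2)⁻¹))
      (k := fun t => (t + (c ^ 2)⁻¹)⁻¹) (k' := fun t => - ((t + (c ^ 2)⁻¹) ^ 2)⁻¹)
      (fun t ht => by
        have : HasDerivAt (fun t : ℝ => t + (c ^ 2)⁻¹) 1 t := (hasDerivAt_id t).add_const _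
        simpa using this.log (by positivity))
      (fun t ht => by
        have : HasDerivAt (fun t : ℝ => t + (c ^ 2)⁻¹) 1 t := (hasDerivAt_id t).add_const _
        convert! this.inv (by positivity) using 1
        field_simp)
      (by
        refine ContinuousOn.neg (ContinuousOn.inv₀ (by fun_prop) fun t ht => ?_)
        have : 0 ≤ t := ht
        positivity) hv hc w
    rw [I, ← integral_const_mul]
    congr 1; funext z
    simp only [Complex.finrank_real_complex, smul_eq_mul, norm_smul, norm_sub_rev w z,
      Real.norm_of_nonneg hc0.le]
    field_simp
    ring
  exact tendsto_nhds_unique L R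


/-! ### The basic inequality -/

theorem ii_symm {v : ℂ → ℝ} (hv : ContDiff ℝ (⊤ : ℕ∞) v) (z : ℂ) :
    fderiv ℝ (fun y => fderiv ℝ v y 1) z Complex.I
      = fderiv ℝ (fun y => fderiv ℝ v y Complex.I) z 1 := by
  have h1 : DifferentiableAt ℝ (fderiv ℝ v) z :=
    ((hv.of_le ii_two_le).fderiv_right (m := 1) (by norm_num)).differentiable (by norm_num) z
  have := (hv.contDiffAt (x := z)).isSymmSndFDerivAt
    (by simp only [minSmoothness_of_isRCLikeNormedField]; exact ii_two_le)
  rw [fderiv_clm_apply h1 (differentiableAt_const _), fderiv_clm_apply h1 (differentiableAt_const _)]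
  simpa using this.eq Complex.I 1

theorem ii_basic {a b V : ℂ → ℝ} (ha : ContDiff ℝ (⊤ : ℕ∞) a) (hb : ContDiff ℝ (⊤ : ℕ∞) b)
    (hV : ContDiff ℝ (⊤ : ℕ∞) V) (hac : HasCompactSupport a) (hbc : HasCompactSupport b) :
    ∫ z, Real.exp (V z) * (a z ^ 2 + b z ^ 2) * lap V z ≤
      ∫ z, Real.exp (V z) * ((fderiv ℝ a z 1 - fderiv ℝ b z Complex.I) ^ 2
        + (fderiv ℝ b z 1 + fderiv ℝ a z Complex.I) ^ 2) := by
  have a1 := ii_contDiff_dir ha 1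
  have a2 := ii_contDiff_dir ha Complex.I
  have b1 := ii_contDiff_dir hb 1
  have b2 := ii_contDiff_dir hb Complex.I
  have v1 := ii_contDiff_dir hV 1
  have v2 := ii_contDiff_dir hV Complex.I
  have hE : ContDiff ℝ (⊤ : ℕ∞) fun z => Real.exp (V z) := hV.exp
  set X : ℂ → ℝ := fun z => (-(a z * a z + b z * b z) * fderiv ℝ V z 1
    - 2 * (fderiv ℝ b z Complex.I * a z - fderiv ℝ a z Complex.I * b z)) * Real.exp (V z) with hX
  set Y : ℂ → ℝ := fun z => (-(a z * a z + b z * b z) * fderiv ℝ V z Complex.I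
    + 2 * (fderiv ℝ b z 1 * a z - fderiv ℝ a z 1 * b z)) * Real.exp (V z) with hY
  have cX : ContDiff ℝ (⊤ : ℕ∞) X := by
    exact ((((ha.mul ha).add (hb.mul hb)).neg.mul v1).sub
      (contDiff_const.mul ((b2.mul ha).sub (a2.mul hb)))).mul hE
  have cY : ContDiff ℝ (⊤ : ℕ∞) Y := by
    exact ((((ha.mul ha).add (hb.mul hb)).neg.mul v2).add
      (contDiff_const.mul ((b1.mul ha).sub (a1.mul hb)))).mul hE
  have sX : HasCompactSupport X := by
    refine HasCompactSupport.mul_right (HasCompactSupport.sub (HasCompactSupport.mul_right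
      (HasCompactSupport.neg (hac.mul_left.add hbc.mul_left))) (HasCompactSupport.mul_left
      (HasCompactSupport.sub hac.mul_left hbc.mul_left)))
  have sY : HasCompactSupport Y := by
    refine HasCompactSupport.mul_right (HasCompactSupport.add (HasCompactSupport.mul_right
      (HasCompactSupport.neg (hac.mul_left.add hbc.mul_left))) (HasCompactSupport.mul_left
      (HasCompactSupport.sub hac.mul_left hbc.mul_left)))
  have h1le : (1 : WithTop ℕ∞) ≤ ((⊤ : ℕ∞) : WithTop ℕ∞) :=
    WithTop.coe_le_coe.2 (le_top : (1 : ℕ∞) ≤ ⊤)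
  have iX := ii_int_fderiv_zero (cX.of_le h1le) sX 1
  have iY := ii_int_fderiv_zero (cY.of_le h1le) sY Complex.I
  have dd : ∀ {f : ℂ → ℝ}, ContDiff ℝ (⊤ : ℕ∞) f → ∀ z, HasFDerivAt f (fderiv ℝ f z) z :=
    fun h z => (h.differentiable (by simp) z).hasFDerivAt
  have key : ∀ z, fderiv ℝ X z 1 + fderiv ℝ Y z Complex.I =
      Real.exp (V z) * ((fderiv ℝ a z 1 - fderiv ℝ b z Complex.I) ^ 2
        + (fderiv ℝ b z 1 + fderiv ℝ a z Complex.I) ^ 2)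
      - Real.exp (V z) * ((fderiv ℝ a z 1 + fderiv ℝ b z Complex.I + fderiv ℝ V z 1 * a z
          + fderiv ℝ V z Complex.I * b z) ^ 2
        + (fderiv ℝ b z 1 - fderiv ℝ a z Complex.I + fderiv ℝ V z 1 * b z
          - fderiv ℝ V z Complex.I * a z) ^ 2)
      - Real.exp (V z) * (a z ^ 2 + b z ^ 2) * lap V z := by
    intro z
    have A := dd ha z
    have B := dd hb z
    have E := (dd hV z).exp
    have hXd := (((((A.mul A).add (B.mul B)).neg.mul (dd v1 z)).sub
      ((((dd b2 z).mul A).sub ((dd a2 z).mul B)).const_mul 2)).mul E)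
    have hYd := (((((A.mul A).add (B.mul B)).neg.mul (dd v2 z)).add
      ((((dd b1 z).mul A).sub ((dd a1 z).mul B)).const_mul 2)).mul E)
    have e1 : fderiv ℝ X z = _ := HasFDerivAt.fderiv hXd
    have e2 : fderiv ℝ Y z = _ := HasFDerivAt.fderiv hYd
    rw [e1, e2, ii_lap_eq (hV.of_le ii_two_le)]
    have sa := ii_symm ha z
    have sb := ii_symm hb z
    simp only [_root_.add_apply, _root_.sub_apply,
      _root_.neg_apply, _root_.smul_apply, smul_eq_mul, Pi.mul_apply, Pi.add_apply,
      Pi.neg_apply, Pi.sub_apply]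
    rw [sa, sb]
    ring
  have c0 : ∀ {f : ℂ → ℝ}, ContDiff ℝ (⊤ : ℕ∞) f → ∀ e, Continuous fun z => fderiv ℝ f z e :=
    fun h e => (ii_contDiff_dir h e).continuous
  have I1 : Integrable fun z => Real.exp (V z) * ((fderiv ℝ a z 1 - fderiv ℝ b z Complex.I) ^ 2
        + (fderiv ℝ b z 1 + fderiv ℝ a z Complex.I) ^ 2) := by
    refine Continuous.integrable_of_hasCompactSupport
      (hE.continuous.mul ((((c0 ha 1).sub (c0 hb _)).pow 2).add
        (((c0 hb 1).add (c0 ha _)).pow 2))) ?_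
    refine HasCompactSupport.mul_left (HasCompactSupport.add ?_ ?_)
    · exact HasCompactSupport.comp_left (g := fun t : ℝ => t ^ 2)
        (HasCompactSupport.sub (hac.fderiv_apply ℝ 1) (hbc.fderiv_apply ℝ Complex.I)) (by simp)
    · exact HasCompactSupport.comp_left (g := fun t : ℝ => t ^ 2)
        (HasCompactSupport.add (hbc.fderiv_apply ℝ 1) (hac.fderiv_apply ℝ Complex.I)) (by simp)
  have I2 : Integrable fun z => Real.exp (V z) * (a z ^ 2 + b z ^ 2) * lap V z := by
    refine Continuous.integrable_of_hasCompactSupport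
      ((hE.continuous.mul ((ha.continuous.pow 2).add (hb.continuous.pow 2))).mul
        (ii_lap_cont hV)) ?_
    refine HasCompactSupport.mul_right (HasCompactSupport.mul_left (HasCompactSupport.add ?_ ?_))
    · exact HasCompactSupport.comp_left (g := fun t : ℝ => t ^ 2) hac (by simp)
    · exact HasCompactSupport.comp_left (g := fun t : ℝ => t ^ 2) hbc (by simp)
  have I3 : Integrable fun z => fderiv ℝ X z 1 :=
    (c0 cX 1).integrable_of_hasCompactSupport (sX.fderiv_apply ℝ 1)
  have I4 : Integrable fun z => fderiv ℝ Y z Complex.I :=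
    (c0 cY _).integrable_of_hasCompactSupport (sY.fderiv_apply ℝ _)
  have : ∫ z, (fderiv ℝ X z 1 + fderiv ℝ Y z Complex.I) ≤
      ∫ z, (Real.exp (V z) * ((fderiv ℝ a z 1 - fderiv ℝ b z Complex.I) ^ 2
        + (fderiv ℝ b z 1 + fderiv ℝ a z Complex.I) ^ 2)
      - Real.exp (V z) * (a z ^ 2 + b z ^ 2) * lap V z) := by
    refine integral_mono (I3.add I4) (I1.sub I2) (fun z => ?_)
    simp only [key z]
    have : 0 ≤ Real.exp (V z) * ((fderiv ℝ a z 1 + fderiv ℝ b z Complex.I + fderiv ℝ V z 1 * a z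
          + fderiv ℝ V z Complex.I * b z) ^ 2
        + (fderiv ℝ b z 1 - fderiv ℝ a z Complex.I + fderiv ℝ V z 1 * b z
          - fderiv ℝ V z Complex.I * a z) ^ 2) := by positivity
    linarith
  rw [integral_add I3 I4, iX, iY, integral_sub I1 I2] at this
  linarith

theorem ii_mol {E : Type*} [NormedAddCommGroup E] [NormedSpace ℝ E] [CompleteSpace E]
    {F : ℂ → E} (hF : LocallyIntegrable F) {χ : ℂ → ℝ}
    (hχ : ContDiff ℝ (⊤ : ℕ∞) χ) (hc : HasCompactSupport χ) :
    ContDiff ℝ (⊤ : ℕ∞) (fun z => ∫ t, χ (z - t) • F t) ∧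
    ∀ z e, fderiv ℝ (fun z => ∫ t, χ (z - t) • F t) z e = ∫ t, (fderiv ℝ χ (z - t) e) • F t := by
  set L : E →L[ℝ] ℝ →L[ℝ] E := (ContinuousLinearMap.lsmul ℝ ℝ).flip with hL
  have e : (fun z => ∫ t, χ (z - t) • F t) = convolution F χ L volume := by
    funext z; rfl
  rw [e]
  refine ⟨hc.contDiff_convolution_right L hF hχ, fun z v => ?_⟩
  have h1 : ContDiff ℝ 1 χ := hχ.of_le (WithTop.coe_le_coe.2 (le_top : (1 : ℕ∞) ≤ ⊤))
  rw [(hc.hasFDerivAt_convolution_right L hF h1 z).fderiv,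
    convolution_precompR_apply L hF (hc.fderiv ℝ) (h1.continuous_fderiv (by norm_num)) z v]
  rfl

theorem ii_fderiv_const_sub {χ : ℂ → ℝ} (hχ : ContDiff ℝ (⊤ : ℕ∞) χ) (z t e : ℂ) :
    fderiv ℝ (fun t => χ (z - t)) t e = - fderiv ℝ χ (z - t) e := by
  have h : HasFDerivAt (fun t : ℂ => z - t) (-ContinuousLinearMap.id ℝ ℂ) t :=
    (hasFDerivAt_id t).const_sub z
  have := ((hχ.differentiable (by simp) (z - t)).hasFDerivAt).comp t h
  rw [show (fun t => χ (z - t)) = χ ∘ (fun t => z - t) from rfl, this.fderiv]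
  simp

theorem ii_lap_const_sub {χ : ℂ → ℝ} (hχ : ContDiff ℝ (⊤ : ℕ∞) χ) (z t : ℂ) :
    lap (fun t => χ (z - t)) t = lap χ (z - t) := by
  have h2 : ContDiff ℝ (⊤ : ℕ∞) (fun t => χ (z - t)) := hχ.comp (contDiff_const.sub contDiff_id)
  rw [ii_lap_eq (h2.of_le ii_two_le), ii_lap_eq (hχ.of_le ii_two_le)]
  simp only [ii_fderiv_const_sub hχ]
  rw [fderiv_fun_neg, fderiv_fun_neg]
  simp only [_root_.neg_apply]
  rw [ii_fderiv_const_sub (ii_contDiff_dir hχ 1), ii_fderiv_const_sub (ii_contDiff_dir hχ _)]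
  ring

theorem ii_supp_const_sub {E : Type*} [Zero E] {χ : ℂ → E} (hc : HasCompactSupport χ) (z : ℂ) :
    HasCompactSupport (fun t => χ (z - t)) := 
  hc.comp_homeomorph (Homeomorph.subLeft z)

theorem ii_mol_lap {V : ℂ → ℝ} (hF : LocallyIntegrable V) {χ : ℂ → ℝ}
    (hχ : ContDiff ℝ (⊤ : ℕ∞) χ) (hc : HasCompactSupport χ) (z : ℂ) :
    lap (fun z => ∫ t, χ (z - t) • V t) z = ∫ t, V t * lap (fun t => χ (z - t)) t := by
  obtain ⟨h1, h2⟩ := ii_mol hF hχ hc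
  rw [ii_lap_eq (h1.of_le ii_two_le)]
  simp only [h2]
  rw [(ii_mol hF (ii_contDiff_dir hχ 1) (hc.fderiv_apply ℝ 1)).2,
    (ii_mol hF (ii_contDiff_dir hχ Complex.I) (hc.fderiv_apply ℝ Complex.I)).2,
    ← integral_add]
  · congr 1; funext t
    rw [ii_lap_const_sub hχ, ii_lap_eq (hχ.of_le ii_two_le)]
    simp only [smul_eq_mul]; ring
  · exact hF.integrable_smul_left_of_hasCompactSupport
      ((ii_contDiff_dir (ii_contDiff_dir hχ 1) 1).continuous.comp (continuous_const.sub continuous_id))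
      (ii_supp_const_sub ((hc.fderiv_apply ℝ 1).fderiv_apply ℝ 1) z)
  · exact hF.integrable_smul_left_of_hasCompactSupport
      ((ii_contDiff_dir (ii_contDiff_dir hχ _) _).continuous.comp (continuous_const.sub continuous_id))
      (ii_supp_const_sub ((hc.fderiv_apply ℝ _).fderiv_apply ℝ _) z)

/-- A sequence of bump functions. -/
def ii_bump (n : ℕ) : ContDiffBump (0 : ℂ) :=
  ⟨1 / (2 * (n + 1)), 1 / (n + 1), by positivity, by
    apply one_div_lt_one_div_of_lt <;> linarith [(Nat.cast_nonneg n : (0:ℝ) ≤ n)]⟩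

/-- The normalised bump functions. -/
def ii_chi (n : ℕ) : ℂ → ℝ := (ii_bump n).normed volume

theorem ii_chi_smooth (n : ℕ) : ContDiff ℝ (⊤ : ℕ∞) (ii_chi n) := (ii_bump n).contDiff_normed
theorem ii_chi_supp (n : ℕ) : HasCompactSupport (ii_chi n) := (ii_bump n).hasCompactSupport_normed
theorem ii_chi_nonneg (n : ℕ) (z : ℂ) : 0 ≤ ii_chi n z := (ii_bump n).nonneg_normed z
theorem ii_chi_int (n : ℕ) : ∫ z, ii_chi n z = 1 := (ii_bump n).integral_normed
theorem ii_chi_zero (n : ℕ) {z : ℂ} (h : 1 / ((n : ℝ) + 1) ≤ ‖z‖) : ii_chi n z = 0 := by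
  have := (ii_bump n).support_normed_eq (μ := volume)
  by_contra h0
  have h1 : z ∈ Function.support ((ii_bump n).normed volume) := h0
  rw [this] at h1
  simp [ii_bump] at h1 h
  linarith

theorem ii_chi_int_sub (n : ℕ) (z : ℂ) : ∫ t, ii_chi n (z - t) = 1 := by
  rw [integral_sub_left_eq_self (ii_chi n) volume z, ii_chi_int]

theorem ii_chi_tendsto {E : Type*} [NormedAddCommGroup E] [NormedSpace ℝ E] [CompleteSpace E]
    {F : ℂ → E} (hF : LocallyIntegrable F) :
    ∀ᵐ z, Tendsto (fun n => ∫ t, ii_chi n (z - t) • F t) atTop (𝓝 (F z)) := by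
  have := ContDiffBump.ae_convolution_tendsto_right_of_locallyIntegrable (μ := (volume : Measure ℂ))
    (φ := ii_bump) (l := atTop) (K := 2) (g := F)
    (by simpa [ii_bump] using tendsto_one_div_add_atTop_nhds_zero_nat (𝕜 := ℝ))
    (Eventually.of_forall fun n => by
      simp only [ii_bump]; rw [← sub_nonneg]; apply le_of_eq; field_simp; ring) hF
  filter_upwards [this] with z hz
  simp only [convolution_lsmul_swap] at hz
  exact hz

/-- averaging bound -/
theorem ii_chi_bound {V : ℂ → ℝ} (n : ℕ) (z : ℂ) {B : ℝ}
    (hB : ∀ t, ‖t - z‖ < 1 / ((n : ℝ) + 1) → |V t| ≤ B) :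
    |∫ t, ii_chi n (z - t) • V t| ≤ B := by
  have hcont : Continuous fun t => ii_chi n (z - t) :=
    (ii_chi_smooth n).continuous.comp (continuous_const.sub continuous_id)
  have hi : Integrable fun t => ii_chi n (z - t) :=
    hcont.integrable_of_hasCompactSupport (ii_supp_const_sub (ii_chi_supp n) z)
  calc |∫ t, ii_chi n (z - t) • V t| ≤ ∫ t, ii_chi n (z - t) * B := by
        rw [← Real.norm_eq_abs]
        refine norm_integral_le_of_norm_le (hi.mul_const B) (Eventually.of_forall fun t => ?_)
        rw [norm_smul, Real.norm_eq_abs, Real.norm_eq_abs, abs_of_nonneg (ii_chi_nonneg _ _)]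
        by_cases h : ‖t - z‖ < 1 / ((n : ℝ) + 1)
        · exact mul_le_mul_of_nonneg_left (hB t h) (ii_chi_nonneg _ _)
        · rw [ii_chi_zero n (by rw [norm_sub_rev]; exact not_lt.1 h)]; simp
    _ = B := by rw [integral_mul_const, ii_chi_int_sub, one_mul]

theorem ii_basic_weak {a b V q : ℂ → ℝ} (ha : ContDiff ℝ (⊤ : ℕ∞) a) (hb : ContDiff ℝ (⊤ : ℕ∞) b)
    (hac : HasCompactSupport a) (hbc : HasCompactSupport b)
    (hVl : LocallyIntegrable V) (hVb : ∀ R : ℝ, ∃ B, ∀ z, ‖z‖ ≤ R → |V z| ≤ B)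
    (hq : Continuous q)
    (hw : ∀ v : ℂ → ℝ, ContDiff ℝ (⊤ : ℕ∞) v → HasCompactSupport v → (∀ z, 0 ≤ v z) →
      ∫ z, v z * q z ≤ ∫ z, V z * lap v z) :
    ∫ z, Real.exp (V z) * (a z ^ 2 + b z ^ 2) * q z ≤
      ∫ z, Real.exp (V z) * ((fderiv ℝ a z 1 - fderiv ℝ b z Complex.I) ^ 2
        + (fderiv ℝ b z 1 + fderiv ℝ a z Complex.I) ^ 2) := by
  set Vn : ℕ → ℂ → ℝ := fun n z => ∫ t, ii_chi n (z - t) • V t with hVn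
  set qn : ℕ → ℂ → ℝ := fun n z => ∫ t, ii_chi n (z - t) • q t with hqn
  have sV : ∀ n, ContDiff ℝ (⊤ : ℕ∞) (Vn n) := fun n => (ii_mol hVl (ii_chi_smooth n) (ii_chi_supp n)).1
  have sq : ∀ n, ContDiff ℝ (⊤ : ℕ∞) (qn n) := fun n =>
    (ii_mol hq.locallyIntegrable (ii_chi_smooth n) (ii_chi_supp n)).1
  have hlap : ∀ n z, qn n z ≤ lap (Vn n) z := fun n z => by
    rw [ii_mol_lap hVl (ii_chi_smooth n) (ii_chi_supp n)]
    exact hw _ ((ii_chi_smooth n).comp (contDiff_const.sub contDiff_id))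
      (ii_supp_const_sub (ii_chi_supp n) z) (fun t => ii_chi_nonneg _ _)
  have c0 : ∀ {f : ℂ → ℝ}, ContDiff ℝ (⊤ : ℕ∞) f → ∀ e, Continuous fun z => fderiv ℝ f z e :=
    fun h e => (ii_contDiff_dir h e).continuous
  set S : ℂ → ℝ := fun z => a z ^ 2 + b z ^ 2 with hS
  set T : ℂ → ℝ := fun z => (fderiv ℝ a z 1 - fderiv ℝ b z Complex.I) ^ 2
        + (fderiv ℝ b z 1 + fderiv ℝ a z Complex.I) ^ 2 with hT
  have cS : Continuous S := (ha.continuous.pow 2).add (hb.continuous.pow 2)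
  have cT : Continuous T := (((c0 ha 1).sub (c0 hb _)).pow 2).add (((c0 hb 1).add (c0 ha _)).pow 2)
  have sS : HasCompactSupport S := HasCompactSupport.add
    (HasCompactSupport.comp_left (g := fun t : ℝ => t ^ 2) hac (by simp))
    (HasCompactSupport.comp_left (g := fun t : ℝ => t ^ 2) hbc (by simp))
  have sT : HasCompactSupport T := HasCompactSupport.add
    (HasCompactSupport.comp_left (g := fun t : ℝ => t ^ 2)
        (HasCompactSupport.sub (hac.fderiv_apply ℝ 1) (hbc.fderiv_apply ℝ Complex.I)) (by simp))
    (HasCompactSupport.comp_left (g := fun t : ℝ => t ^ 2)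
        (HasCompactSupport.add (hbc.fderiv_apply ℝ 1) (hac.fderiv_apply ℝ Complex.I)) (by simp))
  have step : ∀ n, ∫ z, Real.exp (Vn n z) * S z * qn n z ≤ ∫ z, Real.exp (Vn n z) * T z := by
    intro n
    refine le_trans ?_ (ii_basic ha hb (sV n) hac hbc)
    refine integral_mono ?_ ?_ (fun z => ?_)
    · exact Continuous.integrable_of_hasCompactSupport
        (((sV n).exp.continuous.mul cS).mul (sq n).continuous) (HasCompactSupport.mul_right sS.mul_left)
    · exact Continuous.integrable_of_hasCompactSupport
        (((sV n).exp.continuous.mul cS).mul (ii_lap_cont (sV n))) (HasCompactSupport.mul_right sS.mul_left)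
    · exact mul_le_mul_of_nonneg_left (hlap n z) (by simp only [hS]; positivity)
  -- a common ball
  obtain ⟨R, hR⟩ := (sS.isCompact.isBounded.union sT.isCompact.isBounded).subset_closedBall 0
  obtain ⟨B, hB⟩ := hVb (R + 1)
  obtain ⟨Q, hQ⟩ := (isCompact_closedBall (0:ℂ) (R + 1)).exists_bound_of_continuousOn hq.continuousOn
  have out : ∀ z, ¬ ‖z‖ ≤ R → S z = 0 ∧ T z = 0 := fun z hz => by
    have : z ∉ tsupport S ∪ tsupport T := fun h => hz (by simpa using hR h)
    rw [mem_union, not_or] at this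
    exact ⟨image_eq_zero_of_notMem_tsupport this.1, image_eq_zero_of_notMem_tsupport this.2⟩
  have near : ∀ (n : ℕ) (z t : ℂ), ‖z‖ ≤ R → ‖t - z‖ < 1 / ((n : ℝ) + 1) → ‖t‖ ≤ R + 1 := by
    intro n z t hz ht
    have h1 : 1 / ((n : ℝ) + 1) ≤ 1 := by
      rw [div_le_one (by positivity)]; linarith [(Nat.cast_nonneg n : (0:ℝ) ≤ n)]
    have := norm_add_le (t - z) z
    rw [sub_add_cancel] at this
    linarith
  have bV : ∀ n z, ‖z‖ ≤ R → |Vn n z| ≤ B := fun n z hz =>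
    ii_chi_bound n z fun t ht => hB t (near n z t hz ht)
  have bq : ∀ n z, ‖z‖ ≤ R → |qn n z| ≤ Q := fun n z hz =>
    ii_chi_bound n z fun t ht => hQ t (by simpa using near n z t hz ht)
  have tV := ii_chi_tendsto hVl
  have tq := ii_chi_tendsto hq.locallyIntegrable
  refine le_of_tendsto_of_tendsto' (b := atTop) ?_ ?_ step
  · refine tendsto_integral_of_dominated_convergence (fun z => Real.exp B * S z * Q) (fun n => ?_) ?_ 
      (fun n => Eventually.of_forall fun z => ?_) ?_
    · exact (((sV n).exp.continuous.mul cS).mul (sq n).continuous).aestronglyMeasurable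
    · exact Continuous.integrable_of_hasCompactSupport ((continuous_const.mul cS).mul continuous_const)
        (HasCompactSupport.mul_right sS.mul_left)
    · by_cases hz : ‖z‖ ≤ R
      · rw [norm_mul, norm_mul, Real.norm_eq_abs, Real.norm_eq_abs, Real.norm_eq_abs, Real.abs_exp,
          abs_of_nonneg (by simp only [hS]; positivity : 0 ≤ S z)]
        have h1 : Vn n z ≤ B := (le_abs_self _).trans (bV n z hz)
        have h2 := bq n z hz
        have : 0 ≤ S z := by simp only [hS]; positivity
        gcongr
      · simp [(out z hz).1]
    · filter_upwards [tV, tq] with z h1 h2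
      exact ((Real.continuous_exp.tendsto _).comp h1 |>.mul_const _).mul h2
  · refine tendsto_integral_of_dominated_convergence (fun z => Real.exp B * T z) (fun n => ?_) ?_ 
      (fun n => Eventually.of_forall fun z => ?_) ?_
    · exact ((sV n).exp.continuous.mul cT).aestronglyMeasurable
    · exact Continuous.integrable_of_hasCompactSupport (continuous_const.mul cT) sT.mul_left
    · by_cases hz : ‖z‖ ≤ R
      · rw [norm_mul, Real.norm_eq_abs, Real.norm_eq_abs, Real.abs_exp,
          abs_of_nonneg (by simp only [hT]; positivity : 0 ≤ T z)]
        have h1 : Vn n z ≤ B := (le_abs_self _).trans (bV n z hz)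
        have : 0 ≤ T z := by simp only [hT]; positivity
        gcongr
      · simp [(out z hz).2]
    · filter_upwards [tV] with z h1
      exact ((Real.continuous_exp.tendsto _).comp h1 |>.mul_const _)


/-! ### Hörmander's theorem -/

theorem ii_abstract {X H : Type*} [AddCommGroup X] [Module ℂ X] [NormedAddCommGroup H]
    [InnerProductSpace ℂ H] [CompleteSpace H] (T : X →ₗ[ℂ] H) (l : X →ₗ[ℂ] ℂ) {A : ℝ} (hA : 0 ≤ A)
    (h : ∀ x, ‖l x‖ ≤ A * ‖T x‖) : ∃ w : H, ‖w‖ ≤ A ∧ ∀ x, l x = inner ℂ w (T x) := by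
  have hk : LinearMap.ker T ≤ LinearMap.ker l := by
    intro x hx
    have h1 := h x
    rw [LinearMap.mem_ker.1 hx, norm_zero, mul_zero] at h1
    exact LinearMap.mem_ker.2 (norm_le_zero_iff.1 h1)
  let f0 : LinearMap.range T →ₗ[ℂ] ℂ :=
    ((LinearMap.ker T).liftQ l hk).comp T.quotKerEquivRange.symm.toLinearMap
  have hf0 : ∀ x, f0 ⟨T x, LinearMap.mem_range_self T x⟩ = l x := by
    intro x
    have : T.quotKerEquivRange.symm ⟨T x, LinearMap.mem_range_self T x⟩
        = (LinearMap.ker T).mkQ x := by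
      rw [LinearEquiv.symm_apply_eq]; rfl
    simp only [f0, LinearMap.comp_apply, LinearEquiv.coe_coe, this]
    rfl
  have hb : ∀ y : LinearMap.range T, ‖f0 y‖ ≤ A * ‖y‖ := by
    rintro ⟨_, x, rfl⟩
    rw [hf0]; exact h x
  obtain ⟨g, hg1, hg2⟩ := exists_extension_norm_eq (LinearMap.range T) (f0.mkContinuous A hb)
  refine ⟨(InnerProductSpace.toDual ℂ H).symm g, ?_, fun x => ?_⟩
  · rw [LinearIsometryEquiv.norm_map, hg2]
    exact LinearMap.mkContinuous_norm_le _ hA _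
  · rw [InnerProductSpace.toDual_symm_apply]
    have := hg1 ⟨T x, LinearMap.mem_range_self T x⟩
    rw [LinearMap.mkContinuous_apply, hf0] at this
    exact this.symm

theorem ii_memLp {E : Type*} [NormedAddCommGroup E] {F : ℂ → E} (hm : AEStronglyMeasurable F)
    {B R : ℝ} (hB : ∀ z, ‖F z‖ ≤ B) (hR : ∀ z, R < ‖z‖ → F z = 0) (p : ℝ≥0∞) : MemLp F p := by
  have e : F = (closedBall (0:ℂ) R).indicator F := by
    funext z
    by_cases hz : ‖z‖ ≤ R
    · rw [indicator_of_mem (by simpa using hz)]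
    · rw [indicator_of_notMem (by simpa using hz), hR z (not_le.1 hz)]
  rw [e, memLp_indicator_iff_restrict measurableSet_closedBall]
  have : IsFiniteMeasure ((volume : Measure ℂ).restrict (closedBall 0 R)) :=
    ⟨by rw [Measure.restrict_apply_univ]; exact measure_closedBall_lt_top⟩
  exact (memLp_top_of_bound hm.restrict B (Eventually.of_forall hB)).mono_exponent le_top

theorem ii_cs {f h : ℂ → ℝ} (hf : MemLp f 2) (hh : MemLp h 2) (hf0 : ∀ z, 0 ≤ f z)
    (hh0 : ∀ z, 0 ≤ h z) : (∫ z, f z * h z) ^ 2 ≤ (∫ z, f z ^ 2) * ∫ z, h z ^ 2 := by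
  have := integral_mul_le_Lp_mul_Lq_of_nonneg (μ := (volume : Measure ℂ)) (f := f) (g := h)
    (p := 2) (q := 2) ⟨by norm_num, by norm_num, by norm_num⟩ (Eventually.of_forall hf0)
    (Eventually.of_forall hh0) (by simpa using hf) (by simpa using hh)
  have h0 : 0 ≤ ∫ z, f z * h z := integral_nonneg fun z => mul_nonneg (hf0 z) (hh0 z)
  have h1 : 0 ≤ ∫ z, f z ^ 2 := integral_nonneg fun z => sq_nonneg _
  have h2 : 0 ≤ ∫ z, h z ^ 2 := integral_nonneg fun z => sq_nonneg _
  simp only [Real.rpow_two, ← Real.sqrt_eq_rpow] at this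
  calc (∫ z, f z * h z) ^ 2 ≤ (√(∫ z, f z ^ 2) * √(∫ z, h z ^ 2)) ^ 2 := by gcongr
    _ = _ := by rw [mul_pow, Real.sq_sqrt h1, Real.sq_sqrt h2]

theorem ii_L2_norm (w : Lp ℂ 2 (volume : Measure ℂ)) : ‖w‖ ^ 2 = ∫ z, ‖w z‖ ^ 2 := by
  have h := inner_self_eq_norm_sq_to_K (𝕜 := ℂ) w
  rw [L2.inner_def] at h
  simp only [inner_self_eq_norm_sq_to_K] at h
  have h2 : ((∫ z, ‖w z‖ ^ 2 : ℝ) : ℂ) = ((‖w‖ ^ 2 : ℝ) : ℂ) := by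
    rw [← integral_complex_ofReal]
    push_cast
    exact h
  exact (Complex.ofReal_injective h2).symm

/-- The space of complex test functions. -/
def ii_test : Submodule ℂ (ℂ → ℂ) where
  carrier := {f | ContDiff ℝ (⊤ : ℕ∞) f ∧ HasCompactSupport f}
  add_mem' := fun ha hb => ⟨ha.1.add hb.1, ha.2.add hb.2⟩
  zero_mem' := ⟨contDiff_const, HasCompactSupport.zero⟩
  smul_mem' := fun _ _ hf => ⟨contDiff_const.smul hf.1, hf.2.smul_left⟩

theorem ii_dbar_add {f g : ℂ → ℂ} (hf : Differentiable ℝ f) (hg : Differentiable ℝ g) (z : ℂ) :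
    dbar (f + g) z = dbar f z + dbar g z := by
  unfold dbar
  rw [fderiv_add (hf z) (hg z)]
  simp only [_root_.add_apply, smul_eq_mul]
  ring

theorem ii_dbar_smul {f : ℂ → ℂ} (hf : Differentiable ℝ f) (c : ℂ) (z : ℂ) :
    dbar (c • f) z = c * dbar f z := by
  unfold dbar
  rw [fderiv_const_smul (hf z)]
  simp only [_root_.smul_apply, smul_eq_mul]
  ring

theorem ii_dbar_cont {f : ℂ → ℂ} (hf : ContDiff ℝ (⊤ : ℕ∞) f) : Continuous (dbar f) := by
  have h1 : Continuous (fderiv ℝ f) := hf.continuous_fderiv (by simp)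
  unfold dbar
  fun_prop

theorem ii_dbar_supp {f : ℂ → ℂ} (hc : HasCompactSupport f) : HasCompactSupport (dbar f) := by
  have : dbar f = (fun L : ℂ →L[ℝ] ℂ => (L 1 + Complex.I • L Complex.I) / 2) ∘ fderiv ℝ f := rfl
  rw [this]
  exact (hc.fderiv ℝ).comp_left (by simp)

theorem ii_dbar_normSq {f : ℂ → ℂ} (hf : ContDiff ℝ (⊤ : ℕ∞) f) (z : ℂ) :
    4 * ‖dbar f z‖ ^ 2 =
      (fderiv ℝ (fun z => (f z).re) z 1 - fderiv ℝ (fun z => (f z).im) z Complex.I) ^ 2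
        + (fderiv ℝ (fun z => (f z).im) z 1 + fderiv ℝ (fun z => (f z).re) z Complex.I) ^ 2 := by
  have hd := (hf.differentiable (by simp) z).hasFDerivAt
  have e1 : ∀ e, fderiv ℝ (fun z => (f z).re) z e = (fderiv ℝ f z e).re := fun e => by
    have h : HasFDerivAt (fun z => (f z).re) (Complex.reCLM.comp (fderiv ℝ f z)) z :=
      Complex.reCLM.hasFDerivAt.comp z hd
    rw [h.fderiv]; rfl
  have e2 : ∀ e, fderiv ℝ (fun z => (f z).im) z e = (fderiv ℝ f z e).im := fun e => by
    have h : HasFDerivAt (fun z => (f z).im) (Complex.imCLM.comp (fderiv ℝ f z)) z :=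
      Complex.imCLM.hasFDerivAt.comp z hd
    rw [h.fderiv]; rfl
  rw [e1, e1, e2, e2]
  unfold dbar
  rw [norm_div, div_pow, ← Complex.normSq_eq_norm_sq, Complex.normSq_apply]
  simp
  ring

theorem ii_hormander {V q : ℂ → ℝ} (hVm : Measurable V)
    (hVb : ∀ R : ℝ, ∃ B, ∀ z, ‖z‖ ≤ R → |V z| ≤ B)
    (hq : Continuous q) (hq0 : ∀ z, 0 < q z)
    (hw : ∀ v : ℂ → ℝ, ContDiff ℝ (⊤ : ℕ∞) v → HasCompactSupport v → (∀ z, 0 ≤ v z) →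
      ∫ z, v z * q z ≤ ∫ z, V z * lap v z)
    {g : ℂ → ℂ} (hg : Continuous g) (hgc : HasCompactSupport g) :
    ∃ u : ℂ → ℂ, AEStronglyMeasurable u ∧ LocallyIntegrable u ∧
      Integrable (fun z => ‖u z‖ ^ 2 * Real.exp (-V z)) ∧
      ∫ z, ‖u z‖ ^ 2 * Real.exp (-V z) ≤ 4 * ∫ z, ‖g z‖ ^ 2 * Real.exp (-V z) / q z ∧
      IsDistribDbarOf u g := by
  have hVl : LocallyIntegrable V := by
    refine (locallyIntegrable_iff).2 fun k hk => ?_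
    obtain ⟨R, hR⟩ := hk.isBounded.subset_closedBall 0
    obtain ⟨B, hB⟩ := hVb R
    exact IntegrableOn.of_bound hk.measure_lt_top hVm.aestronglyMeasurable B
      (ae_restrict_of_forall_mem hk.measurableSet fun z hz => hB z (by simpa using hR hz))
  -- members of L²
  have mem : ∀ f : ℂ → ℂ, Continuous f → HasCompactSupport f → ∀ s : ℝ,
      MemLp (fun z => Real.exp (s * V z) • f z) 2 := by
    intro f hf hfc s
    obtain ⟨R, hR⟩ := hfc.isCompact.isBounded.subset_closedBall 0
    obtain ⟨B, hB⟩ := hVb R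
    obtain ⟨M, hM⟩ := hfc.exists_bound_of_continuous hf
    have out : ∀ z, R < ‖z‖ → f z = 0 := fun z hz =>
      image_eq_zero_of_notMem_tsupport fun h => (not_le.2 hz) (by simpa using hR h)
    refine ii_memLp (B := Real.exp (|s| * B) * M) (R := R) ?_ (fun z => ?_)
      (fun z hz => by rw [out z hz, smul_zero]) 2
    · exact ((Real.measurable_exp.comp (hVm.const_mul s)).aestronglyMeasurable).smul
        hf.aestronglyMeasurable
    · rw [norm_smul, Real.norm_eq_abs, Real.abs_exp]
      have hM0 := (norm_nonneg (f z)).trans (hM z)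
      by_cases hz : ‖z‖ ≤ R
      · have h1 : s * V z ≤ |s| * B := by
          refine (le_abs_self _).trans ?_
          rw [abs_mul]
          exact mul_le_mul_of_nonneg_left (hB z hz) (abs_nonneg s)
        gcongr
        exact hM z
      · rw [out z (not_le.1 hz), norm_zero, mul_zero]; positivity
  have dcont : ∀ f : ii_test, Continuous (dbar f.1) := fun f => ii_dbar_cont f.2.1
  have dsupp : ∀ f : ii_test, HasCompactSupport (dbar f.1) := fun f => ii_dbar_supp f.2.2
  have ddiff : ∀ f : ii_test, Differentiable ℝ f.1 := fun f => f.2.1.differentiable (by simp)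
  have memd : ∀ f : ii_test, MemLp (fun z => Real.exp (1 / 2 * V z) • dbar f.1 z) 2 :=
    fun f => mem _ (dcont f) (dsupp f) _
  let T : ii_test →ₗ[ℂ] Lp ℂ 2 (volume : Measure ℂ) :=
    { toFun := fun f => (memd f).toLp _
      map_add' := fun f h => by
        rw [← MemLp.toLp_add]
        congr 1; funext z
        simp only [Submodule.coe_add, Pi.add_apply]
        rw [ii_dbar_add (ddiff f) (ddiff h), smul_add]
      map_smul' := fun c f => by
        simp only [RingHom.id_apply]
        rw [← MemLp.toLp_const_smul]
        congr 1; funext z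
        simp only [Submodule.coe_smul, Pi.smul_apply]
        rw [ii_dbar_smul (ddiff f), smul_comm]; rfl }
  have igf : ∀ f : ii_test, Integrable fun z => g z * f.1 z := fun f =>
    (hg.mul f.2.1.continuous).integrable_of_hasCompactSupport hgc.mul_right
  let l : ii_test →ₗ[ℂ] ℂ :=
    { toFun := fun f => ∫ z, g z * f.1 z
      map_add' := fun f h => by
        rw [← integral_add (igf f) (igf h)]
        simp only [Submodule.coe_add, Pi.add_apply, mul_add]
      map_smul' := fun c f => by
        simp only [RingHom.id_apply, Submodule.coe_smul, Pi.smul_apply, smul_eq_mul]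
        rw [← integral_const_mul]
        congr 1; funext z; ring }
  set G := ∫ z, ‖g z‖ ^ 2 * Real.exp (-V z) / q z with hG
  have hG0 : 0 ≤ G := integral_nonneg fun z => by have := hq0 z; positivity
  have nT : ∀ f : ii_test, ‖T f‖ ^ 2 = ∫ z, Real.exp (V z) * ‖dbar f.1 z‖ ^ 2 := by
    intro f
    rw [ii_L2_norm]
    refine integral_congr_ae ?_
    filter_upwards [(memd f).coeFn_toLp] with z hz
    have : (T f : ℂ → ℂ) z = Real.exp (1 / 2 * V z) • dbar f.1 z := hz
    rw [this, norm_smul, Real.norm_eq_abs, Real.abs_exp, mul_pow, ← Real.exp_nat_mul]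
    rw [show ((2:ℕ):ℝ) * (1/2 * V z) = V z by push_cast; ring]
  have bound : ∀ f, ‖l f‖ ≤ √(4 * G) * ‖T f‖ := by
    intro f
    have hre : ContDiff ℝ (⊤ : ℕ∞) fun z => (f.1 z).re := Complex.reCLM.contDiff.comp f.2.1
    have him : ContDiff ℝ (⊤ : ℕ∞) fun z => (f.1 z).im := Complex.imCLM.contDiff.comp f.2.1
    have hrec : HasCompactSupport fun z => (f.1 z).re := f.2.2.comp_left (g := Complex.re) rfl
    have himc : HasCompactSupport fun z => (f.1 z).im := f.2.2.comp_left (g := Complex.im) rfl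
    have K := ii_basic_weak hre him hrec himc hVl hVb hq hw
    have e1 : ∀ z, (f.1 z).re ^ 2 + (f.1 z).im ^ 2 = ‖f.1 z‖ ^ 2 := fun z => by
      rw [← Complex.normSq_eq_norm_sq, Complex.normSq_apply]; ring
    simp only [e1, ← ii_dbar_normSq f.2.1] at K
    have cs := ii_cs (f := fun z => ‖Real.exp (-(1/2) * V z) • (((√(q z))⁻¹ : ℂ) * g z)‖)
      (h := fun z => ‖Real.exp (1/2 * V z) • (((√(q z)) : ℂ) * f.1 z)‖)
      (mem _ (Continuous.mul (Continuous.inv₀ (Complex.continuous_ofReal.comp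
        (Real.continuous_sqrt.comp hq)) fun z => by
          have := hq0 z
          simp [(Real.sqrt_pos.2 this).ne']) hg) hgc.mul_left _).norm
      (mem _ (Continuous.mul (Complex.continuous_ofReal.comp
        (Real.continuous_sqrt.comp hq)) f.2.1.continuous) f.2.2.mul_left _).norm
      (fun z => norm_nonneg _) (fun z => norm_nonneg _)
    have x1 : ∀ z, ‖Real.exp (-(1/2) * V z) • (((√(q z))⁻¹ : ℂ) * g z)‖ ^ 2 =
        ‖g z‖ ^ 2 * Real.exp (-V z) / q z := fun z => by
      rw [norm_smul, norm_mul, norm_inv, Complex.norm_real, Real.norm_eq_abs, Real.norm_eq_abs,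
        Real.abs_exp, abs_of_nonneg (Real.sqrt_nonneg _), mul_pow, mul_pow, inv_pow,
        Real.sq_sqrt (hq0 z).le, ← Real.exp_nat_mul]
      rw [show ((2:ℕ):ℝ) * (-(1/2) * V z) = - V z by push_cast; ring]
      field_simp
    have x2 : ∀ z, ‖Real.exp (1/2 * V z) • (((√(q z)) : ℂ) * f.1 z)‖ ^ 2 =
        Real.exp (V z) * ‖f.1 z‖ ^ 2 * q z := fun z => by
      rw [norm_smul, norm_mul, Complex.norm_real, Real.norm_eq_abs, Real.norm_eq_abs,
        Real.abs_exp, abs_of_nonneg (Real.sqrt_nonneg _), mul_pow, mul_pow,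
        Real.sq_sqrt (hq0 z).le, ← Real.exp_nat_mul]
      rw [show ((2:ℕ):ℝ) * (1/2 * V z) = V z by push_cast; ring]
      ring
    have x3 : ∀ z, ‖Real.exp (-(1/2) * V z) • (((√(q z))⁻¹ : ℂ) * g z)‖ *
        ‖Real.exp (1/2 * V z) • (((√(q z)) : ℂ) * f.1 z)‖ = ‖g z * f.1 z‖ := fun z => by
      have hs := (Real.sqrt_pos.2 (hq0 z)).ne'
      rw [norm_smul, norm_smul, norm_mul, norm_mul, norm_inv, Complex.norm_real, Real.norm_eq_abs,
        Real.norm_eq_abs, Real.norm_eq_abs, Real.abs_exp, Real.abs_exp,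
        abs_of_nonneg (Real.sqrt_nonneg _), norm_mul]
      have : Real.exp (-(1/2) * V z) * Real.exp (1/2 * V z) = 1 := by
        rw [← Real.exp_add]; simp
      have h3 : (√(q z))⁻¹ * √(q z) = 1 := inv_mul_cancel₀ hs
      linear_combination (‖g z‖ * ‖f.1 z‖) * this * ((√(q z))⁻¹ * √(q z)) + (‖g z‖ * ‖f.1 z‖) * h3
    simp only [x1, x2, x3] at cs
    have n1 : ‖l f‖ ≤ ∫ z, ‖g z * f.1 z‖ := norm_integral_le_integral_norm _
    have n2 : ∫ z, Real.exp (V z) * (4 * ‖dbar f.1 z‖ ^ 2) = 4 * ‖T f‖ ^ 2 := by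
      rw [nT, ← integral_const_mul]; congr 1; funext z; ring
    rw [n2] at K
    refine abs_le_of_sq_le_sq' ?_ (by positivity) |>.2
    calc ‖l f‖ ^ 2 ≤ (∫ z, ‖g z * f.1 z‖) ^ 2 := by gcongr
      _ ≤ G * ∫ z, Real.exp (V z) * ‖f.1 z‖ ^ 2 * q z := cs
      _ ≤ G * (4 * ‖T f‖ ^ 2) := by gcongr
      _ = _ := by rw [mul_pow, Real.sq_sqrt (by positivity)]; ring
  obtain ⟨w, hw1, hw2⟩ := ii_abstract T l (Real.sqrt_nonneg _) bound
  have hwm : AEStronglyMeasurable (w : ℂ → ℂ) volume := (Lp.memLp w).1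
  have eu : ∀ z, ‖-(Real.exp (1 / 2 * V z) • (starRingEnd ℂ) (w z))‖ ^ 2 * Real.exp (-V z)
      = ‖w z‖ ^ 2 := fun z => by
    rw [norm_neg, norm_smul, Real.norm_eq_abs, Real.abs_exp, RCLike.norm_conj, mul_pow,
      ← Real.exp_nat_mul]
    rw [show ((2:ℕ):ℝ) * (1/2 * V z) = V z by push_cast; ring, Real.exp_neg]
    field_simp
  have um : AEStronglyMeasurable (fun z => -(Real.exp (1 / 2 * V z) • (starRingEnd ℂ) (w z))) :=
    (((Real.measurable_exp.comp (hVm.const_mul _)).aestronglyMeasurable).smul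
      (Complex.continuous_conj.comp_aestronglyMeasurable hwm)).neg
  have iw : Integrable fun z => ‖w z‖ ^ 2 := (Lp.memLp w).integrable_norm_pow (by norm_num)
  refine ⟨fun z => -(Real.exp (1 / 2 * V z) • (starRingEnd ℂ) (w z)), um, ?_, ?_, ?_, ?_⟩
  · refine (locallyIntegrable_iff).2 fun k hk => ?_
    obtain ⟨R, hR⟩ := hk.isBounded.subset_closedBall 0
    obtain ⟨B, hB⟩ := hVb R
    have iw1 : IntegrableOn (fun z => Real.exp (1/2 * B) * (1 + ‖w z‖ ^ 2)) k :=
      Integrable.const_mul (Integrable.add (integrableOn_const hk.measure_lt_top.ne)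
        iw.integrableOn) _
    refine iw1.mono' um.restrict (ae_restrict_of_forall_mem hk.measurableSet fun z hz => ?_)
    rw [norm_neg, norm_smul, Real.norm_eq_abs, Real.abs_exp, RCLike.norm_conj]
    have h1 : V z ≤ B := (le_abs_self _).trans (hB z (by simpa using hR hz))
    gcongr
    nlinarith [sq_nonneg (‖w z‖ - 1), norm_nonneg (w z)]
  · simp only [eu]; exact iw
  · simp only [eu]
    rw [← ii_L2_norm]
    calc ‖w‖ ^ 2 ≤ √(4 * G) ^ 2 := by gcongr
      _ = 4 * G := Real.sq_sqrt (by positivity)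
  · intro v hv hvc
    have h1 := hw2 ⟨v, hv, hvc⟩
    have h2 : (∫ z, g z * v z) = l ⟨v, hv, hvc⟩ := rfl
    rw [h2, h1, L2.inner_def, ← integral_neg]
    refine integral_congr_ae ?_
    filter_upwards [(memd ⟨v, hv, hvc⟩).coeFn_toLp] with z hz
    have : (T ⟨v, hv, hvc⟩ : ℂ → ℂ) z = Real.exp (1 / 2 * V z) • dbar v z := hz
    rw [this, RCLike.inner_apply]
    simp only [Complex.real_smul]
    ring

/-! ### Mean values and Weyl's lemma -/

theorem ii_polar {k : ℝ → ℝ} (hk : Measurable k) {B R : ℝ} (hB : ∀ r, |k r| ≤ B)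
    (hR : ∀ r, R < r → k r = 0) {F : ℂ → ℂ} {z : ℂ} (hF : DifferentiableOn ℂ F (closedBall z R)) :
    ∫ s, k ‖s - z‖ • F s = (∫ r in Ioi (0:ℝ), r * k r) • (2 * π * F z) := by
  have e0 : ∫ s, k ‖s - z‖ • F s = ∫ s, k ‖s‖ • F (z + s) := by
    rw [← integral_add_left_eq_self _ z]; simp
  rw [e0, ← Complex.integral_comp_polarCoord_symm, polarCoord_target]
  have e1 : ∀ p : ℝ × ℝ, 0 < p.1 → p.1 • (k ‖Complex.polarCoord.symm p‖ •
      F (z + Complex.polarCoord.symm p)) = (p.1 * k p.1) • F (circleMap z p.1 p.2) := by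
    intro p hp
    have h1 : Complex.polarCoord.symm p = p.1 * Complex.exp (p.2 * Complex.I) := by
      rw [Complex.polarCoord_symm_apply, Complex.exp_mul_I]
      push_cast; rfl
    have h2 : ‖Complex.polarCoord.symm p‖ = p.1 := by
      rw [h1, norm_mul, Complex.norm_exp_ofReal_mul_I, mul_one, Complex.norm_real,
        Real.norm_of_nonneg hp.le]
    rw [h2, h1, smul_smul]; rfl
  rw [setIntegral_congr_fun (measurableSet_Ioi.prod measurableSet_Ioo)
    (fun p hp => e1 p hp.1)]
  have hcm : ∀ p : ℝ × ℝ, p ∈ Ioc 0 R ×ˢ Ioo (-π) π → circleMap z p.1 p.2 ∈ closedBall z R := by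
    intro p hp
    have : circleMap z p.1 p.2 ∈ sphere z p.1 := circleMap_mem_sphere z hp.1.1.le p.2
    rw [mem_closedBall, mem_sphere.1 this]; exact hp.1.2
  have hcc : Continuous fun p : ℝ × ℝ => circleMap z p.1 p.2 := by
    unfold circleMap; fun_prop
  obtain ⟨M, hM⟩ := (isCompact_closedBall z R).exists_bound_of_continuousOn hF.continuousOn
  have hi : IntegrableOn (fun p : ℝ × ℝ => (p.1 * k p.1) • F (circleMap z p.1 p.2))
      (Ioi 0 ×ˢ Ioo (-π) π) := by
    have hms : MeasurableSet (Ioc (0:ℝ) R ×ˢ Ioo (-π) π) := measurableSet_Ioc.prod measurableSet_Ioo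
    have h1 : IntegrableOn (fun p : ℝ × ℝ => (p.1 * k p.1) • F (circleMap z p.1 p.2))
        (Ioc 0 R ×ˢ Ioo (-π) π) := by
      refine IntegrableOn.of_bound ?_ ?_ (R * B * M) ?_
      · rw [Measure.volume_eq_prod, Measure.prod_prod]
        simp only [Real.volume_Ioc, Real.volume_Ioo]
        exact ENNReal.mul_lt_top ENNReal.ofReal_lt_top ENNReal.ofReal_lt_top
      · have m1 : AEStronglyMeasurable (fun p : ℝ × ℝ => p.1 * k p.1)
            (volume.restrict (Ioc 0 R ×ˢ Ioo (-π) π)) :=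
          (measurable_fst.mul (hk.comp measurable_fst)).aestronglyMeasurable
        have m2 : AEStronglyMeasurable (fun p : ℝ × ℝ => F (circleMap z p.1 p.2))
            (volume.restrict (Ioc 0 R ×ˢ Ioo (-π) π)) :=
          (hF.continuousOn.comp hcc.continuousOn hcm).aestronglyMeasurable hms
        exact m1.smul m2
      · refine ae_restrict_of_forall_mem hms fun p hp => ?_
        have hM0 := (norm_nonneg _).trans (hM _ (hcm p hp))
        have hB0 := (abs_nonneg _).trans (hB 0)
        have hp1 := hp.1.1
        have hp2 := hp.1.2
        rw [norm_smul, norm_mul, Real.norm_of_nonneg hp1.le, Real.norm_eq_abs]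
        have := hB p.1
        have := hM _ (hcm p hp)
        have hR0 : 0 ≤ R := hp1.le.trans hp2
        gcongr
    refine IntegrableOn.of_forall_sdiff_eq_zero h1 (measurableSet_Ioi.prod measurableSet_Ioo) ?_
    intro p hp
    have : R < p.1 := by
      by_contra hc
      exact hp.2 ⟨⟨hp.1.1, not_lt.1 hc⟩, hp.1.2⟩
    simp [hR _ this]
  rw [Measure.volume_eq_prod] at hi ⊢
  rw [setIntegral_prod _ hi, ← integral_smul_const]
  refine setIntegral_congr_fun measurableSet_Ioi fun r hr => ?_
  simp only
  rw [integral_smul]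
  by_cases hrR : r ≤ R
  · congr 1
    have hd : DiffContOnCl ℂ F (ball z |r|) := by
      rw [abs_of_pos hr]
      refine DifferentiableOn.diffContOnCl ?_
      exact hF.mono ((closure_ball_subset_closedBall).trans (closedBall_subset_closedBall hrR))
    have h1 := hd.circleAverage
    rw [Real.circleAverage_def] at h1
    have h2 : ∫ θ in Ioo (-π) π, F (circleMap z r θ) = ∫ θ in (0:ℝ)..2 * π, F (circleMap z r θ) := by
      have hp : Function.Periodic (fun θ => F (circleMap z r θ)) (2 * π) := fun θ => by
        simp only [periodic_circleMap z r θ]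
      have h3 := hp.intervalIntegral_add_eq (-π) 0
      rw [show -π + 2 * π = π by ring, zero_add] at h3
      rw [← h3, intervalIntegral.integral_of_le (by linarith [Real.pi_pos]), integral_Ioc_eq_integral_Ioo]
    rw [h2, ← h1, Complex.real_smul]
    push_cast
    field_simp
  · rw [hR r (not_le.1 hrR)]; simp

theorem ii_mean {k : ℝ → ℝ} (hk : Measurable k) {B R : ℝ} (hB : ∀ r, |k r| ≤ B)
    (hR : ∀ r, R < r → k r = 0) {F : ℂ → ℂ} {z : ℂ} (hF : DifferentiableOn ℂ F (closedBall z R)) :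
    ∫ s, k ‖s - z‖ • F s = (∫ s : ℂ, k ‖s‖) • F z := by
  have h1 := ii_polar hk hB hR hF
  have h2 := ii_polar (F := fun _ => 1) (z := 0) hk hB hR (differentiableOn_const _)
  simp only [sub_zero, mul_one, Complex.real_smul] at h2
  have h3 : ((∫ s : ℂ, k ‖s‖ : ℝ) : ℂ) = ((∫ r in Ioi (0:ℝ), r * k r : ℝ) : ℂ) * (2 * π) := by
    rw [← h2, ← integral_complex_ofReal]
  rw [h1, Complex.real_smul, Complex.real_smul, h3]
  ring

/-- Sub-mean value property. -/
theorem ii_submean {R : ℝ} (hR : 0 < R) {F : ℂ → ℂ} {z : ℂ}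
    (hF : DifferentiableOn ℂ F (closedBall z R)) :
    π * R ^ 2 * ‖F z‖ ≤ ∫ s in closedBall z R, ‖F s‖ := by
  have h := ii_mean (k := (Iic R).indicator 1) (measurable_one.indicator measurableSet_Iic)
    (B := 1) (R := R) (fun r => by
      by_cases h : r ∈ Iic R <;> simp [h]) (fun r hr => by
      rw [indicator_of_notMem]; simpa using hr) hF
  have e1 : ∀ (s z : ℂ), (Iic R).indicator (1 : ℝ → ℝ) ‖s - z‖ = (closedBall z R).indicator 1 s := by
    intro s z
    by_cases h : ‖s - z‖ ≤ R
    · rw [indicator_of_mem (by simpa using h), indicator_of_mem (by simpa [dist_eq_norm] using h)]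
      rfl
    · rw [indicator_of_notMem (by simpa using h),
        indicator_of_notMem (by simpa [dist_eq_norm] using h)]
  have e2 : ∫ s : ℂ, (Iic R).indicator (1 : ℝ → ℝ) ‖s‖ = π * R ^ 2 := by
    have : ∀ s : ℂ, (Iic R).indicator (1 : ℝ → ℝ) ‖s‖ = (closedBall 0 R).indicator 1 s :=
      fun s => by rw [← e1 s 0, sub_zero]
    simp only [this]
    rw [integral_indicator_one measurableSet_closedBall, Measure.real, Complex.volume_closedBall]
    simp only [ENNReal.toReal_mul, ENNReal.toReal_pow, ENNReal.toReal_ofReal hR.le,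
      ENNReal.coe_toReal, NNReal.coe_real_pi]
    ring
  rw [e2] at h
  have h3 := congrArg norm h
  rw [norm_smul, Real.norm_of_nonneg (by positivity)] at h3
  rw [← h3]
  refine (norm_integral_le_integral_norm _).trans (le_of_eq ?_)
  rw [← integral_indicator measurableSet_closedBall]
  congr 1; funext s
  rw [e1]
  by_cases h : s ∈ closedBall z R <;> simp [h]

/-- A radial bump. -/
def ii_rad (r : ℝ) : ℝ := Real.smoothTransition (1 - r ^ 2)

theorem ii_rad_smooth : ContDiff ℝ (⊤ : ℕ∞) fun z : ℂ => ii_rad ‖z‖ := by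
  unfold ii_rad
  exact Real.smoothTransition.contDiff.comp (contDiff_const.sub (contDiff_norm_sq ℝ))

theorem ii_rad_zero {r : ℝ} (h : 1 < r) : ii_rad r = 0 :=
  Real.smoothTransition.zero_of_nonpos (by nlinarith)

theorem ii_rad_supp : HasCompactSupport fun z : ℂ => ii_rad ‖z‖ := by
  refine HasCompactSupport.intro (isCompact_closedBall (0:ℂ) 1) fun z hz => ii_rad_zero ?_
  simpa using hz

theorem ii_rad_pos : 0 < ∫ z : ℂ, ii_rad ‖z‖ := by
  refine ii_rad_smooth.continuous.integral_pos_of_hasCompactSupport_nonneg_nonzero ii_rad_supp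
    (fun z => Real.smoothTransition.nonneg _) (x := 0) ?_
  simp [ii_rad]

theorem ii_dbar_zero_diff {F : ℂ → ℂ} (hF : Differentiable ℝ F) (h : ∀ z, dbar F z = 0) :
    Differentiable ℂ F := fun z => by
  refine differentiableAt_complex_iff_differentiableAt_real.2 ⟨hF z, ?_⟩
  have h1 := h z
  unfold dbar at h1
  simp only [smul_eq_mul] at h1 ⊢
  have h2 : fderiv ℝ F z 1 + Complex.I * fderiv ℝ F z Complex.I = 0 := by
    simpa using h1
  linear_combination (-Complex.I) * h2 + (fderiv ℝ F z Complex.I) * Complex.I_sq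

theorem ii_mol_entire {F : ℂ → ℂ} (hF : LocallyIntegrable F)
    (h : ∀ v : ℂ → ℂ, ContDiff ℝ (⊤ : ℕ∞) v → HasCompactSupport v → ∫ z, F z * dbar v z = 0)
    {χ : ℂ → ℝ} (hχ : ContDiff ℝ (⊤ : ℕ∞) χ) (hc : HasCompactSupport χ) :
    Differentiable ℂ (fun z => ∫ t, χ (z - t) • F t) := by
  obtain ⟨h1, h2⟩ := ii_mol hF hχ hc
  refine ii_dbar_zero_diff (h1.differentiable (by simp)) fun z => ?_
  have h3 := h (fun t => (χ (z - t) : ℂ))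
    (Complex.ofRealCLM.contDiff.comp (hχ.comp (contDiff_const.sub contDiff_id)))
    ((ii_supp_const_sub hc z).comp_left (g := Complex.ofReal) rfl)
  have h4 : ∀ t e, fderiv ℝ (fun t => (χ (z - t) : ℂ)) t e = - (fderiv ℝ χ (z - t) e : ℂ) := by
    intro t e
    have hd : HasFDerivAt (fun t => χ (z - t)) (fderiv ℝ (fun t => χ (z - t)) t) t :=
      ((hχ.comp (contDiff_const.sub contDiff_id)).differentiable (by simp) t).hasFDerivAt
    have : HasFDerivAt (fun t => (χ (z - t) : ℂ))
      (Complex.ofRealCLM.comp (fderiv ℝ (fun t => χ (z - t)) t)) t :=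
      Complex.ofRealCLM.hasFDerivAt.comp t hd
    rw [this.fderiv]
    simp [ii_fderiv_const_sub hχ]
  have i : ∀ e, Integrable fun t => (fderiv ℝ χ (z - t) e) • F t := fun e =>
    hF.integrable_smul_left_of_hasCompactSupport
      ((ii_contDiff_dir hχ e).continuous.comp (continuous_const.sub continuous_id))
      (ii_supp_const_sub (hc.fderiv_apply ℝ e) z)
  unfold dbar at h3 ⊢
  have iI : Integrable fun t => Complex.I • fderiv ℝ χ (z - t) Complex.I • F t :=
    (i _).smul Complex.I
  rw [h2, h2, ← integral_smul, ← integral_add (i 1) iI]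
  simp only [h4] at h3
  have h5 : ∫ t, (fderiv ℝ χ (z - t) 1 • F t + Complex.I • fderiv ℝ χ (z - t) Complex.I • F t)
      = ∫ t, (-2) * (F t * ((-(fderiv ℝ χ (z - t) 1 : ℂ) +
        Complex.I • -(fderiv ℝ χ (z - t) Complex.I : ℂ)) / 2)) := by
    congr 1; funext t
    simp only [Complex.real_smul, smul_eq_mul]; ring
  rw [h5, integral_const_mul, h3]; simp

theorem ii_mol_comm {F : ℂ → ℂ} (hF : LocallyIntegrable F) {χ η : ℂ → ℝ}
    (hχ : Continuous χ) (hχc : HasCompactSupport χ)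
    (hη : Continuous η) (hηc : HasCompactSupport η) (z : ℂ) :
    ∫ s, η (z - s) • ∫ t, χ (s - t) • F t = ∫ s, χ (z - s) • ∫ t, η (s - t) • F t := by
  -- both are integrals against `F`
  have key : ∀ {χ η : ℂ → ℝ}, Continuous χ → HasCompactSupport χ → Continuous η →
      HasCompactSupport η → ∫ s, η (z - s) • ∫ t, χ (s - t) • F t
        = ∫ t, (∫ s, η (z - s) * χ (s - t)) • F t := by
    intro χ η hχ hχc hη hηc
    simp only [← integral_smul, smul_smul]
    rw [integral_integral_swap]
    · congr 1; funext t; rw [integral_smul_const]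
    · obtain ⟨R1, hR1⟩ := hηc.isCompact.isBounded.subset_closedBall 0
      obtain ⟨R2, hR2⟩ := hχc.isCompact.isBounded.subset_closedBall 0
      obtain ⟨M1, hM1⟩ := hηc.exists_bound_of_continuous hη
      obtain ⟨M2, hM2⟩ := hχc.exists_bound_of_continuous hχ
      have o1 : ∀ x, R1 < ‖x‖ → η x = 0 := fun z hz =>
        image_eq_zero_of_notMem_tsupport fun h => (not_le.2 hz) (by simpa using hR1 h)
      have o2 : ∀ x, R2 < ‖x‖ → χ x = 0 := fun z hz =>
        image_eq_zero_of_notMem_tsupport fun h => (not_le.2 hz) (by simpa using hR2 h)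
      have hFi : IntegrableOn F (closedBall z (R1 + R2)) :=
        hF.integrableOn_isCompact (isCompact_closedBall _ _)
      have hg1 : Integrable (fun s => (closedBall z R1).indicator (fun _ => (1:ℝ)) s) :=
        (integrable_indicator_iff measurableSet_closedBall).2
          (integrableOn_const measure_closedBall_lt_top.ne)
      have hg2 : Integrable (fun t => (closedBall z (R1 + R2)).indicator F t) :=
        (integrable_indicator_iff measurableSet_closedBall).2 hFi
      have hg := (hg1.smul_prod hg2).norm.const_mul (M1 * M2)
      refine hg.mono' ?_ (Eventually.of_forall fun p => ?_)
      · have m1 : AEStronglyMeasurable (fun p : ℂ × ℂ => η (z - p.1) * χ (p.1 - p.2))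
            (volume.prod volume) := ((hη.comp (continuous_const.sub continuous_fst)).mul
            (hχ.comp (continuous_fst.sub continuous_snd))).aestronglyMeasurable
        have m2 : AEStronglyMeasurable (fun p : ℂ × ℂ => F p.2) (volume.prod volume) :=
          hF.aestronglyMeasurable.comp_snd
        exact m1.smul m2
      · simp only [Function.uncurry]
        have hM10 := (norm_nonneg _).trans (hM1 0)
        have hM20 := (norm_nonneg _).trans (hM2 0)
        by_cases h1 : ‖z - p.1‖ ≤ R1
        · by_cases h2 : ‖p.1 - p.2‖ ≤ R2
          · have h3 : p.2 ∈ closedBall z (R1 + R2) := by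
              rw [mem_closedBall, dist_comm]
              have := dist_triangle z p.1 p.2
              rw [dist_eq_norm z p.1, dist_eq_norm p.1 p.2] at this
              linarith
            rw [indicator_of_mem (by rw [mem_closedBall, dist_comm, dist_eq_norm]; exact h1),
              indicator_of_mem h3, one_smul, norm_smul, norm_mul]
            gcongr
            · exact hM1 _
            · exact hM2 _
          · rw [o2 _ (not_le.1 h2)]; simp; positivity
        · rw [o1 _ (not_le.1 h1)]; simp; positivity
  rw [key hχ hχc hη hηc, key hη hηc hχ hχc]
  congr 1; funext t
  congr 1
  rw [← integral_sub_left_eq_self _ volume (z + t)]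
  congr 1; funext s
  rw [show z - (z + t - s) = s - t by ring, show z + t - s - t = z - s by ring, mul_comm]

theorem ii_weyl {F : ℂ → ℂ} (hF : LocallyIntegrable F)
    (h : ∀ v : ℂ → ℂ, ContDiff ℝ (⊤ : ℕ∞) v → HasCompactSupport v → ∫ z, F z * dbar v z = 0) :
    ∃ G : ℂ → ℂ, Differentiable ℂ G ∧ F =ᵐ[volume] G := by
  set c := ∫ z : ℂ, ii_rad ‖z‖ with hc
  have hc0 : 0 < c := ii_rad_pos
  set G0 : ℂ → ℂ := fun z => ∫ t, ii_rad ‖z - t‖ • F t with hG0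
  have dG0 : Differentiable ℂ G0 := ii_mol_entire hF h ii_rad_smooth ii_rad_supp
  refine ⟨fun z => c⁻¹ • G0 z, fun z => by exact (dG0 z).const_smul (c⁻¹), ?_⟩
  have dn : ∀ n, Differentiable ℂ (fun z => ∫ t, ii_chi n (z - t) • F t) := fun n =>
    ii_mol_entire hF h (ii_chi_smooth n) (ii_chi_supp n)
  have e : ∀ n z, ∫ t, ii_chi n (z - t) • G0 t = c • ∫ t, ii_chi n (z - t) • F t := by
    intro n z
    rw [hG0, ← ii_mol_comm hF (ii_chi_smooth n).continuous (ii_chi_supp n)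
      ii_rad_smooth.continuous ii_rad_supp]
    have := ii_mean (k := ii_rad) (B := 1) (R := 1) (z := z)
      (by unfold ii_rad; exact (Real.smoothTransition.continuous.comp (by fun_prop)).measurable)
      (fun r => by
        unfold ii_rad
        rw [abs_of_nonneg (Real.smoothTransition.nonneg _)]
        exact Real.smoothTransition.le_one _) (fun r hr => ii_rad_zero hr) (dn n).differentiableOn
    simp only [norm_sub_rev _ z] at this
    exact this
  filter_upwards [ii_chi_tendsto hF, ii_chi_tendsto dG0.continuous.locallyIntegrable] with z h1 h2
  simp only [e] at h2
  have := tendsto_nhds_unique h2 (h1.const_smul c)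
  simp only [this, smul_smul, inv_mul_cancel₀ hc0.ne', one_smul]


/-! ### Geometry of doubling measures -/

theorem ii_dbl_iter {μ : Measure ℂ} {C : ℝ≥0} (hD : IsDoubling μ C) (z : ℂ) {r : ℝ} (hr : 0 < r)
    (n : ℕ) : μ (ball z (2 ^ n * r)) ≤ (C : ℝ≥0∞) ^ n * μ (ball z r) := by
  induction n with
  | zero => simp
  | succ n ih =>
    have h := hD z (2 ^ n * r) (by positivity)
    rw [show 2 ^ (n + 1) * r = 2 * (2 ^ n * r) by ring, pow_succ', mul_assoc]
    exact h.trans (by gcongr)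

theorem ii_fin {μ : Measure ℂ} {C : ℝ≥0} (hD : IsDoubling μ C) {ρ : ℂ → ℝ} (hρ : IsRadius μ ρ)
    (z : ℂ) (r : ℝ) : μ (ball z r) < ∞ := by
  obtain ⟨h0, h1⟩ := hρ z
  obtain ⟨n, hn⟩ := pow_unbounded_of_one_lt (r / ρ z) (one_lt_two (α := ℝ))
  have h2 := ii_dbl_iter hD z h0 n
  rw [h1, mul_one] at h2
  refine lt_of_le_of_lt (measure_mono (ball_subset_ball ?_))
    (h2.trans_lt (ENNReal.pow_lt_top ENNReal.coe_lt_top))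
  rw [div_lt_iff₀ h0] at hn; exact hn.le

theorem ii_finite_compacts {μ : Measure ℂ} {C : ℝ≥0} (hD : IsDoubling μ C) {ρ : ℂ → ℝ}
    (hρ : IsRadius μ ρ) : IsFiniteMeasureOnCompacts μ := ⟨fun K hK => by
  obtain ⟨R, hR⟩ := hK.isBounded.subset_ball 0
  exact (measure_mono hR).trans_lt (ii_fin hD hρ 0 R)⟩

theorem ii_real_mono {μ : Measure ℂ} {C : ℝ≥0} (hD : IsDoubling μ C) {ρ : ℂ → ℝ}
    (hρ : IsRadius μ ρ) {z w : ℂ} {r s : ℝ} (h : dist z w + r ≤ s) :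
    μ.real (ball z r) ≤ μ.real (ball w s) :=
  measureReal_mono (ball_subset_ball' (by linarith)) (ii_fin hD hρ w s).ne

theorem ii_dbl_real {μ : Measure ℂ} {C : ℝ≥0} (hD : IsDoubling μ C) {ρ : ℂ → ℝ}
    (hρ : IsRadius μ ρ) (z : ℂ) {r : ℝ} (hr : 0 < r)
    (n : ℕ) : μ.real (ball z (2 ^ n * r)) ≤ (C : ℝ) ^ n * μ.real (ball z r) := by
  have h := ENNReal.toReal_mono
    (ENNReal.mul_lt_top (ENNReal.pow_lt_top ENNReal.coe_lt_top) (ii_fin hD hρ z r)).ne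
    (ii_dbl_iter hD z hr n)
  rw [ENNReal.toReal_mul, ENNReal.toReal_pow, ENNReal.coe_toReal] at h
  exact h

theorem ii_real_one {μ : Measure ℂ} {ρ : ℂ → ℝ} (hρ : IsRadius μ ρ) (z : ℂ) :
    μ.real (ball z (ρ z)) = 1 := by
  rw [Measure.real, (hρ z).2]; simp

theorem ii_one_le {μ : Measure ℂ} {C : ℝ≥0} (hD : IsDoubling μ C) {ρ : ℂ → ℝ}
    (hρ : IsRadius μ ρ) : (1:ℝ) ≤ C := by
  have h := ii_dbl_real hD hρ 0 (hρ 0).1 1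
  rw [ii_real_one hρ] at h
  have h2 := ii_real_mono hD hρ (z := 0) (w := 0) (r := ρ 0) (s := 2 ^ 1 * ρ 0)
    (by simp; linarith [(hρ 0).1])
  rw [ii_real_one hρ] at h2
  linarith

theorem ii_real_pos {μ : Measure ℂ} {C : ℝ≥0} (hD : IsDoubling μ C) {ρ : ℂ → ℝ}
    (hρ : IsRadius μ ρ) (z : ℂ) {r : ℝ} (hr : 0 < r) : 0 < μ.real (ball z r) := by
  obtain ⟨n, hn⟩ := pow_unbounded_of_one_lt (ρ z / r) (one_lt_two (α := ℝ))
  have h2 := ii_dbl_real hD hρ z hr n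
  rw [div_lt_iff₀ hr] at hn
  have h3 := ii_real_mono hD hρ (z := z) (w := z) (r := ρ z) (s := 2 ^ n * r) (by simp; exact hn.le)
  rw [ii_real_one hρ] at h3
  have hC := ii_one_le hD hρ
  by_contra hc
  have : μ.real (ball z r) = 0 := le_antisymm (not_lt.1 hc) measureReal_nonneg
  rw [this] at h2; linarith

theorem ii_annulus {μ : Measure ℂ} {C : ℝ≥0} (hD : IsDoubling μ C) {ρ : ℂ → ℝ}
    (hρ : IsRadius μ ρ) (z : ℂ) {r s t : ℝ} (hr : 0 ≤ r) (hs : 0 < s) (ht : r + 2 * s ≤ t) :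
    μ.real (ball z r) + μ.real (ball (z + ((r + s : ℝ) : ℂ)) s) ≤ μ.real (ball z t) := by
  have hdist : dist (z + ((r + s : ℝ) : ℂ)) z = r + s := by
    rw [dist_eq_norm, add_sub_cancel_left, Complex.norm_real, Real.norm_of_nonneg (by linarith)]
  rw [← measureReal_union (ball_disjoint_ball (by rw [dist_comm, hdist])) measurableSet_ball
    (ii_fin hD hρ _ _).ne (ii_fin hD hρ _ _).ne]
  refine measureReal_mono (union_subset (ball_subset_ball (by linarith))
    (ball_subset_ball' (by rw [hdist]; linarith))) (ii_fin hD hρ _ _).ne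

theorem ii_strict {μ : Measure ℂ} {C : ℝ≥0} (hD : IsDoubling μ C) {ρ : ℂ → ℝ}
    (hρ : IsRadius μ ρ) (z : ℂ) {r s : ℝ} (hr : 0 ≤ r) (hs : r < s) :
    μ.real (ball z r) < μ.real (ball z s) := by
  have h := ii_annulus hD hρ z hr (s := (s - r) / 2) (t := s) (by linarith) (by linarith)
  have := ii_real_pos hD hρ (z + ((r + (s - r) / 2 : ℝ) : ℂ)) (r := (s - r) / 2) (by linarith)
  linarith

theorem ii_lip {μ : Measure ℂ} {C : ℝ≥0} (hD : IsDoubling μ C) {ρ : ℂ → ℝ}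
    (hρ : IsRadius μ ρ) (z w : ℂ) : ρ z ≤ ρ w + ‖z - w‖ := by
  by_contra hc
  have h1 := ii_strict hD hρ z (r := ρ w + ‖z - w‖) (by have := (hρ w).1; positivity) (not_le.1 hc)
  have h2 := ii_real_mono hD hρ (z := w) (w := z) (r := ρ w) (s := ρ w + ‖z - w‖)
    (by rw [dist_comm, dist_eq_norm]; linarith)
  rw [ii_real_one hρ] at h1 h2
  linarith

theorem ii_rho_cont {μ : Measure ℂ} {C : ℝ≥0} (hD : IsDoubling μ C) {ρ : ℂ → ℝ}
    (hρ : IsRadius μ ρ) : Continuous ρ := by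
  have : LipschitzWith 1 ρ := LipschitzWith.of_le_add fun z w => by
    rw [dist_eq_norm]; exact ii_lip hD hρ z w
  exact this.continuous

theorem ii_rev {μ : Measure ℂ} {C : ℝ≥0} (hD : IsDoubling μ C) {ρ : ℂ → ℝ}
    (hρ : IsRadius μ ρ) (z : ℂ) {r : ℝ} (hr : 0 < r) (n : ℕ) :
    (1 + 1 / (C:ℝ) ^ 2) ^ n * μ.real (ball z r) ≤ μ.real (ball z (4 ^ n * r)) := by
  have hC := ii_one_le hD hρ
  induction n with
  | zero => simp
  | succ n ih =>
    have hs : 0 < 4 ^ n * r := by positivity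
    have h1 := ii_annulus hD hρ z hs.le hs (t := 4 * (4 ^ n * r)) (by linarith)
    have h2 := ii_dbl_real hD hρ (z + ((4 ^ n * r + 4 ^ n * r : ℝ) : ℂ)) hs 2
    have h3 := ii_real_mono hD hρ (z := z) (w := z + ((4 ^ n * r + 4 ^ n * r : ℝ) : ℂ))
      (r := 4 ^ n * r) (s := 2 ^ 2 * (4 ^ n * r)) (by
        rw [dist_comm, dist_eq_norm, add_sub_cancel_left, Complex.norm_real,
          Real.norm_of_nonneg (by linarith)]
        linarith)
    have h4 : μ.real (ball z (4 ^ n * r)) / (C:ℝ) ^ 2 ≤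
        μ.real (ball (z + ((4 ^ n * r + 4 ^ n * r : ℝ) : ℂ)) (4 ^ n * r)) := by
      rw [div_le_iff₀ (by positivity)]; linarith
    rw [show 4 ^ (n + 1) * r = 4 * (4 ^ n * r) by ring, pow_succ', mul_assoc]
    calc _ ≤ (1 + 1 / (C:ℝ) ^ 2) * μ.real (ball z (4 ^ n * r)) := by gcongr
      _ = μ.real (ball z (4 ^ n * r)) + μ.real (ball z (4 ^ n * r)) / (C:ℝ) ^ 2 := by ring
      _ ≤ _ := by linarith

theorem ii_up {μ : Measure ℂ} {C : ℝ≥0} (hD : IsDoubling μ C) {ρ : ℂ → ℝ}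
    (hρ : IsRadius μ ρ) (R : ℝ) : ∃ B : ℝ, 0 < B ∧ ∀ z, μ.real (ball z (R * ρ z)) ≤ B := by
  obtain ⟨n, hn⟩ := pow_unbounded_of_one_lt R (one_lt_two (α := ℝ))
  have hC := ii_one_le hD hρ
  refine ⟨(C:ℝ) ^ n, by positivity, fun z => ?_⟩
  have h := ii_dbl_real hD hρ z (hρ z).1 n
  rw [ii_real_one hρ, mul_one] at h
  refine le_trans (ii_real_mono hD hρ ?_) h
  have := (hρ z).1
  simp; nlinarith

theorem ii_big {μ : Measure ℂ} {C : ℝ≥0} (hD : IsDoubling μ C) {ρ : ℂ → ℝ}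
    (hρ : IsRadius μ ρ) (M : ℝ) : ∃ R : ℝ, 1 ≤ R ∧ ∀ z, M ≤ μ.real (ball z (R * ρ z)) := by
  have hC := ii_one_le hD hρ
  have hb : 1 < 1 + 1 / (C:ℝ) ^ 2 := by
    have : 0 < 1 / (C:ℝ) ^ 2 := by positivity
    linarith
  obtain ⟨n, hn⟩ := pow_unbounded_of_one_lt M hb
  refine ⟨4 ^ n, one_le_pow₀ (by norm_num), fun z => ?_⟩
  have h := ii_rev hD hρ z (hρ z).1 n
  rw [ii_real_one hρ, mul_one] at h
  linarith

/-- polynomial comparison of radii. -/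
theorem ii_E {μ : Measure ℂ} {C : ℝ≥0} (hD : IsDoubling μ C) {ρ : ℂ → ℝ}
    (hρ : IsRadius μ ρ) : ∃ A : ℝ, 1 ≤ A ∧ ∃ s : ℕ, ∀ z l,
      ρ l ≤ A * (1 + ‖z - l‖ / ρ l) ^ s * ρ z := by
  have hC := ii_one_le hD hρ
  set b := 1 + 1 / (C:ℝ) ^ 2 with hbdef
  have hb : 1 < b := by
    have : 0 < 1 / (C:ℝ) ^ 2 := by positivity
    linarith
  obtain ⟨N, hN⟩ := pow_unbounded_of_one_lt (C:ℝ) hb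
  refine ⟨(4:ℝ) ^ (N * 2 + 1), one_le_pow₀ (by norm_num), 2 * N, fun z l => ?_⟩
  have hl := (hρ l).1
  have hz := (hρ z).1
  set K := 1 + ‖z - l‖ / ρ l with hK
  have hK1 : 1 ≤ K := by have : 0 ≤ ‖z - l‖ / ρ l := by positivity
                         linarith
  have hKl : K * ρ l = ρ l + ‖z - l‖ := by rw [hK]; field_simp
  obtain ⟨n, hn1, hn2⟩ := exists_nat_pow_near hK1 (one_lt_two (α := ℝ))
  -- `2 ^ n ≤ K < 2 ^ (n+1)`
  set j := (n + 2) * N with hj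
  have h1 := ii_rev hD hρ z hz j
  rw [ii_real_one hρ, mul_one] at h1
  have h2 : μ.real (ball z (K * ρ l)) ≤ (C:ℝ) ^ (n + 2) := by
    have h3 := ii_dbl_real hD hρ l hl (n + 2)
    rw [ii_real_one hρ, mul_one] at h3
    refine le_trans (ii_real_mono hD hρ ?_) h3
    rw [dist_eq_norm]
    have : 2 * (K * ρ l) ≤ 2 ^ (n + 2) * ρ l := by
      rw [pow_succ']
      nlinarith
    linarith
  have h4 : (C:ℝ) ^ (n + 2) < b ^ j := by
    rw [hj, mul_comm, pow_mul]
    exact pow_lt_pow_left₀ hN (by positivity) (by simp)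
  have h5 : K * ρ l ≤ 4 ^ j * ρ z := by
    by_contra hc
    have := ii_real_mono hD hρ (z := z) (w := z) (r := 4 ^ j * ρ z) (s := K * ρ l)
      (by simp; exact (not_le.1 hc).le)
    linarith
  have h6 : (4:ℝ) ^ j ≤ 4 ^ (N * 2) * K ^ (2 * N) := by
    have : (4:ℝ) ^ j = 4 ^ (N * 2) * (2 ^ n) ^ (2 * N) := by
      rw [show (4:ℝ) = 2 ^ 2 by norm_num, ← pow_mul, ← pow_mul, ← pow_mul, ← pow_add]
      congr 1; rw [hj]; ring
    rw [this]; gcongr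
  calc ρ l ≤ K * ρ l := by nlinarith
    _ ≤ 4 ^ j * ρ z := h5
    _ ≤ (4 ^ (N * 2) * K ^ (2 * N)) * ρ z := by gcongr
    _ ≤ _ := by
      have : (4:ℝ) ^ (N * 2) ≤ 4 ^ (N * 2 + 1) := pow_le_pow_right₀ (by norm_num) (by simp)
      gcongr

theorem ii_K_one {ρ : ℂ → ℝ} {l : ℂ} (h : 0 < ρ l) (z : ℂ) : 1 ≤ 1 + ‖z - l‖ / ρ l := by
  have : 0 ≤ ‖z - l‖ / ρ l := by positivity
  linarith

theorem ii_K_symm {ρ : ℂ → ℝ} (h0 : ∀ z, 0 < ρ z) {A : ℝ} (hA : 1 ≤ A) {s : ℕ}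
    (hE : ∀ z l, ρ l ≤ A * (1 + ‖z - l‖ / ρ l) ^ s * ρ z) (z l : ℂ) :
    1 + ‖l - z‖ / ρ z ≤ A * (1 + ‖z - l‖ / ρ l) ^ (s + 1) := by
  have h1 := hE z l
  have hz := h0 z
  have hl := h0 l
  set K := 1 + ‖z - l‖ / ρ l with hK
  have hK1 : 1 ≤ K := ii_K_one hl z
  have hd : ‖l - z‖ = (K - 1) * ρ l := by rw [hK, norm_sub_rev]; field_simp; ring
  have h2 : ‖l - z‖ / ρ z ≤ (K - 1) * (A * K ^ s) := by
    rw [div_le_iff₀ hz, hd, mul_assoc]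
    exact mul_le_mul_of_nonneg_left h1 (by linarith)
  have h3 : 1 ≤ A * K ^ s := one_le_mul_of_one_le_of_one_le hA (one_le_pow₀ hK1)
  calc _ ≤ 1 + (K - 1) * (A * K ^ s) := by linarith
    _ ≤ K * (A * K ^ s) := by linarith
    _ = _ := by ring

theorem ii_flat {ρ : ℂ → ℝ} (hc : Continuous ρ) (h0 : ∀ z, 0 < ρ z) {A : ℝ} (hA : 1 ≤ A) {s : ℕ}
    (hE : ∀ z l, ρ l ≤ A * (1 + ‖z - l‖ / ρ l) ^ s * ρ z) {ω : ℂ → ℝ} (hω : IsFlatWeight ρ ω) :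
    ∃ B : ℝ, 1 ≤ B ∧ ∃ k : ℕ, ∀ z l, ω z ≤ B * (1 + ‖z - l‖ / ρ l) ^ k * ω l ∧
      ω l ≤ B * (1 + ‖z - l‖ / ρ l) ^ k * ω z := by
  obtain ⟨hpos, -, C, hC, hlog⟩ := hω
  obtain ⟨k, hk⟩ := exists_nat_ge (C * (s + 1))
  refine ⟨Real.exp (C * (1 + Real.log A)), Real.one_le_exp (by
    have := Real.log_nonneg hA; positivity), k, fun z l => ?_⟩
  have hl := h0 l
  set K := 1 + ‖z - l‖ / ρ l with hK
  have hK1 : 1 ≤ K := ii_K_one hl z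
  -- the path distance
  have hset : ∀ L ∈ { L : ℝ | ∃ γ : ℝ → ℂ, γ 0 = l ∧ γ 1 = z ∧ ContDiff ℝ 1 γ ∧
    L = ∫ t in (0:ℝ)..1, ‖deriv γ t‖ / ρ (γ t) }, 0 ≤ L := by
    rintro L ⟨γ, -, -, -, rfl⟩
    exact intervalIntegral.integral_nonneg (by norm_num) fun t _ =>
      div_nonneg (norm_nonneg _) (h0 _).le
  have hd0 : 0 ≤ pathDist ρ l z := Real.sInf_nonneg hset
  have hd : pathDist ρ l z ≤ A * K ^ (s + 1) := by
    have hmem : pathDist ρ l z ≤ ∫ t in (0:ℝ)..1, ‖z - l‖ / ρ (l + t * (z - l)) := by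
      refine csInf_le ⟨0, hset⟩ ⟨fun t => l + t * (z - l), by simp, by simp, ?_, ?_⟩
      · exact contDiff_const.add (Complex.ofRealCLM.contDiff.mul contDiff_const)
      · have : ∀ t : ℝ, deriv (fun t : ℝ => l + t * (z - l)) t = z - l := by
          intro t
          have : HasDerivAt (fun t : ℝ => l + (t:ℂ) * (z - l)) (1 * (z - l)) t :=
            ((Complex.ofRealCLM.hasDerivAt (x := t)).mul_const (z - l)).const_add l
          rw [this.deriv, one_mul]
        simp only [this]
    refine hmem.trans ?_
    have hle : ∀ t ∈ Icc (0:ℝ) 1, ‖z - l‖ / ρ (l + t * (z - l)) ≤ A * K ^ (s + 1) := by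
      intro t ht
      have h1 := hE (l + t * (z - l)) l
      have h2 : 1 + ‖l + t * (z - l) - l‖ / ρ l ≤ K := by
        rw [add_sub_cancel_left, norm_mul, Complex.norm_real, Real.norm_of_nonneg ht.1, hK]
        gcongr
        exact mul_le_of_le_one_left (norm_nonneg _) ht.2
      have h3 : ρ l ≤ A * K ^ s * ρ (l + t * (z - l)) := by
        refine h1.trans ?_
        have := (h0 (l + t * (z - l))).le
        gcongr
      rw [div_le_iff₀ (h0 _)]
      have h4 : ‖z - l‖ = (K - 1) * ρ l := by rw [hK]; field_simp; ring
      rw [h4]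
      calc (K - 1) * ρ l ≤ (K - 1) * (A * K ^ s * ρ (l + t * (z - l))) :=
            mul_le_mul_of_nonneg_left h3 (by linarith)
        _ ≤ K * (A * K ^ s * ρ (l + t * (z - l))) := by
            have := (h0 (l + t * (z - l))).le
            gcongr; linarith
        _ = _ := by ring
    have hcont : Continuous fun t : ℝ => ‖z - l‖ / ρ (l + t * (z - l)) :=
      continuous_const.div (hc.comp (by fun_prop)) fun t => (h0 _).ne'
    have := intervalIntegral.integral_mono_on (μ := volume) (a := 0) (b := 1) (by norm_num)
      (hcont.intervalIntegrable _ _) (intervalIntegrable_const (c := A * K ^ (s + 1))) hle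
    simpa using this
  have hlogd : max (Real.log (pathDist ρ l z)) 0 ≤ Real.log A + (s + 1) * Real.log K := by
    have e : Real.log (A * K ^ (s + 1)) = Real.log A + (s + 1) * Real.log K := by
      rw [Real.log_mul (by positivity) (by positivity), Real.log_pow]; push_cast; ring
    have hAK : 1 ≤ A * K ^ (s + 1) := one_le_mul_of_one_le_of_one_le hA (one_le_pow₀ hK1)
    refine max_le ?_ (by rw [← e]; exact Real.log_nonneg hAK)
    rw [← e]
    rcases hd0.eq_or_lt with h | h
    · rw [← h, Real.log_zero]; exact Real.log_nonneg hAK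
    · exact Real.log_le_log h hd
  have hmain : |Real.log (ω l) - Real.log (ω z)| ≤ C * (1 + Real.log A) + k * Real.log K := by
    refine (hlog l z).trans ?_
    have hlK := Real.log_nonneg hK1
    calc C * (1 + max (Real.log (pathDist ρ l z)) 0)
        ≤ C * (1 + (Real.log A + (s + 1) * Real.log K)) := by gcongr
      _ = C * (1 + Real.log A) + C * (s + 1) * Real.log K := by ring
      _ ≤ _ := by gcongr
  have hfin : ∀ a b : ℝ, 0 < a → 0 < b → Real.log a - Real.log b ≤
      C * (1 + Real.log A) + k * Real.log K → a ≤ Real.exp (C * (1 + Real.log A)) * K ^ k * b := by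
    intro a b ha hb h
    have h1 : Real.log a ≤ C * (1 + Real.log A) + k * Real.log K + Real.log b := by linarith
    have h2 := Real.exp_le_exp.2 h1
    rw [Real.exp_log ha, Real.exp_add, Real.exp_add, Real.exp_log hb, ← Real.log_pow,
      Real.exp_log (by positivity)] at h2
    exact h2
  have := abs_le.1 hmain
  exact ⟨hfin _ _ (hpos z) (hpos l) (by linarith), hfin _ _ (hpos l) (hpos z) (by linarith)⟩

theorem ii_rho' {μ : Measure ℂ} {C : ℝ≥0} (hD : IsDoubling μ C) {ρ : ℂ → ℝ}
    (hρ : IsRadius μ ρ) {ε : ℝ} (hε : 0 < ε) {ρ' : ℂ → ℝ}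
    (hρ' : IsRadius (ENNReal.ofReal (1 + ε) • μ) ρ') :
    ∃ B : ℝ, 0 < B ∧ ∀ z, ρ z ≤ B * ρ' z := by
  have hC := ii_one_le hD hρ
  have hb : 1 < 1 + 1 / (C:ℝ) ^ 2 := by
    have : 0 < 1 / (C:ℝ) ^ 2 := by positivity
    linarith
  obtain ⟨j, hj⟩ := pow_unbounded_of_one_lt (1 + ε) hb
  refine ⟨4 ^ j, by positivity, fun z => ?_⟩
  obtain ⟨h1, h2⟩ := hρ' z
  have h3 : (1 + ε) * μ.real (ball z (ρ' z)) = 1 := by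
    have := congrArg ENNReal.toReal h2
    rw [Measure.smul_apply, smul_eq_mul, ENNReal.toReal_mul, ENNReal.toReal_ofReal (by linarith)] at this
    rw [Measure.real, this]; simp
  by_contra hc
  have h4 := ii_real_mono hD hρ (z := z) (w := z) (r := 4 ^ j * ρ' z) (s := ρ z)
    (by simp; exact (not_le.1 hc).le)
  rw [ii_real_one hρ] at h4
  have h5 := ii_rev hD hρ z h1 j
  have h6 := ii_real_pos hD hρ z h1
  nlinarith



/-! ### Logarithmic potentials -/

theorem ii_logpot {μ : Measure ℂ} {C : ℝ≥0} (hD : IsDoubling μ C) {ρ : ℂ → ℝ}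
    (hρ : IsRadius μ ρ) : ∃ C₁ : ℝ, 0 < C₁ ∧ ∀ (z : ℂ) (r : ℝ), 0 < r →
      Integrable (fun w => Real.posLog (r / ‖z - w‖)) μ ∧
      ∫ w, Real.posLog (r / ‖z - w‖) ∂μ ≤ C₁ * μ.real (ball z r) := by
  have hC := ii_one_le hD hρ
  set b := 1 + 1 / (C:ℝ) ^ 2 with hbdef
  have hb : 1 < b := by
    have : 0 < 1 / (C:ℝ) ^ 2 := by positivity
    linarith
  have hb' : b⁻¹ < 1 := inv_lt_one_of_one_lt₀ hb
  have hl4 : 0 < Real.log 4 := Real.log_pos (by norm_num)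
  refine ⟨Real.log 4 * (C:ℝ) ^ 2 * (1 - b⁻¹)⁻¹, by
    have : 0 < 1 - b⁻¹ := by linarith
    positivity, fun z r hr => ?_⟩
  have hmeas : Measurable fun w => Real.posLog (r / ‖z - w‖) :=
    Real.continuous_posLog.measurable.comp (measurable_const.div (by fun_prop))
  have hpt : ∀ w, ENNReal.ofReal (Real.posLog (r / ‖z - w‖)) ≤
      ∑' k : ℕ, (ball z (4 * r / 4 ^ k)).indicator (fun _ => ENNReal.ofReal (Real.log 4)) w := by
    intro w
    by_cases hx : 1 ≤ r / ‖z - w‖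
    · obtain ⟨n, hn1, hn2⟩ := exists_nat_pow_near hx (show (1:ℝ) < 4 by norm_num)
      have hw : 0 < ‖z - w‖ := by
        rcases (norm_nonneg (z - w)).eq_or_lt with h | h
        · rw [← h, div_zero] at hx; linarith
        · exact h
      calc ENNReal.ofReal (Real.posLog (r / ‖z - w‖))
          ≤ ENNReal.ofReal ((n + 1 : ℕ) * Real.log 4) := by
            apply ENNReal.ofReal_le_ofReal
            rw [Real.posLog_eq_log (by rw [abs_of_nonneg (by positivity)]; exact hx), ← Real.log_pow]
            exact Real.log_le_log (by positivity) hn2.le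
        _ = ∑ k ∈ Finset.range (n + 1),
            (ball z (4 * r / 4 ^ k)).indicator (fun _ => ENNReal.ofReal (Real.log 4)) w := by
            rw [Finset.sum_congr rfl (g := fun _ => ENNReal.ofReal (Real.log 4))]
            · rw [Finset.sum_const, Finset.card_range, nsmul_eq_mul, ENNReal.ofReal_mul (by positivity),
                ENNReal.ofReal_natCast]
            · intro k hk
              rw [indicator_of_mem]
              rw [mem_ball, dist_comm, dist_eq_norm, lt_div_iff₀ (by positivity)]
              have h1 : (4:ℝ) ^ k ≤ 4 ^ n :=
                pow_le_pow_right₀ (by norm_num) (Nat.lt_succ_iff.1 (Finset.mem_range.1 hk))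
              have h2 : (4:ℝ) ^ k * ‖z - w‖ ≤ r := by
                rw [← le_div_iff₀ hw]; exact h1.trans hn1
              linarith
        _ ≤ _ := ENNReal.sum_le_tsum _
    · rw [(Real.posLog_eq_zero_iff _).2 (by rw [abs_of_nonneg (by positivity)]; exact (not_le.1 hx).le)]
      simp
  have hball : ∀ k : ℕ, μ.real (ball z (4 * r / 4 ^ k)) ≤ (C:ℝ) ^ 2 * μ.real (ball z r) * b⁻¹ ^ k := by
    intro k
    have h1 := ii_rev hD hρ z (r := 4 * r / 4 ^ k) (by positivity) k
    have h2 := ii_dbl_real hD hρ z hr 2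
    rw [show (4:ℝ) ^ k * (4 * r / 4 ^ k) = 2 ^ 2 * r by field_simp; norm_num] at h1
    rw [inv_pow, ← div_eq_mul_inv, le_div_iff₀ (by positivity), mul_comm]
    exact h1.trans h2
  have hgs : Summable fun k : ℕ => Real.log 4 * ((C:ℝ) ^ 2 * μ.real (ball z r) * b⁻¹ ^ k) :=
    ((summable_geometric_of_lt_one (by positivity) hb').mul_left _).mul_left _
  have hm0 : 0 ≤ μ.real (ball z r) := measureReal_nonneg
  have hlint : ∫⁻ w, ENNReal.ofReal (Real.posLog (r / ‖z - w‖)) ∂μ ≤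
      ENNReal.ofReal (Real.log 4 * (C:ℝ) ^ 2 * (1 - b⁻¹)⁻¹ * μ.real (ball z r)) := by
    calc _ ≤ ∫⁻ w, ∑' k : ℕ,
          (ball z (4 * r / 4 ^ k)).indicator (fun _ => ENNReal.ofReal (Real.log 4)) w ∂μ :=
          lintegral_mono hpt
      _ = ∑' k : ℕ, ENNReal.ofReal (Real.log 4) * μ (ball z (4 * r / 4 ^ k)) := by
          rw [lintegral_tsum fun k => (measurable_const.indicator measurableSet_ball).aemeasurable]
          congr 1; funext k
          rw [lintegral_indicator_const measurableSet_ball]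
      _ ≤ ∑' k : ℕ, ENNReal.ofReal (Real.log 4 * ((C:ℝ) ^ 2 * μ.real (ball z r) * b⁻¹ ^ k)) := by
          refine ENNReal.tsum_le_tsum fun k => ?_
          rw [ENNReal.ofReal_mul hl4.le]
          gcongr
          rw [← ENNReal.ofReal_toReal (ii_fin hD hρ z (4 * r / 4 ^ k)).ne]
          exact ENNReal.ofReal_le_ofReal (hball k)
      _ = _ := by
          rw [← ENNReal.ofReal_tsum_of_nonneg (fun k => by positivity) hgs, tsum_mul_left, tsum_mul_left,
            tsum_geometric_of_lt_one (by positivity) hb']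
          congr 1; ring
  have hintg : Integrable (fun w => Real.posLog (r / ‖z - w‖)) μ :=
    (lintegral_ofReal_ne_top_iff_integrable hmeas.aestronglyMeasurable
      (Eventually.of_forall fun w => Real.posLog_nonneg)).1 (hlint.trans_lt ENNReal.ofReal_lt_top).ne
  refine ⟨hintg, ?_⟩
  rw [integral_eq_lintegral_of_nonneg_ae (Eventually.of_forall fun w => Real.posLog_nonneg)
    hmeas.aestronglyMeasurable]
  have h1b : 0 < 1 - b⁻¹ := by linarith
  exact ENNReal.toReal_le_of_le_ofReal (by positivity) hlint

theorem ii_lap_int_zero {v : ℂ → ℝ} (hv : ContDiff ℝ (⊤ : ℕ∞) v) (hc : HasCompactSupport v) :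
    ∫ z, lap v z = 0 := by
  have := ii_ibp_radial (g := fun _ => 1) (k := fun _ => 0) (k' := fun _ => 0)
    (fun t _ => hasDerivAt_const _ _) (fun t _ => hasDerivAt_const _ _) continuousOn_const hv hc 0
  simpa using this

theorem ii_fund' {v : ℂ → ℝ} (hv : ContDiff ℝ (⊤ : ℕ∞) v) (hc : HasCompactSupport v) (w : ℂ)
    {r : ℝ} (hr : 0 < r) : ∫ z, Real.log (‖z - w‖ / r) * lap v z = 2 * π * v w := by
  have h1 := ii_fund v hv hc w
  have i1 := ii_log_mul_integrable (ii_lap_cont hv) (ii_lap_supp hv hc) w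
  have i2 : Integrable fun z => Real.log r * lap v z :=
    ((ii_lap_cont hv).integrable_of_hasCompactSupport (ii_lap_supp hv hc)).const_mul _
  have e : ∀ᵐ z : ℂ, Real.log (‖z - w‖ / r) * lap v z
      = Real.log ‖z - w‖ * lap v z - Real.log r * lap v z := by
    have : ∀ᵐ z : ℂ, z ≠ w := by simp [ae_iff, measure_singleton]
    filter_upwards [this] with z hz
    rw [Real.log_div (norm_ne_zero_iff.2 (sub_ne_zero.2 hz)) hr.ne']; ring
  rw [integral_congr_ae e, integral_sub i1 i2, integral_const_mul, ii_lap_int_zero hv hc]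
  have : ∀ z, Real.log (‖z - w‖ ^ 2) * lap v z = 2 * (Real.log ‖z - w‖ * lap v z) := fun z => by
    rw [Real.log_pow]; push_cast; ring
  simp only [this] at h1
  rw [integral_const_mul] at h1
  linarith

theorem ii_G {μ : Measure ℂ} {C : ℝ≥0} (hD : IsDoubling μ C) {ρ : ℂ → ℝ}
    (hρ : IsRadius μ ρ) (R : ℝ) (hR : 1 ≤ R) : ∃ CR : ℝ, 0 < CR ∧ ∀ a, ∃ G : ℂ → ℝ,
      Measurable G ∧ (∀ S, ∃ B, ∀ z, ‖z‖ ≤ S → |G z| ≤ B) ∧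
      (∀ z, μ.real (ball a (R * ρ a)) / (2 * π) * Real.log (1 + ‖z - a‖ / ρ a) - CR ≤ G z) ∧
      (∀ z, ‖z - a‖ ≤ ρ a → G z ≤ CR) ∧
      ∀ v : ℂ → ℝ, ContDiff ℝ (⊤ : ℕ∞) v → HasCompactSupport v →
        ∫ z, G z * lap v z = ∫ z in ball a (R * ρ a), v z ∂μ := by
  obtain ⟨C₁, hC₁, hpot⟩ := ii_logpot hD hρ
  obtain ⟨B1, hB1, hB1'⟩ := ii_up hD hρ R
  obtain ⟨B2, hB2, hB2'⟩ := ii_up hD hρ (R + 2)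
  have hlR : 0 < Real.log (2 + R) := Real.log_pos (by linarith)
  have hpi := Real.pi_pos
  refine ⟨(B1 * Real.log (2 + R) + C₁ * B2) / (2 * π), by positivity, fun a => ?_⟩
  set CR := (B1 * Real.log (2 + R) + C₁ * B2) / (2 * π) with hCR
  have hr := (hρ a).1
  set r := ρ a with hrdef
  set ν := μ.restrict (ball a (R * r)) with hν
  have : IsFiniteMeasure ν := ⟨by rw [hν, Measure.restrict_apply_univ]; exact ii_fin hD hρ _ _⟩
  set m := μ.real (ball a (R * r)) with hm
  have hmν : ν.real univ = m := by rw [hν, measureReal_restrict_apply_univ]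
  have hm0 : 0 ≤ m := measureReal_nonneg
  have hmB : m ≤ B1 := hB1' a
  have hνball : ∀ᵐ w ∂ν, w ∈ ball a (R * r) := ae_restrict_mem measurableSet_ball
  have hinv : ∀ z w : ℂ, (‖z - w‖ / r)⁻¹ = r / ‖z - w‖ := fun z w => by rw [inv_div]
  -- positive part
  have hposb : ∀ z w : ℂ, w ∈ ball a (R * r) →
      Real.posLog (‖z - w‖ / r) ≤ Real.log (R + (1 + ‖z - a‖ / r)) := by
    intro z w hw
    have h1 : ‖z - w‖ / r ≤ R + (1 + ‖z - a‖ / r) := by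
      rw [div_le_iff₀ hr]
      have h2 : ‖z - w‖ ≤ ‖z - a‖ + ‖w - a‖ := by
        rw [← norm_sub_rev a w]; exact norm_sub_le_norm_sub_add_norm_sub z a w
      have h3 : ‖w - a‖ < R * r := by rw [← dist_eq_norm]; exact hw
      have : (R + (1 + ‖z - a‖ / r)) * r = R * r + r + ‖z - a‖ := by field_simp; ring
      linarith
    have h0 : 0 ≤ ‖z - a‖ / r := by positivity
    rw [Real.posLog_eq_log_max_one (by positivity)]
    exact Real.log_le_log (by positivity) (max_le (by linarith) h1)
  have hposm : ∀ z, Measurable fun w : ℂ => Real.posLog (‖z - w‖ / r) := fun z =>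
    Real.continuous_posLog.measurable.comp (by fun_prop)
  have hposi : ∀ z, Integrable (fun w => Real.posLog (‖z - w‖ / r)) ν := fun z =>
    Integrable.of_bound (hposm z).aestronglyMeasurable (Real.log (R + (1 + ‖z - a‖ / r))) (by
      filter_upwards [hνball] with w hw
      rw [Real.norm_of_nonneg Real.posLog_nonneg]; exact hposb z w hw)
  have hposI : ∀ z, ∫ w, Real.posLog (‖z - w‖ / r) ∂ν ≤ m * Real.log (R + (1 + ‖z - a‖ / r)) := by
    intro z
    have := integral_mono_ae (hposi z) (integrable_const (Real.log (R + (1 + ‖z - a‖ / r)))) (by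
      filter_upwards [hνball] with w hw using hposb z w hw)
    rwa [integral_const, hmν, smul_eq_mul] at this
  have hnegi : ∀ z, Integrable (fun w => Real.posLog (r / ‖z - w‖)) ν := fun z =>
    (hpot z r hr).1.integrableOn
  have hnegI : ∀ z, ∫ w, Real.posLog (r / ‖z - w‖) ∂ν ≤ C₁ * μ.real (ball z r) := fun z =>
    (setIntegral_le_integral (hpot z r hr).1 (Eventually.of_forall fun w => Real.posLog_nonneg)).trans
      (hpot z r hr).2
  have hlogeq : ∀ z w : ℂ, Real.log (‖z - w‖ / r) =
      Real.posLog (‖z - w‖ / r) - Real.posLog (r / ‖z - w‖) := fun z w => by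
    rw [← hinv, Real.posLog_sub_posLog_inv]
  have hlogi : ∀ z, Integrable (fun w => Real.log (‖z - w‖ / r)) ν := fun z => by
    simp only [hlogeq]; exact (hposi z).sub (hnegi z)
  have habs : ∀ z, ∫ w, |Real.log (‖z - w‖ / r)| ∂ν ≤
      m * Real.log (R + (1 + ‖z - a‖ / r)) + C₁ * μ.real (ball z r) := by
    intro z
    have h1 : ∫ w, |Real.log (‖z - w‖ / r)| ∂ν ≤
        ∫ w, (Real.posLog (‖z - w‖ / r) + Real.posLog (r / ‖z - w‖)) ∂ν := by
      refine integral_mono (hlogi z).abs ((hposi z).add (hnegi z)) fun w => ?_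
      simp only [hlogeq]
      refine (abs_sub _ _).trans ?_
      rw [abs_of_nonneg Real.posLog_nonneg, abs_of_nonneg Real.posLog_nonneg]
    rw [integral_add (hposi z) (hnegi z)] at h1
    linarith [hposI z, hnegI z]
  have hloc : ∀ S : ℝ, ∃ B, ∀ z, ‖z‖ ≤ S → ∫ w, |Real.log (‖z - w‖ / r)| ∂ν ≤ B := by
    intro S
    refine ⟨m * Real.log (R + (1 + (S + ‖a‖) / r)) + C₁ * μ.real (ball 0 (S + r)), fun z hz => ?_⟩
    refine (habs z).trans ?_
    have h0 : 0 ≤ ‖z - a‖ / r := by positivity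
    have h1 : ‖z - a‖ ≤ S + ‖a‖ := (norm_sub_le _ _).trans (by linarith)
    have h2 := ii_real_mono hD hρ (z := z) (w := 0) (r := r) (s := S + r) (by
      rw [dist_zero_right]; linarith)
    gcongr
  have hjm : StronglyMeasurable (Function.uncurry fun z w : ℂ => Real.log (‖z - w‖ / r)) := by
    refine Measurable.stronglyMeasurable (Real.measurable_log.comp ?_)
    exact ((continuous_fst.sub continuous_snd).norm.div_const r).measurable
  have hGm : Measurable fun z => 1 / (2 * π) * ∫ w, Real.log (‖z - w‖ / r) ∂ν :=
    measurable_const.mul hjm.integral_prod_right.measurable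
  refine ⟨fun z => 1 / (2 * π) * ∫ w, Real.log (‖z - w‖ / r) ∂ν, hGm, ?_, ?_, ?_, ?_⟩
  · intro S
    obtain ⟨B, hB⟩ := hloc S
    refine ⟨1 / (2 * π) * B, fun z hz => ?_⟩
    rw [abs_mul, abs_of_pos (by positivity : 0 < 1 / (2 * π))]
    have := hB z hz
    have h2 := abs_integral_le_integral_abs (f := fun w => Real.log (‖z - w‖ / r)) (μ := ν)
    gcongr
    exact h2.trans this
  · intro z
    have hnb : ∫ w, Real.posLog (r / ‖z - w‖) ∂ν ≤ C₁ * B2 := by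
      by_cases hz : ‖z - a‖ < (R + 1) * r
      · refine (hnegI z).trans ?_
        gcongr
        refine le_trans (ii_real_mono hD hρ ?_) (hB2' a)
        rw [dist_eq_norm]; nlinarith
      · have : ∫ w, Real.posLog (r / ‖z - w‖) ∂ν = ∫ w, (0:ℝ) ∂ν := by
          refine integral_congr_ae ?_
          filter_upwards [hνball] with w hw
          rw [Real.posLog_eq_zero_iff, abs_of_nonneg (by positivity)]
          have h3 : ‖w - a‖ < R * r := by rw [← dist_eq_norm]; exact hw
          have h2 : ‖z - a‖ ≤ ‖z - w‖ + ‖w - a‖ := norm_sub_le_norm_sub_add_norm_sub z w a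
          have h4 : r < ‖z - w‖ := by nlinarith
          rw [div_le_one (by linarith)]; exact h4.le
        rw [this]; simp; positivity
    have hlow : m * (Real.log (1 + ‖z - a‖ / r) - Real.log (2 + R)) ≤
        ∫ w, Real.posLog (‖z - w‖ / r) ∂ν := by
      have := integral_mono_ae (μ := ν)
        (integrable_const (Real.log (1 + ‖z - a‖ / r) - Real.log (2 + R))) (hposi z) (by
        filter_upwards [hνball] with w hw
        rw [sub_le_iff_le_add, Real.posLog_eq_log_max_one (by positivity),
          ← Real.log_mul (by positivity) (by positivity)]
        refine Real.log_le_log (by positivity) ?_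
        have h3 : ‖w - a‖ < R * r := by rw [← dist_eq_norm]; exact hw
        have h2 : ‖z - a‖ ≤ ‖z - w‖ + ‖w - a‖ := norm_sub_le_norm_sub_add_norm_sub z w a
        have h4 : ‖z - a‖ / r ≤ ‖z - w‖ / r + R := by
          rw [div_le_iff₀ hr, add_mul, div_mul_cancel₀ _ hr.ne']; linarith
        have h5 := le_max_left 1 (‖z - w‖ / r)
        have h6 := le_max_right 1 (‖z - w‖ / r)
        nlinarith)
      rwa [integral_const, hmν, smul_eq_mul] at this
    simp only [hlogeq]
    rw [integral_sub (hposi z) (hnegi z)]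
    have h7 : m * Real.log (2 + R) ≤ B1 * Real.log (2 + R) := by gcongr
    have h8 : m / (2 * π) * Real.log (1 + ‖z - a‖ / r) - CR =
      1 / (2 * π) * (m * Real.log (1 + ‖z - a‖ / r) - (B1 * Real.log (2 + R) + C₁ * B2)) := by
      rw [hCR]; ring
    rw [h8]
    refine mul_le_mul_of_nonneg_left ?_ (by positivity)
    linarith
  · intro z hz
    have h1 : ∫ w, Real.log (‖z - w‖ / r) ∂ν ≤ m * Real.log (2 + R) := by
      simp only [hlogeq]
      rw [integral_sub (hposi z) (hnegi z)]
      have h2 : 0 ≤ ∫ w, Real.posLog (r / ‖z - w‖) ∂ν := integral_nonneg fun w => Real.posLog_nonneg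
      have h3 := hposI z
      have h4 : Real.log (R + (1 + ‖z - a‖ / r)) ≤ Real.log (2 + R) := by
        have : ‖z - a‖ / r ≤ 1 := by rw [div_le_one hr]; exact hz
        have h0 : 0 ≤ ‖z - a‖ / r := by positivity
        exact Real.log_le_log (by positivity) (by linarith)
      nlinarith
    have h7 : m * Real.log (2 + R) ≤ B1 * Real.log (2 + R) := by gcongr
    have h8 : 0 < C₁ * B2 := by positivity
    have h9 : CR = 1 / (2 * π) * (B1 * Real.log (2 + R) + C₁ * B2) := by rw [hCR]; ring
    rw [h9]
    refine mul_le_mul_of_nonneg_left ?_ (by positivity)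
    linarith
  · intro v hv hc
    have hlc := ii_lap_cont hv
    obtain ⟨S, hS⟩ := (ii_lap_supp hv hc).isCompact.isBounded.subset_closedBall 0
    obtain ⟨M, hM⟩ := (ii_lap_supp hv hc).exists_bound_of_continuous hlc
    have o1 : ∀ x, S < ‖x‖ → lap v x = 0 := fun z hz =>
      image_eq_zero_of_notMem_tsupport fun h => (not_le.2 hz) (by simpa using hS h)
    obtain ⟨B, hB0, hB⟩ : ∃ B, 0 ≤ B ∧ ∀ z, ‖z‖ ≤ S → ∫ w, |Real.log (‖z - w‖ / r)| ∂ν ≤ B := by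
      obtain ⟨B, hB⟩ := hloc S
      exact ⟨max B 0, le_max_right _ _, fun z hz => (hB z hz).trans (le_max_left _ _)⟩
    have hintg : Integrable (Function.uncurry fun z w : ℂ => Real.log (‖z - w‖ / r) * lap v z)
        (volume.prod ν) := by
      have hsm : StronglyMeasurable
          (Function.uncurry fun z w : ℂ => Real.log (‖z - w‖ / r) * lap v z) :=
        hjm.mul (hlc.comp continuous_fst).stronglyMeasurable
      rw [integrable_prod_iff hsm.aestronglyMeasurable]
      refine ⟨Eventually.of_forall fun z => by exact (hlogi z).mul_const (lap v z), ?_⟩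
      have e : ∀ z : ℂ, ∫ w, ‖Function.uncurry (fun z w : ℂ => Real.log (‖z - w‖ / r) * lap v z) (z, w)‖ ∂ν
          = (∫ w, |Real.log (‖z - w‖ / r)| ∂ν) * |lap v z| := by
        intro z
        rw [← integral_mul_const]
        congr 1; funext w
        simp [Function.uncurry]
      simp only [e]
      rw [← memLp_one_iff_integrable]
      refine ii_memLp (B := B * M) (R := S) ?_ ?_ ?_ 1
      · have : Measurable fun z => ∫ w, |Real.log (‖z - w‖ / r)| ∂ν :=
          (hjm.norm.integral_prod_right (ν := ν)).measurable
        exact (this.mul hlc.measurable.abs).aestronglyMeasurable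
      · intro z
        have hM0 := (norm_nonneg _).trans (hM z)
        have hJ0 : 0 ≤ ∫ w, |Real.log (‖z - w‖ / r)| ∂ν := integral_nonneg fun w => abs_nonneg _
        by_cases hz : ‖z‖ ≤ S
        · rw [Real.norm_of_nonneg (by positivity)]
          have := hB z hz
          have := hM z
          rw [Real.norm_eq_abs] at this
          gcongr
        · rw [o1 z (not_le.1 hz)]; simp
          positivity
      · intro z hz; rw [o1 z hz]; simp
    have e1 : ∀ z, (1 / (2 * π) * ∫ w, Real.log (‖z - w‖ / r) ∂ν) * lap v z =
        1 / (2 * π) * ∫ w, Real.log (‖z - w‖ / r) * lap v z ∂ν := fun z => by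
      rw [integral_mul_const]; ring
    simp only [e1]
    rw [integral_const_mul, integral_integral_swap hintg]
    simp only [ii_fund' hv hc _ hr]
    rw [integral_const_mul]
    field_simp



theorem ii_locbdd_locint {V : ℂ → ℝ} (hVm : Measurable V)
    (hVb : ∀ R : ℝ, ∃ B, ∀ z, ‖z‖ ≤ R → |V z| ≤ B) : LocallyIntegrable V := by
  refine (locallyIntegrable_iff).2 fun k hk => ?_
  obtain ⟨R, hR⟩ := hk.isBounded.subset_closedBall 0
  obtain ⟨B, hB⟩ := hVb R
  exact IntegrableOn.of_bound hk.measure_lt_top hVm.aestronglyMeasurable B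
    (ae_restrict_of_forall_mem hk.measurableSet fun z hz => hB z (by simpa using hR hz))

theorem ii_int_lap {V : ℂ → ℝ} (hV : LocallyIntegrable V) {v : ℂ → ℝ}
    (hv : ContDiff ℝ (⊤ : ℕ∞) v) (hc : HasCompactSupport v) :
    Integrable fun z => V z * lap v z := by
  have := hV.integrable_smul_right_of_hasCompactSupport (ii_lap_cont hv) (ii_lap_supp hv hc)
  simpa [smul_eq_mul] using this

/-- Local approximation by real parts of holomorphic functions. -/
theorem ii_local {φ : ℂ → ℝ} {μ : Measure ℂ} (hφ : HasDoublingLaplacian φ μ) {ρ : ℂ → ℝ}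
    (hρ : IsRadius μ ρ) : ∃ CA : ℝ, 0 < CA ∧ ∀ a, ∃ h : ℂ → ℂ,
      DifferentiableOn ℂ h (ball a (ρ a / 2)) ∧
      ∀ z ∈ ball a (ρ a / 2), |φ z - (h z).re| ≤ CA := by
  obtain ⟨C, -, hD⟩ := hφ.doubling
  obtain ⟨CR, hCR, hG⟩ := ii_G hD hρ 1 le_rfl
  refine ⟨CR + 1, by positivity, fun a => ?_⟩
  obtain ⟨G, hGm, hGb, hGl, hGu, hGw⟩ := hG a
  have hr := (hρ a).1
  rw [one_mul] at hGl hGw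
  have hGl' : ∀ z, -CR ≤ G z := fun z => by
    refine le_trans ?_ (hGl z)
    have h1 := Real.log_nonneg (ii_K_one hr z)
    have h2 : 0 ≤ μ.real (ball a (ρ a)) / (2 * π) := by
      have := Real.pi_pos
      have : 0 ≤ μ.real (ball a (ρ a)) := measureReal_nonneg
      positivity
    nlinarith [mul_nonneg h2 h1]
  have hGloc := ii_locbdd_locint hGm hGb
  have hφloc : LocallyIntegrable φ := hφ.continuous.locallyIntegrable
  have hFloc : LocallyIntegrable (fun z => φ z - G z) := hφloc.sub hGloc
  -- choose the mollifier
  have huc := (isCompact_closedBall a (2 * ρ a)).uniformContinuousOn_of_continuous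
    hφ.continuous.continuousOn
  obtain ⟨δ, hδ, huc⟩ := Metric.uniformContinuousOn_iff.1 huc 1 one_pos
  obtain ⟨n, hn⟩ := exists_nat_one_div_lt (lt_min hδ (show 0 < ρ a / 4 by linarith))
  have hnδ : 1 / ((n:ℝ) + 1) < δ := hn.trans_le (min_le_left _ _)
  have hnr : 1 / ((n:ℝ) + 1) < ρ a / 4 := hn.trans_le (min_le_right _ _)
  set H : ℂ → ℝ := fun z => ∫ t, ii_chi n (z - t) • (φ t - G t) with hH
  have hHs : ContDiff ℝ (⊤ : ℕ∞) H := (ii_mol hFloc (ii_chi_smooth n) (ii_chi_supp n)).1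
  have hlap : ∀ z ∈ ball a (ρ a / 2), lap H z = 0 := by
    intro z hz
    have hvs : ContDiff ℝ (⊤ : ℕ∞) fun t => ii_chi n (z - t) :=
      (ii_chi_smooth n).comp (contDiff_const.sub contDiff_id)
    have hvc := ii_supp_const_sub (ii_chi_supp n) z
    rw [hH, ii_mol_lap hFloc (ii_chi_smooth n) (ii_chi_supp n) z]
    simp only [sub_mul]
    rw [integral_sub (ii_int_lap hφloc hvs hvc) (ii_int_lap hGloc hvs hvc), hφ.lap_eq _ hvs hvc,
      hGw _ hvs hvc, setIntegral_eq_integral_of_forall_compl_eq_zero, sub_self]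
    intro t ht
    apply ii_chi_zero
    by_contra hc
    apply ht
    rw [mem_ball, dist_comm] at *
    have := dist_triangle a z t
    rw [dist_eq_norm z t] at this
    linarith [not_le.1 hc]
  have hharm : InnerProductSpace.HarmonicOnNhd H (ball a (ρ a / 2)) := by
    intro z hz
    refine ⟨(hHs.of_le ii_two_le).contDiffAt, ?_⟩
    filter_upwards [isOpen_ball.mem_nhds hz] with w hw
    rw [InnerProductSpace.laplacian_eq_iteratedFDeriv_complexPlane]
    exact hlap w hw
  obtain ⟨h, h1, h2⟩ := hharm.exists_analyticOnNhd_ball_re_eq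
  refine ⟨h, h1.differentiableOn, fun z hz => ?_⟩
  have h3 : (h z).re = H z := h2 hz
  have hintg : Integrable fun t => ii_chi n (z - t) • (φ t - G t) :=
    hFloc.integrable_smul_left_of_hasCompactSupport
      ((ii_chi_smooth n).continuous.comp (continuous_const.sub continuous_id))
      (ii_supp_const_sub (ii_chi_supp n) z)
  have hint2 : Integrable fun t => ii_chi n (z - t) • φ z :=
    (((ii_chi_smooth n).continuous.comp (continuous_const.sub
      continuous_id)).integrable_of_hasCompactSupport
      (ii_supp_const_sub (ii_chi_supp n) z)).smul_const _
  have h4 : H z - φ z = ∫ t, ii_chi n (z - t) • ((φ t - G t) - φ z) := by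
    simp only [smul_sub _ _ (φ z)]
    rw [integral_sub hintg hint2, integral_smul_const, ii_chi_int_sub, one_smul]
  rw [h3, abs_sub_comm, h4]
  refine ii_chi_bound n z fun t ht => ?_
  have hz' : dist z a < ρ a / 2 := hz
  have htz : dist t z < 1 / ((n:ℝ) + 1) := by rw [dist_eq_norm]; exact ht
  have hta : dist t a < ρ a := by linarith [dist_triangle t z a]
  have h5 := huc t (mem_closedBall.2 (by linarith)) z (mem_closedBall.2 (by linarith))
    (htz.trans hnδ)
  rw [Real.dist_eq] at h5
  have h6 := hGl' t
  have h7 := hGu t (by rw [← dist_eq_norm]; exact hta.le)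
  rw [abs_le]
  have := abs_lt.1 h5
  constructor <;> linarith



/-! ### Peak functions -/

theorem ii_dbar_mul {f g : ℂ → ℂ} {z : ℂ} (hf : DifferentiableAt ℝ f z)
    (hg : DifferentiableAt ℝ g z) :
    dbar (fun z => f z * g z) z = dbar f z * g z + f z * dbar g z := by
  unfold dbar
  have : HasFDerivAt (fun z => f z * g z) (f z • fderiv ℝ g z + g z • fderiv ℝ f z) z :=
    hf.hasFDerivAt.mul hg.hasFDerivAt
  rw [this.fderiv]
  simp only [_root_.add_apply, _root_.smul_apply, smul_eq_mul]
  ring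

theorem ii_dbar_hol {f : ℂ → ℂ} {z : ℂ} (hf : DifferentiableAt ℂ f z) : dbar f z = 0 := by
  have h := (differentiableAt_complex_iff_differentiableAt_real.1 hf).2
  unfold dbar
  rw [h]
  simp only [smul_eq_mul, ← mul_assoc, Complex.I_mul_I]
  ring

theorem ii_dbar_le (f : ℂ → ℂ) (z : ℂ) : ‖dbar f z‖ ≤ ‖fderiv ℝ f z‖ := by
  unfold dbar
  rw [norm_div, Complex.norm_two, div_le_iff₀ (by norm_num)]
  have h1 := (fderiv ℝ f z).le_opNorm 1
  have h2 := (fderiv ℝ f z).le_opNorm Complex.I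
  rw [norm_one, mul_one] at h1
  rw [Complex.norm_I, mul_one] at h2
  refine (norm_add_le _ _).trans ?_
  rw [norm_smul, Complex.norm_I, one_mul]
  linarith

theorem ii_dbar_congr {f g : ℂ → ℂ} {z : ℂ} (h : f =ᶠ[𝓝 z] g) : dbar f z = dbar g z := by
  unfold dbar; rw [h.fderiv_eq]

theorem ii_dbar_cont1 {f : ℂ → ℂ} (hf : ContDiff ℝ 1 f) : Continuous (dbar f) := by
  have h1 : Continuous (fderiv ℝ f) := hf.continuous_fderiv (by simp)
  unfold dbar
  fun_prop

theorem ii_dbar_ibp {E v : ℂ → ℂ} (hE : ContDiff ℝ 1 E) (hv : ContDiff ℝ (⊤ : ℕ∞) v)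
    (hc : HasCompactSupport v) : ∫ z, E z * dbar v z = - ∫ z, dbar E z * v z := by
  have hEd : Continuous (fderiv ℝ E) := hE.continuous_fderiv (by simp)
  have hvd : Continuous (fderiv ℝ v) := hv.continuous_fderiv (by simp)
  have i1 : ∀ e, Integrable fun z => fderiv ℝ E z e * v z := fun e =>
    (((hEd.clm_apply continuous_const).mul hv.continuous)).integrable_of_hasCompactSupport hc.mul_left
  have i2 : ∀ e, Integrable fun z => E z * fderiv ℝ v z e := fun e =>
    ((hE.continuous.mul (hvd.clm_apply continuous_const))).integrable_of_hasCompactSupport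
      (hc.fderiv_apply ℝ e).mul_left
  have i3 : Integrable fun z => E z * v z :=
    (hE.continuous.mul hv.continuous).integrable_of_hasCompactSupport hc.mul_left
  have key : ∀ e, ∫ z, E z * fderiv ℝ v z e = - ∫ z, fderiv ℝ E z e * v z := fun e =>
    integral_mul_fderiv_eq_neg_fderiv_mul_of_integrable (i1 e) (i2 e) i3
      (fun x _ => hE.differentiable (by simp) x) (fun x _ => hv.differentiable (by simp) x)
  have e1 : ∀ z, E z * dbar v z = (1/2) * (E z * fderiv ℝ v z 1)
      + (Complex.I / 2) * (E z * fderiv ℝ v z Complex.I) := fun z => by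
    unfold dbar; rw [smul_eq_mul]; ring
  have e2 : ∀ z, dbar E z * v z = (1/2) * (fderiv ℝ E z 1 * v z)
      + (Complex.I / 2) * (fderiv ℝ E z Complex.I * v z) := fun z => by
    unfold dbar; rw [smul_eq_mul]; ring
  simp only [e1, e2]
  rw [integral_add ((i2 1).const_mul _) ((i2 _).const_mul _),
    integral_add ((i1 1).const_mul _) ((i1 _).const_mul _)]
  simp only [integral_const_mul, key]
  ring

theorem ii_Ebump : ∃ B0 : ℝ, 0 < B0 ∧ ∀ (a : ℂ) (r : ℝ), 0 < r → ∀ h : ℂ → ℂ,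
    DifferentiableOn ℂ h (ball a (r / 2)) → ∃ E : ℂ → ℂ, ContDiff ℝ 1 E ∧
      (∀ z, ‖z - a‖ ≤ r / 8 → E z = Complex.exp (h z)) ∧
      (∀ z, r / 4 ≤ ‖z - a‖ → E z = 0) ∧
      (∀ z, ‖E z‖ ≤ ‖Complex.exp (h z)‖) ∧
      (∀ z, ‖z - a‖ < r / 8 → dbar E z = 0) ∧
      (∀ z, r / 4 < ‖z - a‖ → dbar E z = 0) ∧
      (∀ z, ‖dbar E z‖ ≤ B0 / r * ‖Complex.exp (h z)‖) := by
  let χ0 : ContDiffBump (0 : ℂ) := ⟨1/8, 1/4, by norm_num, by norm_num⟩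
  set X : ℂ → ℂ := fun w => (χ0 w : ℂ) with hX
  have hXs : ContDiff ℝ (⊤ : ℕ∞) X := Complex.ofRealCLM.contDiff.comp χ0.contDiff
  have hXc : HasCompactSupport X := χ0.hasCompactSupport.comp_left (g := Complex.ofReal) rfl
  obtain ⟨B, hB⟩ := (hXc.fderiv ℝ).exists_bound_of_continuous (hXs.continuous_fderiv (by simp))
  have hB0 : 0 ≤ B := (norm_nonneg _).trans (hB 0)
  refine ⟨B + 1, by positivity, fun a r hr h hh => ?_⟩
  set χ : ℂ → ℂ := fun z => X ((1 / r : ℝ) • (z - a)) with hχ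
  have hnorm : ∀ z, ‖(1 / r : ℝ) • (z - a)‖ = ‖z - a‖ / r := fun z => by
    rw [norm_smul, Real.norm_of_nonneg (by positivity)]; ring
  have hlin : ContDiff ℝ (⊤ : ℕ∞) (fun z : ℂ => (1 / r : ℝ) • (z - a)) := by
    exact (contDiff_id.sub contDiff_const).const_smul (1 / r : ℝ)
  have hχs : ContDiff ℝ (⊤ : ℕ∞) χ := hXs.comp hlin
  have hχ1 : ∀ z, ‖z - a‖ ≤ r / 8 → χ z = 1 := by
    intro z hz
    have : χ0 ((1 / r : ℝ) • (z - a)) = 1 := χ0.one_of_mem_closedBall (by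
      rw [mem_closedBall, dist_zero_right, hnorm, div_le_iff₀ hr]
      show _ ≤ 1/8 * r
      linarith)
    simp only [hχ, hX, this, Complex.ofReal_one, Complex.ofReal_zero]
  have hχ0 : ∀ z, r / 4 ≤ ‖z - a‖ → χ z = 0 := by
    intro z hz
    have : χ0 ((1 / r : ℝ) • (z - a)) = 0 := χ0.zero_of_le_dist (by
      rw [dist_zero_right, hnorm, le_div_iff₀ hr]
      show 1/4 * r ≤ _
      linarith)
    simp only [hχ, hX, this, Complex.ofReal_one, Complex.ofReal_zero]
  have hχn : ∀ z, ‖χ z‖ ≤ 1 := by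
    intro z
    rw [hχ, hX]
    simp only [Complex.norm_real]
    rw [Real.norm_of_nonneg χ0.nonneg]; exact χ0.le_one
  have hχd : ∀ z, ‖dbar χ z‖ ≤ B / r := by
    intro z
    have h1 : HasFDerivAt (fun z : ℂ => (1 / r : ℝ) • (z - a))
        ((1 / r : ℝ) • ContinuousLinearMap.id ℝ ℂ) z :=
      ((hasFDerivAt_id z).sub_const a).const_smul (1 / r : ℝ)
    have h2 : HasFDerivAt χ ((fderiv ℝ X ((1 / r : ℝ) • (z - a))).comp
        ((1 / r : ℝ) • ContinuousLinearMap.id ℝ ℂ)) z :=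
      ((hXs.differentiable (by simp) _).hasFDerivAt).comp z h1
    refine (ii_dbar_le χ z).trans ?_
    rw [h2.fderiv, ContinuousLinearMap.comp_smul, ContinuousLinearMap.comp_id, norm_smul,
      Real.norm_of_nonneg (by positivity)]
    have := hB ((1 / r : ℝ) • (z - a))
    rw [div_mul_eq_mul_div, one_mul]
    gcongr
  set E : ℂ → ℂ := fun z => χ z * Complex.exp (h z) with hE
  have hhd : ∀ z, ‖z - a‖ < r / 2 → DifferentiableAt ℂ (fun z => Complex.exp (h z)) z := fun z hz =>
    (hh.differentiableAt (isOpen_ball.mem_nhds (by rw [mem_ball, dist_eq_norm]; exact hz))).cexp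
  have hout : ∀ z, r / 4 < ‖z - a‖ → E =ᶠ[𝓝 z] fun _ => 0 := by
    intro z hz
    have : ∀ᶠ w in 𝓝 z, r / 4 < ‖w - a‖ :=
      ((continuous_id.sub continuous_const).norm.tendsto z).eventually (lt_mem_nhds hz)
    filter_upwards [this] with w hw
    simp [hE, hχ0 w hw.le]
  have hdE : ∀ z, dbar E z = dbar χ z * Complex.exp (h z) := by
    intro z
    by_cases hz : ‖z - a‖ < r / 2
    · rw [hE, ii_dbar_mul (hχs.differentiable (by simp) z) ((hhd z hz).restrictScalars ℝ),
        ii_dbar_hol (hhd z hz), mul_zero, add_zero]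
    · have h2 : r / 4 < ‖z - a‖ := by linarith [not_lt.1 hz]
      have h3 : χ =ᶠ[𝓝 z] fun _ => 0 := by
        have : ∀ᶠ w in 𝓝 z, r / 4 < ‖w - a‖ :=
          ((continuous_id.sub continuous_const).norm.tendsto z).eventually (lt_mem_nhds h2)
        filter_upwards [this] with w hw using hχ0 w hw.le
      rw [ii_dbar_congr (hout z h2), ii_dbar_congr h3]
      simp [dbar]
  refine ⟨E, ?_, ?_, ?_, ?_, ?_, ?_, ?_⟩
  · refine contDiff_iff_contDiffAt.2 fun z => ?_
    by_cases hz : ‖z - a‖ < r / 2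
    · have h1 : AnalyticAt ℂ h z := hh.analyticAt
        (isOpen_ball.mem_nhds (by rw [mem_ball, dist_eq_norm]; exact hz))
      have h2 : ContDiffAt ℂ 1 (fun z => Complex.exp (h z)) z := h1.cexp.contDiffAt
      exact ((hχs.of_le (by simp)).contDiffAt).mul (h2.restrict_scalars ℝ)
    · exact contDiffAt_const.congr_of_eventuallyEq (hout z (by linarith [not_lt.1 hz]))
  · intro z hz; simp [hE, hχ1 z hz]
  · intro z hz; simp [hE, hχ0 z hz]
  · intro z; rw [hE]; simp only [norm_mul]
    exact mul_le_of_le_one_left (norm_nonneg _) (hχn z)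
  · intro z hz
    have h3 : χ =ᶠ[𝓝 z] fun _ => 1 := by
      have : ∀ᶠ w in 𝓝 z, ‖w - a‖ < r / 8 :=
        ((continuous_id.sub continuous_const).norm.tendsto z).eventually (gt_mem_nhds hz)
      filter_upwards [this] with w hw using hχ1 w hw.le
    rw [hdE, ii_dbar_congr h3]
    simp [dbar]
  · intro z hz
    rw [ii_dbar_congr (hout z hz)]; simp [dbar]
  · intro z
    rw [hdE, norm_mul]
    have := hχd z
    gcongr
    refine this.trans ?_
    gcongr
    linarith



theorem ii_corr {u E H g : ℂ → ℂ} {a : ℂ} {s0 : ℝ} (hs0 : 0 < s0)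
    (hE : ContDiff ℝ 1 E) (hEH : ∀ z, ‖z - a‖ ≤ s0 → E z = H z)
    (hH : DifferentiableOn ℂ H (closedBall a s0))
    (hu : LocallyIntegrable u) (hu2 : IntegrableOn (fun z => ‖u z‖ ^ 2) (closedBall a s0))
    (hd : IsDistribDbarOf u g) (hg : ∀ z, g z * (z - a) = dbar E z) :
    ∃ P : ℂ → ℂ, Differentiable ℂ P ∧ P a = H a ∧
      (fun z => E z - (z - a) * u z) =ᵐ[volume] P := by
  have c1 : Continuous fun z : ℂ => z - a := continuous_id.sub continuous_const
  have l1 : LocallyIntegrable fun z => (z - a) * u z := by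
    refine (locallyIntegrable_iff).2 fun k hk => ?_
    exact IntegrableOn.continuousOn_mul c1.continuousOn (hu.integrableOn_isCompact hk) hk
  have l2 : LocallyIntegrable fun z => E z - (z - a) * u z :=
    (hE.continuous.locallyIntegrable).sub l1
  obtain ⟨P, hP, hPe⟩ := ii_weyl l2 (fun v hv hc => by
    have hdc : Continuous (dbar v) := ii_dbar_cont1 (hv.of_le (by simp))
    have hds : HasCompactSupport (dbar v) := ii_dbar_supp hc
    have hlin : ContDiff ℝ (⊤ : ℕ∞) fun z : ℂ => z - a := contDiff_id.sub contDiff_const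
    have t1 := hd (fun z => (z - a) * v z) (hlin.mul hv) hc.mul_left
    have t2 : ∀ z, dbar (fun z => (z - a) * v z) z = (z - a) * dbar v z := fun z => by
      rw [ii_dbar_mul (hlin.differentiable (by simp) z) (hv.differentiable (by simp) z),
        ii_dbar_hol (f := fun z => z - a) (differentiableAt_id.sub_const a), zero_mul, zero_add]
    have t3 := ii_dbar_ibp hE hv hc
    have i1 : Integrable fun z => E z * dbar v z :=
      (hE.continuous.mul hdc).integrable_of_hasCompactSupport hds.mul_left
    have i2 : Integrable fun z => (z - a) * u z * dbar v z := by
      have := l1.integrable_smul_right_of_hasCompactSupport hdc hds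
      exact this
    have e1 : ∀ z, (E z - (z - a) * u z) * dbar v z = E z * dbar v z - (z - a) * u z * dbar v z :=
      fun z => by ring
    simp only [e1]
    rw [integral_sub i1 i2, t3]
    have e2 : ∫ z, g z * ((z - a) * v z) = ∫ z, dbar E z * v z := by
      refine integral_congr_ae (Eventually.of_forall fun z => ?_)
      simp only [← mul_assoc, hg]
    have e3 : ∫ z, u z * dbar (fun z => (z - a) * v z) z = ∫ z, (z - a) * u z * dbar v z := by
      refine integral_congr_ae (Eventually.of_forall fun z => ?_)
      simp only [t2]; ring
    rw [← e2, t1, e3]; ring)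
  refine ⟨P, hP, ?_, hPe⟩
  set N : ℂ → ℂ := fun z => H z - P z with hN
  suffices h0 : N a = 0 by exact (sub_eq_zero.1 h0).symm
  have key : ∀ t : ℝ, 0 < t → ∀ s, 0 < s → s ≤ s0 →
      π * ‖N a‖ ≤ π * t + 1 / (4 * t) * ∫ z in closedBall a s, ‖u z‖ ^ 2 := by
    intro t ht s hs hss
    have hsub : closedBall a s ⊆ closedBall a s0 := closedBall_subset_closedBall hss
    have hND : DifferentiableOn ℂ N (closedBall a s) :=
      (hH.mono hsub).sub hP.differentiableOn
    have h1 := ii_submean hs hND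
    haveI : IsFiniteMeasure (volume.restrict (closedBall a s)) :=
      ⟨by rw [Measure.restrict_apply_univ]; exact measure_closedBall_lt_top⟩
    have hI : IntegrableOn (fun z => ‖u z‖ ^ 2) (closedBall a s) := hu2.mono_set hsub
    have h2 : ∫ z in closedBall a s, ‖N z‖ ≤
        ∫ z in closedBall a s, (t + s ^ 2 * (1 / (4 * t) * ‖u z‖ ^ 2)) := by
      have hae : ∀ᵐ z ∂(volume.restrict (closedBall a s)),
          ‖N z‖ ≤ t + s ^ 2 * (1 / (4 * t) * ‖u z‖ ^ 2) := by
        filter_upwards [ae_restrict_of_ae hPe, ae_restrict_mem measurableSet_closedBall] with z hz hzm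
        have hzn : ‖z - a‖ ≤ s := by simpa [dist_eq_norm] using hzm
        have : N z = (z - a) * u z := by
          simp only [hN, ← hz, hEH z (hzn.trans hss)]; ring
        rw [this, norm_mul]
        have h3 : ‖z - a‖ * ‖u z‖ ≤ s * ‖u z‖ := by gcongr
        refine h3.trans ?_
        have h4 : t + s ^ 2 * (1 / (4 * t) * ‖u z‖ ^ 2) - s * ‖u z‖ = (2 * t - s * ‖u z‖) ^ 2 / (4 * t) := by
          field_simp; ring
        have h5 : 0 ≤ (2 * t - s * ‖u z‖) ^ 2 / (4 * t) := by positivity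
        linarith
      refine integral_mono_ae ?_ ?_ hae
      · exact (hND.continuousOn.norm).integrableOn_compact (isCompact_closedBall a s)
      · exact (integrable_const _).add ((hI.const_mul _).const_mul _)
    have h6 : ∫ z in closedBall a s, (t + s ^ 2 * (1 / (4 * t) * ‖u z‖ ^ 2)) =
        π * s ^ 2 * t + s ^ 2 * (1 / (4 * t) * ∫ z in closedBall a s, ‖u z‖ ^ 2) := by
      rw [integral_add (integrable_const _) ((hI.const_mul _).const_mul _), integral_const_mul,
        integral_const_mul, setIntegral_const, Measure.real, Complex.volume_closedBall]
      simp [ENNReal.toReal_ofReal hs.le]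
      left; ring
    rw [h6] at h2
    have h7 := h1.trans h2
    have hs2 : 0 < s ^ 2 := by positivity
    refine le_of_mul_le_mul_left ?_ hs2
    nlinarith [h7]
  have lim : Tendsto (fun s : ℝ => ∫ z in closedBall a s, ‖u z‖ ^ 2) (𝓝[>] 0) (𝓝 0) := by
    have hh := Integrable.tendsto_setIntegral_nhds_zero (s := fun s : ℝ => closedBall a s) (l := 𝓝[>] (0 : ℝ)) hu2 (by
      have h1 : Tendsto (fun s : ℝ => ENNReal.ofReal s ^ 2 * NNReal.pi) (𝓝[>] 0) (𝓝 0) := by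
        have : Tendsto (fun s : ℝ => ENNReal.ofReal s ^ 2 * NNReal.pi) (𝓝 0)
            (𝓝 (ENNReal.ofReal 0 ^ 2 * NNReal.pi)) := by
          refine ENNReal.Tendsto.mul_const ?_ (Or.inr (by simp))
          exact (ENNReal.continuous_pow 2).tendsto _ |>.comp (ENNReal.continuous_ofReal.tendsto 0)
        simp at this
        exact this.mono_left nhdsWithin_le_nhds
      refine tendsto_of_tendsto_of_tendsto_of_le_of_le tendsto_const_nhds h1 (fun _ => zero_le) ?_
      intro s
      simp only [Function.comp]
      refine (Measure.restrict_apply_le _ _).trans ?_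
      rw [Complex.volume_closedBall])
    refine hh.congr' ?_
    have : ∀ᶠ s : ℝ in 𝓝[>] 0, s < s0 := nhdsWithin_le_nhds (gt_mem_nhds hs0)
    filter_upwards [this] with s hs
    rw [Measure.restrict_restrict measurableSet_closedBall,
      inter_eq_left.2 (closedBall_subset_closedBall hs.le)]
  have key2 : ∀ t : ℝ, 0 < t → π * ‖N a‖ ≤ π * t := by
    intro t ht
    have h1 : Tendsto (fun s : ℝ => π * t + 1 / (4 * t) * ∫ z in closedBall a s, ‖u z‖ ^ 2) (𝓝[>] 0)
        (𝓝 (π * t + 1 / (4 * t) * 0)) := (lim.const_mul _).const_add _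
    rw [mul_zero, add_zero] at h1
    refine ge_of_tendsto h1 ?_
    have h2 : ∀ᶠ s : ℝ in 𝓝[>] 0, s < s0 := nhdsWithin_le_nhds (gt_mem_nhds hs0)
    filter_upwards [h2, self_mem_nhdsWithin] with s hs hs'
    exact key t ht s hs' hs.le
  have key3 : ‖N a‖ ≤ 0 := by
    refine le_of_forall_pos_le_add fun t ht => ?_
    rw [zero_add]
    exact le_of_mul_le_mul_left (key2 t ht) Real.pi_pos
  exact norm_le_zero_iff.1 key3



theorem ii_ballint (a : ℂ) {r : ℝ} (hr : 0 < r) (c : ℝ) :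
    Integrable ((closedBall a r).indicator fun _ : ℂ => c) ∧
    ∫ z, (closedBall a r).indicator (fun _ : ℂ => c) z = c * (π * r ^ 2) := by
  constructor
  · exact (integrable_indicator_iff measurableSet_closedBall).2
      (integrableOn_const measure_closedBall_lt_top.ne)
  · rw [integral_indicator measurableSet_closedBall, setIntegral_const, Measure.real,
      Complex.volume_closedBall]
    simp [ENNReal.toReal_ofReal hr.le]
    ring

theorem ii_weight {φ : ℂ → ℝ} {μ : Measure ℂ} (hφ : HasDoublingLaplacian φ μ) {ρ : ℂ → ℝ}
    (hρ : IsRadius μ ρ) {ε : ℝ} (hε : 0 < ε) (a : ℂ) {r s : ℝ} (hr : 0 < r) {G : ℂ → ℝ}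
    (hGm : Measurable G) (hGb : ∀ S, ∃ B, ∀ z, ‖z‖ ≤ S → |G z| ≤ B)
    (hG : ∀ v : ℂ → ℝ, ContDiff ℝ (⊤ : ℕ∞) v → HasCompactSupport v →
        ∫ z, G z * lap v z = ∫ z in ball a s, v z ∂μ)
    (v : ℂ → ℝ) (hv : ContDiff ℝ (⊤ : ℕ∞) v) (hc : HasCompactSupport v) (hv0 : ∀ z, 0 ≤ v z) :
    ∫ z, v z * (8 * r ^ 2 / (r ^ 2 + ‖z - a‖ ^ 2) ^ 2) ≤
      ∫ z, (2 * ε * (φ z - G z) + 2 * Real.log (1 + ‖z - a‖ ^ 2 / r ^ 2)) * lap v z := by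
  obtain ⟨C, -, hD⟩ := hφ.doubling
  have := ii_finite_compacts hD hρ
  have hr2 : 0 < r ^ 2 := by positivity
  have i1 : Integrable fun z => φ z * lap v z :=
    ii_int_lap hφ.continuous.locallyIntegrable hv hc
  have i2 : Integrable fun z => G z * lap v z := ii_int_lap (ii_locbdd_locint hGm hGb) hv hc
  have cl : Continuous fun z : ℂ => Real.log (1 + ‖z - a‖ ^ 2 / r ^ 2) := by
    refine Continuous.log (by fun_prop) fun z => ?_
    positivity
  have i3 : Integrable fun z => Real.log (1 + ‖z - a‖ ^ 2 / r ^ 2) * lap v z :=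
    ii_int_lap cl.locallyIntegrable hv hc
  have i12 : Integrable fun z => φ z * lap v z - G z * lap v z := i1.sub i2
  have e1 : ∀ z, (2 * ε * (φ z - G z) + 2 * Real.log (1 + ‖z - a‖ ^ 2 / r ^ 2)) * lap v z =
      (2 * ε) * (φ z * lap v z - G z * lap v z) +
        2 * (Real.log (1 + ‖z - a‖ ^ 2 / r ^ 2) * lap v z) := fun z => by ring
  have e2 : ∫ z, (2 * ε * (φ z - G z) + 2 * Real.log (1 + ‖z - a‖ ^ 2 / r ^ 2)) * lap v z =
      (2 * ε) * (∫ z, v z ∂μ - ∫ z in ball a s, v z ∂μ) +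
        2 * ∫ z, Real.log (1 + ‖z - a‖ ^ 2 / r ^ 2) * lap v z := by
    simp only [e1]
    rw [integral_add (i12.const_mul _) (i3.const_mul _), integral_const_mul,
      integral_const_mul, integral_sub i1 i2, hφ.lap_eq v hv hc, hG v hv hc]
  have hd : ∀ t : ℝ, 0 ≤ t → HasDerivAt (fun t => Real.log (1 + t / r ^ 2)) (1 / (r ^ 2 + t)) t := by
    intro t ht
    have h1 : HasDerivAt (fun t : ℝ => 1 + t / r ^ 2) (1 / r ^ 2) t :=
      ((hasDerivAt_id t).div_const _).const_add 1
    have h2 := h1.log (by positivity)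
    convert h2 using 1
    field_simp
  have hd2 : ∀ t : ℝ, 0 ≤ t → HasDerivAt (fun t : ℝ => 1 / (r ^ 2 + t)) (-1 / (r ^ 2 + t) ^ 2) t := by
    intro t ht
    have h1 : HasDerivAt (fun t : ℝ => r ^ 2 + t) 1 t := (hasDerivAt_id t).const_add _
    have h2 := h1.inv (by positivity)
    simp only [one_div]
    exact h2
  have hd3 : ContinuousOn (fun t : ℝ => -1 / (r ^ 2 + t) ^ 2) (Ici 0) := by
    refine ContinuousOn.div (by fun_prop) (by fun_prop) fun t ht => ?_
    have : 0 ≤ t := ht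
    positivity
  have e3 := ii_ibp_radial hd hd2 hd3 hv hc a
  have e4 : 2 * ∫ z, Real.log (1 + ‖z - a‖ ^ 2 / r ^ 2) * lap v z =
      ∫ z, v z * (8 * r ^ 2 / (r ^ 2 + ‖z - a‖ ^ 2) ^ 2) := by
    rw [e3, ← integral_const_mul]
    refine integral_congr_ae (Eventually.of_forall fun z => ?_)
    simp only
    field_simp
    ring
  rw [e2, e4]
  have h5 : ∫ z in ball a s, v z ∂μ ≤ ∫ z, v z ∂μ :=
    setIntegral_le_integral (hv.continuous.integrable_of_hasCompactSupport hc)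
      (Eventually.of_forall hv0)
  have h6 : 0 ≤ 2 * ε * (∫ z, v z ∂μ - ∫ z in ball a s, v z ∂μ) :=
    mul_nonneg (by positivity) (by linarith)
  linarith


set_option maxHeartbeats 2000000 in
theorem ii_pre {φ : ℂ → ℝ} {μ : Measure ℂ} (hφ : HasDoublingLaplacian φ μ) {ρ : ℂ → ℝ}
    (hρ : IsRadius μ ρ) {ε : ℝ} (hε : 0 < ε) (N : ℕ) : ∃ T : ℝ, 0 < T ∧ ∀ a, ∃ P : ℂ → ℂ,
      Differentiable ℂ P ∧ P a = 1 ∧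
      Integrable (fun z => ‖P z‖ ^ 2 * Real.exp (-(2 * ε * (φ z - φ a))) *
        (1 + ‖z - a‖ / ρ a) ^ N) ∧
      ∫ z, ‖P z‖ ^ 2 * Real.exp (-(2 * ε * (φ z - φ a))) * (1 + ‖z - a‖ / ρ a) ^ N
        ≤ T * ρ a ^ 2 := by
  obtain ⟨C, -, hD⟩ := hφ.doubling
  obtain ⟨CA, hCA, hloc⟩ := ii_local hφ hρ
  obtain ⟨B0, hB0, hbump⟩ := ii_Ebump
  obtain ⟨R, hR1, hR⟩ := ii_big hD hρ (π * (N + 6) / ε)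
  obtain ⟨CR, hCR, hGG⟩ := ii_G hD hρ R hR1
  set T0 : ℝ := 32 * B0 ^ 2 * Real.exp (2 * ε * (CA + CR)) * π with hT0
  set T1 : ℝ := 2 * Real.exp (2 * ε * CA) * 2 ^ N * π + 2 * Real.exp (2 * ε * CR) * (4 * T0) with hT1
  have hT0p : 0 < T0 := by positivity
  refine ⟨Real.exp (2 * ε * CA) * T1, by positivity, fun a => ?_⟩
  set r := ρ a with hr'
  have hr : 0 < r := (hρ a).1
  have hr2 : 0 < r ^ 2 := by positivity
  obtain ⟨h, hh, hhφ⟩ := hloc a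
  obtain ⟨G, hGm, hGb, hGlow, hGup, hGlap⟩ := hGG a
  have hεh : DifferentiableOn ℂ (fun z => (ε : ℂ) * h z) (ball a (r / 2)) :=
    (differentiableOn_const _).mul hh
  obtain ⟨E, hE1, hE2, hE3, hE4, hE5, hE6, hE7⟩ := hbump a r hr _ hεh
  have hexp : ∀ z, ‖Complex.exp ((ε : ℂ) * h z)‖ = Real.exp (ε * (h z).re) := fun z => by
    rw [Complex.norm_exp]; simp
  have hexpφ : ∀ z, ‖z - a‖ < r / 2 → ‖Complex.exp ((ε : ℂ) * h z)‖ ≤ Real.exp (ε * (φ z + CA)) := by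
    intro z hz
    rw [hexp, Real.exp_le_exp]
    have := abs_le.1 (hhφ z (by rw [mem_ball, dist_eq_norm]; exact hz))
    exact mul_le_mul_of_nonneg_left (by linarith) hε.le
  set V : ℂ → ℝ := fun z => 2 * ε * (φ z - G z) + 2 * Real.log (1 + ‖z - a‖ ^ 2 / r ^ 2) with hV
  set q : ℂ → ℝ := fun z => 8 * r ^ 2 / (r ^ 2 + ‖z - a‖ ^ 2) ^ 2 with hq
  have cl : Continuous fun z : ℂ => Real.log (1 + ‖z - a‖ ^ 2 / r ^ 2) := by
    refine Continuous.log (by fun_prop) fun z => ?_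
    positivity
  have hVm : Measurable V :=
    ((hφ.continuous.measurable.sub hGm).const_mul _).add (cl.measurable.const_mul _)
  have hVb : ∀ S : ℝ, ∃ B, ∀ z, ‖z‖ ≤ S → |V z| ≤ B := by
    intro S
    obtain ⟨B1, hB1⟩ := (isCompact_closedBall (0 : ℂ) S).exists_bound_of_continuousOn hφ.continuous.continuousOn
    obtain ⟨B2, hB2⟩ := hGb S
    obtain ⟨B3, hB3⟩ := (isCompact_closedBall (0 : ℂ) S).exists_bound_of_continuousOn cl.continuousOn
    refine ⟨2 * ε * (B1 + B2) + 2 * B3, fun z hz => ?_⟩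
    have h1 := hB1 z (by simpa using hz)
    have h2 := hB2 z hz
    have h3 := hB3 z (by simpa using hz)
    rw [Real.norm_eq_abs] at h1 h3
    calc |V z| ≤ |2 * ε * (φ z - G z)| + |2 * Real.log (1 + ‖z - a‖ ^ 2 / r ^ 2)| := abs_add_le _ _
      _ = 2 * ε * |φ z - G z| + 2 * |Real.log (1 + ‖z - a‖ ^ 2 / r ^ 2)| := by
        rw [abs_mul, abs_mul 2 (Real.log _), abs_of_pos (by positivity : 0 < 2 * ε), abs_two]
      _ ≤ 2 * ε * (B1 + B2) + 2 * B3 := by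
        have : |φ z - G z| ≤ B1 + B2 := (abs_sub _ _).trans (by linarith)
        have := mul_le_mul_of_nonneg_left this (by positivity : 0 ≤ 2 * ε)
        linarith
  have hqc : Continuous q := by
    refine Continuous.div (by fun_prop) (by fun_prop) fun z => ?_
    positivity
  have hq0 : ∀ z, 0 < q z := fun z => by positivity
  set g : ℂ → ℂ := fun z => dbar E z / (z - a) with hg
  have hga : dbar E a = 0 := hE5 a (by simp; positivity)
  have hgm : ∀ z, g z * (z - a) = dbar E z := by
    intro z
    by_cases hz : z = a
    · rw [hz, hga]; simp
    · exact div_mul_cancel₀ _ (sub_ne_zero.2 hz)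
  have hgc : Continuous g := by
    rw [continuous_iff_continuousAt]
    intro z
    by_cases hz : z = a
    · have : g =ᶠ[𝓝 z] fun _ => 0 := by
        have : ∀ᶠ w in 𝓝 z, ‖w - a‖ < r / 8 := by
          refine ((continuous_id.sub continuous_const).norm.tendsto z).eventually (gt_mem_nhds ?_)
          simp [hz]; positivity
        filter_upwards [this] with w hw
        simp [hg, hE5 w hw]
      exact continuousAt_const.congr this.symm
    · exact (ii_dbar_cont1 hE1).continuousAt.div (by fun_prop) (sub_ne_zero.2 hz)
  have hgout : ∀ z, r / 4 < ‖z - a‖ → g z = 0 := fun z hz => by simp [hg, hE6 z hz]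
  have hgs : HasCompactSupport g := by
    refine HasCompactSupport.intro (isCompact_closedBall a (r / 4)) fun z hz => hgout z ?_
    simpa [dist_eq_norm] using hz
  obtain ⟨u, hum, hul, hui, hub, hud⟩ := ii_hormander hVm hVb hqc hq0
    (fun v hv hc hv0 => ii_weight hφ hρ hε a hr hGm hGb hGlap v hv hc hv0) hgc hgs
  have hdata : ∫ z, ‖g z‖ ^ 2 * Real.exp (-V z) / q z ≤ T0 := by
    obtain ⟨j1, j2⟩ := ii_ballint a hr (32 * B0 ^ 2 * Real.exp (2 * ε * (CA + CR)) / r ^ 2)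
    have : T0 = 32 * B0 ^ 2 * Real.exp (2 * ε * (CA + CR)) / r ^ 2 * (π * r ^ 2) := by
      rw [hT0]; field_simp
    rw [this, ← j2]
    refine integral_mono_of_nonneg (Eventually.of_forall fun z => ?_) j1
      (Eventually.of_forall fun z => ?_)
    · have := (hq0 z).le
      simp only [Pi.zero_apply]
      positivity
    · simp only
      by_cases h1 : r / 4 < ‖z - a‖
      · rw [hgout z h1]
        simp only [norm_zero, ne_eq, OfNat.ofNat_ne_zero, not_false_eq_true, zero_pow, zero_mul, zero_div]
        exact indicator_nonneg (fun _ _ => by positivity) _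
      push Not at h1
      rw [indicator_of_mem (by rw [mem_closedBall, dist_eq_norm]; linarith)]
      by_cases h2 : ‖z - a‖ < r / 8
      · have : g z = 0 := by simp [hg, hE5 z h2]
        rw [this]
        simp only [norm_zero, ne_eq, OfNat.ofNat_ne_zero, not_false_eq_true, zero_pow, zero_mul, zero_div]
        positivity
      push Not at h2
      have hza : 0 < ‖z - a‖ := by linarith [hr]
      have g1 : ‖g z‖ ≤ 8 * B0 / r ^ 2 * Real.exp (ε * (φ z + CA)) := by
        rw [hg]
        simp only [norm_div]
        rw [div_le_iff₀ hza]
        refine (hE7 z).trans ?_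
        have e1 := hexpφ z (by linarith)
        calc B0 / r * ‖Complex.exp ((ε : ℂ) * h z)‖ ≤ B0 / r * Real.exp (ε * (φ z + CA)) := by gcongr
          _ = 8 * B0 / r ^ 2 * Real.exp (ε * (φ z + CA)) * (r / 8) := by field_simp
          _ ≤ _ := by gcongr
      have g2 : Real.exp (-V z) ≤ Real.exp (-(2 * ε * φ z) + 2 * ε * CR) := by
        rw [Real.exp_le_exp, hV]
        have l0 : 0 ≤ Real.log (1 + ‖z - a‖ ^ 2 / r ^ 2) := Real.log_nonneg (by
          have : 0 ≤ ‖z - a‖ ^ 2 / r ^ 2 := by positivity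
          linarith)
        have l1 := mul_le_mul_of_nonneg_left (hGup z (by linarith)) (by positivity : 0 ≤ 2 * ε)
        simp only
        linarith
      have g3 : 1 / q z ≤ r ^ 2 / 2 := by
        rw [hq]
        simp only
        rw [one_div_div, div_le_div_iff₀ (by positivity) (by norm_num)]
        have : ‖z - a‖ ^ 2 ≤ r ^ 2 := by gcongr; linarith
        have : (r ^ 2 + ‖z - a‖ ^ 2) ^ 2 ≤ (2 * r ^ 2) ^ 2 := by gcongr; linarith
        nlinarith
      calc ‖g z‖ ^ 2 * Real.exp (-V z) / q z = ‖g z‖ ^ 2 * Real.exp (-V z) * (1 / q z) := by ring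
        _ ≤ (8 * B0 / r ^ 2 * Real.exp (ε * (φ z + CA))) ^ 2 *
            Real.exp (-(2 * ε * φ z) + 2 * ε * CR) * (r ^ 2 / 2) := by
          have := (hq0 z).le
          gcongr
        _ = 32 * B0 ^ 2 * (Real.exp (ε * (φ z + CA)) ^ 2 * Real.exp (-(2 * ε * φ z) + 2 * ε * CR)) / r ^ 2 := by
          field_simp; ring
        _ = _ := by
          rw [← Real.exp_nat_mul, ← Real.exp_add]
          congr 4
          push_cast; ring
  have hu2 : ∀ s, IntegrableOn (fun z => ‖u z‖ ^ 2) (closedBall a s) := by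
    intro s
    obtain ⟨B, hB⟩ := hVb (‖a‖ + s)
    refine Integrable.mono' ((hui.const_mul (Real.exp B)).integrableOn (s := closedBall a s))
      (hum.norm.pow 2).restrict (ae_restrict_of_forall_mem measurableSet_closedBall fun z hz => ?_)
    have hz' : ‖z‖ ≤ ‖a‖ + s := by
      have : ‖z - a‖ ≤ s := by simpa [dist_eq_norm] using hz
      calc ‖z‖ = ‖a + (z - a)‖ := by congr 1; ring
        _ ≤ _ := (norm_add_le _ _).trans (by linarith)
    rw [Real.norm_of_nonneg (by positivity)]
    have e1 : 1 ≤ Real.exp B * Real.exp (-V z) := by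
      rw [← Real.exp_add]
      exact Real.one_le_exp (by linarith [(abs_le.1 (hB z hz')).2])
    nlinarith [sq_nonneg ‖u z‖]
  obtain ⟨P0, hP0, hP0a, hP0e⟩ := ii_corr (s0 := r / 8) (H := fun z => Complex.exp ((ε : ℂ) * h z))
    (by positivity) hE1 hE2 ((hεh.mono (closedBall_subset_ball (by linarith))).cexp) hul (hu2 _) hud hgm
  -- the dominating function
  set D : ℂ → ℝ := fun z => (closedBall a r).indicator (fun _ => 2 * Real.exp (2 * ε * CA) * 2 ^ N) z +
    2 * r ^ 2 * Real.exp (2 * ε * CR) * (‖u z‖ ^ 2 * Real.exp (-V z)) with hDd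
  obtain ⟨j1, j2⟩ := ii_ballint a hr (2 * Real.exp (2 * ε * CA) * 2 ^ N)
  have hDi : Integrable D := j1.add (hui.const_mul _)
  have hDint : ∫ z, D z ≤ T1 * r ^ 2 := by
    rw [hDd, integral_add j1 (hui.const_mul _), j2, integral_const_mul, hT1]
    have h1 : ∫ z, ‖u z‖ ^ 2 * Real.exp (-V z) ≤ 4 * T0 := hub.trans (by linarith)
    have := mul_le_mul_of_nonneg_left h1 (by positivity : 0 ≤ 2 * r ^ 2 * Real.exp (2 * ε * CR))
    nlinarith [this]
  have hP0D : ∀ᵐ z, ‖P0 z‖ ^ 2 * Real.exp (-(2 * ε * φ z)) * (1 + ‖z - a‖ / r) ^ N ≤ D z := by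
    filter_upwards [hP0e] with z hz
    rw [← hz]
    set K := 1 + ‖z - a‖ / r with hK
    have hK1 : 1 ≤ K := ii_K_one hr z
    have hK0 : 0 < K := by linarith
    have n1 : ‖E z - (z - a) * u z‖ ^ 2 ≤ 2 * ‖E z‖ ^ 2 + 2 * (‖z - a‖ * ‖u z‖) ^ 2 := by
      have := norm_sub_le (E z) ((z - a) * u z)
      rw [norm_mul] at this
      have h0 := norm_nonneg (E z - (z - a) * u z)
      nlinarith [sq_nonneg (‖E z‖ - ‖z - a‖ * ‖u z‖)]
    have n2 : ‖E z‖ ^ 2 * Real.exp (-(2 * ε * φ z)) * K ^ N ≤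
        (closedBall a r).indicator (fun _ => Real.exp (2 * ε * CA) * 2 ^ N) z := by
      by_cases h1 : r / 4 ≤ ‖z - a‖
      · rw [hE3 z h1]
        simp only [norm_zero, ne_eq, OfNat.ofNat_ne_zero, not_false_eq_true, zero_pow, zero_mul]
        exact indicator_nonneg (fun _ _ => by positivity) _
      push Not at h1
      rw [indicator_of_mem (by rw [mem_closedBall, dist_eq_norm]; linarith)]
      have k1 : K ≤ 2 := by
        have : ‖z - a‖ / r ≤ 1 := by rw [div_le_one hr]; linarith
        rw [hK]; linarith
      have k2 : ‖E z‖ ≤ Real.exp (ε * (φ z + CA)) := (hE4 z).trans (hexpφ z (by linarith))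
      have k3 : ‖E z‖ ^ 2 * Real.exp (-(2 * ε * φ z)) ≤ Real.exp (2 * ε * CA) := by
        calc _ ≤ Real.exp (ε * (φ z + CA)) ^ 2 * Real.exp (-(2 * ε * φ z)) := by gcongr
          _ = _ := by
            rw [← Real.exp_nat_mul, ← Real.exp_add]
            congr 1; push_cast; ring
      gcongr
    have n3 : (‖z - a‖ * ‖u z‖) ^ 2 * Real.exp (-(2 * ε * φ z)) * K ^ N ≤
        r ^ 2 * Real.exp (2 * ε * CR) * (‖u z‖ ^ 2 * Real.exp (-V z)) := by
      have m1 : ‖z - a‖ ≤ r * K := by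
        rw [hK, mul_add, mul_div_cancel₀ _ hr.ne']; linarith
      have m2 : Real.exp (-(2 * ε * φ z)) * K ^ (N + 2) ≤ Real.exp (2 * ε * CR) * Real.exp (-V z) := by
        have hlK : 0 ≤ Real.log K := Real.log_nonneg hK1
        have s1 : Real.log (1 + ‖z - a‖ ^ 2 / r ^ 2) ≤ 2 * Real.log K := by
          have : 2 * Real.log K = Real.log (K ^ 2) := by rw [Real.log_pow]; norm_num
          rw [this]
          refine Real.log_le_log (by positivity) ?_
          have : 0 ≤ ‖z - a‖ / r := by positivity
          rw [hK, ← div_pow]; nlinarith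
        have s2 := hGlow z
        have s3 : (N + 6 : ℝ) / (2 * ε) ≤ μ.real (ball a (R * r)) / (2 * π) := by
          rw [le_div_iff₀ (by positivity)]
          refine le_trans (le_of_eq ?_) (hR a)
          field_simp
        have s4 := mul_le_mul_of_nonneg_right s3 hlK
        have s5 : (N + 6 : ℝ) * Real.log K - 2 * ε * CR ≤ 2 * ε * G z := by
          have : 2 * ε * ((N + 6 : ℝ) / (2 * ε) * Real.log K - CR) ≤ 2 * ε * G z :=
            mul_le_mul_of_nonneg_left (by linarith) (by positivity)
          refine le_trans (le_of_eq ?_) this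
          field_simp
        have s6 : K ^ (N + 2) = Real.exp ((N + 2 : ℝ) * Real.log K) := by
          rw [mul_comm, Real.exp_mul, Real.exp_log hK0]
          rw [← Real.rpow_natCast]; push_cast; rfl
        rw [s6, ← Real.exp_add, ← Real.exp_add, Real.exp_le_exp, hV]
        simp only
        linarith
      calc (‖z - a‖ * ‖u z‖) ^ 2 * Real.exp (-(2 * ε * φ z)) * K ^ N
          ≤ (r * K * ‖u z‖) ^ 2 * Real.exp (-(2 * ε * φ z)) * K ^ N := by gcongr
        _ = r ^ 2 * ‖u z‖ ^ 2 * (Real.exp (-(2 * ε * φ z)) * K ^ (N + 2)) := by ring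
        _ ≤ r ^ 2 * ‖u z‖ ^ 2 * (Real.exp (2 * ε * CR) * Real.exp (-V z)) := by gcongr
        _ = _ := by ring
    have n4 : (closedBall a r).indicator (fun _ => 2 * Real.exp (2 * ε * CA) * 2 ^ N) z =
        2 * (closedBall a r).indicator (fun _ => Real.exp (2 * ε * CA) * 2 ^ N) z := by
      by_cases hz : z ∈ closedBall a r
      · rw [indicator_of_mem hz, indicator_of_mem hz]; ring
      · rw [indicator_of_notMem hz, indicator_of_notMem hz]; ring
    rw [hDd]
    simp only
    rw [n4]
    calc ‖E z - (z - a) * u z‖ ^ 2 * Real.exp (-(2 * ε * φ z)) * K ^ N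
        ≤ (2 * ‖E z‖ ^ 2 + 2 * (‖z - a‖ * ‖u z‖) ^ 2) * Real.exp (-(2 * ε * φ z)) * K ^ N := by gcongr
      _ = 2 * (‖E z‖ ^ 2 * Real.exp (-(2 * ε * φ z)) * K ^ N) +
          2 * ((‖z - a‖ * ‖u z‖) ^ 2 * Real.exp (-(2 * ε * φ z)) * K ^ N) := by ring
      _ ≤ _ := by linarith
  set κ : ℂ := Complex.exp (-((ε : ℂ) * h a)) with hκ
  have hκn : ‖κ‖ ^ 2 * Real.exp (2 * ε * φ a) ≤ Real.exp (2 * ε * CA) := by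
    have e1 : ‖κ‖ = Real.exp (-(ε * (h a).re)) := by rw [hκ, Complex.norm_exp]; simp
    rw [e1, ← Real.exp_nat_mul, ← Real.exp_add, Real.exp_le_exp]
    have := abs_le.1 (hhφ a (mem_ball_self (by positivity)))
    have := mul_le_mul_of_nonneg_left this.2 (by positivity : 0 ≤ 2 * ε)
    push_cast
    linarith
  set F : ℂ → ℝ := fun z => ‖P0 z‖ ^ 2 * Real.exp (-(2 * ε * φ z)) * (1 + ‖z - a‖ / r) ^ N with hF
  have hFc : Continuous F := by
    have c1 := hφ.continuous
    have c2 := hP0.continuous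
    rw [hF]
    fun_prop
  have hF0 : ∀ z, 0 ≤ F z := fun z => by positivity
  have hFi : Integrable F := hDi.mono' hFc.aestronglyMeasurable (by
    filter_upwards [hP0D] with z hz
    rw [Real.norm_of_nonneg (hF0 z)]; exact hz)
  have eF : ∀ z, ‖κ * P0 z‖ ^ 2 * Real.exp (-(2 * ε * (φ z - φ a))) * (1 + ‖z - a‖ / r) ^ N =
      (‖κ‖ ^ 2 * Real.exp (2 * ε * φ a)) * F z := fun z => by
    have : Real.exp (-(2 * ε * (φ z - φ a))) = Real.exp (2 * ε * φ a) * Real.exp (-(2 * ε * φ z)) := by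
      rw [← Real.exp_add]; congr 1; ring
    rw [this, norm_mul, hF]; ring
  refine ⟨fun z => κ * P0 z, fun z => (hP0 z).const_mul κ, ?_, ?_, ?_⟩
  · simp only [hP0a, hκ]
    rw [← Complex.exp_add]; simp
  · simp only [eF]
    exact hFi.const_mul _
  · simp only [eF]
    rw [integral_const_mul, mul_assoc (Real.exp _)]
    have h1 : ∫ z, F z ≤ T1 * r ^ 2 := (integral_mono_ae hFi hDi hP0D).trans hDint
    exact mul_le_mul hκn h1 (integral_nonneg hF0) (by positivity)



theorem ii_ptwise {φ : ℂ → ℝ} {μ : Measure ℂ} (hφ : HasDoublingLaplacian φ μ) {ρ : ℂ → ℝ}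
    (hρ : IsRadius μ ρ) {θ : ℝ} (hθ : 0 < θ) (n : ℕ) : ∃ C : ℝ, 0 < C ∧ ∀ f : ℂ → ℂ,
      Differentiable ℂ f → ∀ z, (‖f z‖ * Real.exp (-(θ * φ z))) ^ n * ρ z ^ 2 ≤
        C * ∫ w in closedBall z (ρ z / 4), (‖f w‖ * Real.exp (-(θ * φ w))) ^ n := by
  obtain ⟨CA, hCA, hloc⟩ := ii_local hφ hρ
  set L := Real.exp (θ * CA) ^ n with hL
  have hL0 : 0 < L := by positivity
  refine ⟨16 / π * (L * L), by positivity, fun f hf z => ?_⟩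
  have hr : 0 < ρ z := (hρ z).1
  obtain ⟨h, hh, hhφ⟩ := hloc z
  have hsub : closedBall z (ρ z / 4) ⊆ ball z (ρ z / 2) := closedBall_subset_ball (by linarith)
  have hFd : DifferentiableOn ℂ (fun w => (f w * Complex.exp (-((θ : ℂ) * h w))) ^ n)
      (closedBall z (ρ z / 4)) := by
    refine DifferentiableOn.pow (hf.differentiableOn.mul ?_) n
    exact (((differentiableOn_const _).mul (hh.mono hsub)).neg).cexp
  have hn : ∀ w, ‖(f w * Complex.exp (-((θ : ℂ) * h w))) ^ n‖ =
      (‖f w‖ * Real.exp (-(θ * (h w).re))) ^ n := fun w => by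
    rw [norm_pow, norm_mul, Complex.norm_exp]; simp
  have h1 := ii_submean (by positivity) hFd
  simp only [hn] at h1
  have b1 : ∀ w ∈ ball z (ρ z / 2), (‖f w‖ * Real.exp (-(θ * (h w).re))) ^ n ≤
      L * (‖f w‖ * Real.exp (-(θ * φ w))) ^ n := by
    intro w hw
    rw [hL, ← mul_pow]
    refine pow_le_pow_left₀ (by positivity) ?_ n
    have : Real.exp (-(θ * (h w).re)) ≤ Real.exp (θ * CA) * Real.exp (-(θ * φ w)) := by
      rw [← Real.exp_add, Real.exp_le_exp]
      have := mul_le_mul_of_nonneg_left (abs_le.1 (hhφ w hw)).2 hθ.le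
      linarith
    calc _ ≤ ‖f w‖ * (Real.exp (θ * CA) * Real.exp (-(θ * φ w))) := by gcongr
      _ = _ := by ring
  have b2 : ∀ w ∈ ball z (ρ z / 2), (‖f w‖ * Real.exp (-(θ * φ w))) ^ n ≤
      L * (‖f w‖ * Real.exp (-(θ * (h w).re))) ^ n := by
    intro w hw
    rw [hL, ← mul_pow]
    refine pow_le_pow_left₀ (by positivity) ?_ n
    have : Real.exp (-(θ * φ w)) ≤ Real.exp (θ * CA) * Real.exp (-(θ * (h w).re)) := by
      rw [← Real.exp_add, Real.exp_le_exp]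
      have := mul_le_mul_of_nonneg_left (abs_le.1 (hhφ w hw)).1 hθ.le
      linarith
    calc _ ≤ ‖f w‖ * (Real.exp (θ * CA) * Real.exp (-(θ * (h w).re))) := by gcongr
      _ = _ := by ring
  have h2 : ∫ w in closedBall z (ρ z / 4), (‖f w‖ * Real.exp (-(θ * (h w).re))) ^ n ≤
      L * ∫ w in closedBall z (ρ z / 4), (‖f w‖ * Real.exp (-(θ * φ w))) ^ n := by
    rw [← integral_const_mul]
    refine setIntegral_mono_on ?_ ?_ measurableSet_closedBall fun w hw => b1 w (hsub hw)
    · have := hFd.continuousOn.norm.integrableOn_compact (μ := volume) (isCompact_closedBall z (ρ z / 4))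
      simpa only [hn] using this
    · have c1 := hφ.continuous
      have c2 := hf.continuous
      exact (by fun_prop : Continuous fun w => L * (‖f w‖ * Real.exp (-(θ * φ w))) ^ n).continuousOn.integrableOn_compact
        (isCompact_closedBall z (ρ z / 4))
  have h3 := b2 z (mem_ball_self (by positivity))
  set X := (‖f z‖ * Real.exp (-(θ * (h z).re))) ^ n
  set I := ∫ w in closedBall z (ρ z / 4), (‖f w‖ * Real.exp (-(θ * φ w))) ^ n
  have h4 : π * (ρ z / 4) ^ 2 * X ≤ L * I := h1.trans h2
  calc (‖f z‖ * Real.exp (-(θ * φ z))) ^ n * ρ z ^ 2 ≤ L * X * ρ z ^ 2 := by gcongr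
    _ = 16 / π * L * (π * (ρ z / 4) ^ 2 * X) := by field_simp; ring
    _ ≤ 16 / π * L * (L * I) := by gcongr
    _ = _ := by ring

theorem ii_peak {φ : ℂ → ℝ} {μ : Measure ℂ} (hφ : HasDoublingLaplacian φ μ) {ρ : ℂ → ℝ}
    (hρ : IsRadius μ ρ) {ε : ℝ} (hε : 0 < ε) (M : ℕ) : ∃ B : ℝ, 0 < B ∧ ∀ a, ∃ P : ℂ → ℂ,
      Differentiable ℂ P ∧ P a = 1 ∧
      ∀ z, ‖P z‖ * (1 + ‖z - a‖ / ρ a) ^ M ≤ B * Real.exp (ε * (φ z - φ a)) := by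
  obtain ⟨C, -, hD⟩ := hφ.doubling
  obtain ⟨A, hA, s, hE⟩ := ii_E hD hρ
  set N := 2 * s + 2 * M with hN
  obtain ⟨T, hT, hpre⟩ := ii_pre hφ hρ hε N
  obtain ⟨Cp, hCp, hpt⟩ := ii_ptwise hφ hρ hε 2
  set B := Real.sqrt (Cp * 2 ^ N * T * A ^ 2) with hB
  have hA0 : 0 < A := by linarith
  have hBsq : B ^ 2 = Cp * 2 ^ N * T * A ^ 2 := Real.sq_sqrt (by positivity)
  refine ⟨B, by positivity, fun a => ?_⟩
  obtain ⟨P, hP, hPa, hPi, hPb⟩ := hpre a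
  refine ⟨P, hP, hPa, fun z => ?_⟩
  have hr : 0 < ρ a := (hρ a).1
  have hz : 0 < ρ z := (hρ z).1
  set K := 1 + ‖z - a‖ / ρ a with hK
  have hK1 : 1 ≤ K := ii_K_one hr z
  have hK0 : 0 < K := by linarith
  set F : ℂ → ℝ := fun z => ‖P z‖ ^ 2 * Real.exp (-(2 * ε * (φ z - φ a))) * (1 + ‖z - a‖ / ρ a) ^ N with hF
  have hF0 : ∀ z, 0 ≤ F z := fun z => by
    have := ii_K_one hr z
    have : 0 ≤ 1 + ‖z - a‖ / ρ a := by linarith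
    positivity
  have rK : ρ a * K = ρ a + ‖z - a‖ := by rw [hK]; field_simp
  have hKw : ∀ w ∈ closedBall z (ρ z / 4), K ≤ 2 * (1 + ‖w - a‖ / ρ a) := by
    intro w hw
    have h1 : ‖w - z‖ ≤ ρ z / 4 := by simpa [dist_eq_norm] using hw
    have h2 := ii_lip hD hρ z a
    have h3 : ‖z - a‖ ≤ ‖w - a‖ + ‖w - z‖ := by
      have := norm_sub_le (w - a) (w - z)
      simpa using this
    have h5 : ρ a * (2 * (1 + ‖w - a‖ / ρ a)) = 2 * ρ a + 2 * ‖w - a‖ := by field_simp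
    refine le_of_mul_le_mul_left ?_ hr
    rw [h5, rK]
    linarith [norm_nonneg (z - a)]
  have h1 := hpt P hP z
  have h2 : ∫ w in closedBall z (ρ z / 4), (‖P w‖ * Real.exp (-(ε * φ w))) ^ 2 ≤
      Real.exp (-(2 * ε * φ a)) * (2 / K) ^ N * ∫ w, F w := by
    have c1 := hφ.continuous
    have c2 := hP.continuous
    calc _ ≤ ∫ w in closedBall z (ρ z / 4), Real.exp (-(2 * ε * φ a)) * (2 / K) ^ N * F w := by
          refine setIntegral_mono_on ?_ (hPi.const_mul _).integrableOn measurableSet_closedBall ?_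
          · exact (by fun_prop : Continuous fun w => (‖P w‖ * Real.exp (-(ε * φ w))) ^ 2).continuousOn.integrableOn_compact
              (isCompact_closedBall z (ρ z / 4))
          · intro w hw
            have k1 : 1 ≤ (2 / K) ^ N * (1 + ‖w - a‖ / ρ a) ^ N := by
              rw [← mul_pow]
              refine one_le_pow₀ ?_
              rw [div_mul_eq_mul_div, one_le_div hK0]
              exact hKw w hw
            have k2 : (‖P w‖ * Real.exp (-(ε * φ w))) ^ 2 =
                Real.exp (-(2 * ε * φ a)) * (‖P w‖ ^ 2 * Real.exp (-(2 * ε * (φ w - φ a)))) := by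
              rw [mul_pow, ← Real.exp_nat_mul, mul_left_comm, ← Real.exp_add]
              congr 2; push_cast; ring
            rw [k2, hF]
            simp only
            calc _ = Real.exp (-(2 * ε * φ a)) * (‖P w‖ ^ 2 * Real.exp (-(2 * ε * (φ w - φ a)))) * 1 := by ring
              _ ≤ Real.exp (-(2 * ε * φ a)) * (‖P w‖ ^ 2 * Real.exp (-(2 * ε * (φ w - φ a)))) *
                  ((2 / K) ^ N * (1 + ‖w - a‖ / ρ a) ^ N) := by gcongr
              _ = _ := by ring
      _ = Real.exp (-(2 * ε * φ a)) * (2 / K) ^ N * ∫ w in closedBall z (ρ z / 4), F w :=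
          integral_const_mul _ _
      _ ≤ _ := by
          have := setIntegral_le_integral (s := closedBall z (ρ z / 4)) hPi (Eventually.of_forall hF0)
          gcongr
  have h3 : ρ a ^ 2 ≤ (A * K ^ s * ρ z) ^ 2 := by
    have := hE z a
    gcongr
  have h4 : (‖P z‖ * Real.exp (-(ε * φ z))) ^ 2 * ρ z ^ 2 ≤
      Cp * (Real.exp (-(2 * ε * φ a)) * (2 / K) ^ N * (T * (A * K ^ s * ρ z) ^ 2)) := by
    refine h1.trans ?_
    gcongr
    refine h2.trans ?_
    gcongr
    refine hPb.trans ?_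
    gcongr
  have h5 : (‖P z‖ * Real.exp (-(ε * φ z)) * K ^ M) ^ 2 ≤ (B * Real.exp (-(ε * φ a))) ^ 2 := by
    have e1 : Cp * (Real.exp (-(2 * ε * φ a)) * (2 / K) ^ N * (T * (A * K ^ s * ρ z) ^ 2)) =
        (B * Real.exp (-(ε * φ a))) ^ 2 / K ^ (2 * M) * ρ z ^ 2 := by
      have : Real.exp (-(2 * ε * φ a)) = Real.exp (-(ε * φ a)) ^ 2 := by
        rw [← Real.exp_nat_mul]; congr 1; push_cast; ring
      rw [this, mul_pow B, hBsq, hN, div_pow]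
      field_simp
      ring
    rw [e1] at h4
    have h6 := le_of_mul_le_mul_right h4 (by positivity)
    rw [le_div_iff₀ (by positivity)] at h6
    refine le_trans (le_of_eq ?_) h6
    ring
  have h6 := (pow_le_pow_iff_left₀ (by positivity) (by positivity) two_ne_zero).1 h5
  have e2 : Real.exp (ε * (φ z - φ a)) = Real.exp (ε * φ z) * Real.exp (-(ε * φ a)) := by
    rw [← Real.exp_add]; congr 1; ring
  have e3 : Real.exp (ε * φ z) * Real.exp (-(ε * φ z)) = 1 := by rw [← Real.exp_add]; simp
  calc ‖P z‖ * K ^ M = Real.exp (ε * φ z) * (‖P z‖ * Real.exp (-(ε * φ z)) * K ^ M) := by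
        linear_combination -(‖P z‖ * K ^ M) * e3
    _ ≤ Real.exp (ε * φ z) * (B * Real.exp (-(ε * φ a))) := by gcongr
    _ = _ := by rw [e2]; ring



theorem ii_sup {φ : ℂ → ℝ} {μ : Measure ℂ} (hφ : HasDoublingLaplacian φ μ) {ρ : ℂ → ℝ}
    (hρ : IsRadius μ ρ) {p : ℝ≥0∞} (hp : 1 ≤ p) {ω : ℂ → ℝ} (hω : IsFlatWeight ρ ω)
    {f : ℂ → ℂ} (hf : MemF p φ ω ρ f) : ∃ C : ℝ, ∀ z, ω z * ‖f z‖ * Real.exp (-φ z) ≤ C := by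
  obtain ⟨hfd, hfn⟩ := hf
  by_cases hpt : p = ∞
  · rw [Fnorm, if_pos hpt] at hfn
    refine ⟨(⨆ z : ℂ, ENNReal.ofReal (ω z * ‖f z‖ * Real.exp (-φ z))).toReal, fun z => ?_⟩
    have h1 := le_iSup (fun z : ℂ => ENNReal.ofReal (ω z * ‖f z‖ * Real.exp (-φ z))) z
    exact (ENNReal.ofReal_le_iff_le_toReal hfn.ne).1 h1
  rw [Fnorm, if_neg hpt] at hfn
  set q := p.toReal with hq
  have hq1 : 1 ≤ q := by
    rw [hq, ← ENNReal.toReal_one]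
    exact (ENNReal.toReal_le_toReal ENNReal.one_ne_top hpt).2 hp
  obtain ⟨C, -, hD⟩ := hφ.doubling
  have hρc := ii_rho_cont hD hρ
  obtain ⟨A, hA, s, hE⟩ := ii_E hD hρ
  obtain ⟨B, hB, k, hfl⟩ := ii_flat hρc (fun z => (hρ z).1) hA hE hω
  obtain ⟨Cp, hCp, hpt1⟩ := ii_ptwise hφ hρ one_pos 1
  have hωp := hω.1
  set Y : ℂ → ℝ := fun z => ‖f z‖ ^ q * Real.exp (-(q * φ z)) * ω z ^ q / ρ z ^ 2 with hY
  have hYm : Measurable Y := by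
    have m1 : Measurable fun z => ‖f z‖ ^ q := (hfd.continuous.norm.measurable).pow_const q
    have m2 : Measurable fun z => Real.exp (-(q * φ z)) :=
      ((hφ.continuous.measurable.const_mul q).neg).exp
    have m3 : Measurable fun z => ω z ^ q := hω.2.1.pow_const q
    exact ((m1.mul m2).mul m3).div (hρc.measurable.pow_const 2)
  have hY0 : ∀ z, 0 ≤ Y z := fun z => by have := hωp z; positivity
  have hYi : Integrable Y := by
    refine ⟨hYm.aestronglyMeasurable, ?_⟩
    rw [hasFiniteIntegral_iff_ofReal (Eventually.of_forall hY0)]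
    exact (ENNReal.rpow_lt_top_iff_of_pos (by positivity)).1 hfn
  have hYI : 0 ≤ ∫ w, Y w := integral_nonneg hY0
  refine ⟨Cp * (B * 2 ^ k * (π + 4 * ∫ w, Y w)), fun z => ?_⟩
  have hz := (hρ z).1
  have h1 := hpt1 f hfd z
  simp only [pow_one, one_mul] at h1
  have hb : ∀ w ∈ closedBall z (ρ z / 4), ω z * (‖f w‖ * Real.exp (-φ w)) ≤
      B * 2 ^ k * (1 + 4 * ρ z ^ 2 * Y w) := by
    intro w hw
    have d1 : ‖w - z‖ ≤ ρ z / 4 := by simpa [dist_eq_norm] using hw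
    have d1' : ‖z - w‖ ≤ ρ z / 4 := by rw [norm_sub_rev]; exact d1
    have d2 := ii_lip hD hρ z w
    have d3 := ii_lip hD hρ w z
    have hw0 := (hρ w).1
    have k1 : 1 + ‖z - w‖ / ρ w ≤ 2 := by
      have : ‖z - w‖ / ρ w ≤ 1 := by rw [div_le_one hw0]; linarith
      linarith
    have k2 : ω z ≤ B * 2 ^ k * ω w := by
      refine (hfl z w).1.trans ?_
      have := hωp w
      gcongr
    set x := ω w * ‖f w‖ * Real.exp (-φ w) with hx
    have hx0 : 0 ≤ x := by have := hωp w; positivity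
    have hx1 : x ≤ 1 + x ^ q := by
      rcases le_total x 1 with h | h
      · linarith [Real.rpow_nonneg hx0 q]
      · linarith [Real.self_le_rpow_of_one_le h hq1]
    have hx2 : x ^ q = Y w * ρ w ^ 2 := by
      rw [hx, Real.mul_rpow (by have := hωp w; positivity) (by positivity),
        Real.mul_rpow (hωp w).le (norm_nonneg _), ← Real.exp_mul, hY]
      simp only
      rw [div_mul_cancel₀ _ (by positivity)]
      have : -φ w * q = -(q * φ w) := by ring
      rw [this]; ring
    have hx3 : Y w * ρ w ^ 2 ≤ 4 * ρ z ^ 2 * Y w := by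
      have : ρ w ^ 2 ≤ (2 * ρ z) ^ 2 := by gcongr; linarith
      have := mul_le_mul_of_nonneg_left this (hY0 w)
      linarith
    calc ω z * (‖f w‖ * Real.exp (-φ w)) ≤ (B * 2 ^ k * ω w) * (‖f w‖ * Real.exp (-φ w)) := by gcongr
      _ = B * 2 ^ k * x := by rw [hx]; ring
      _ ≤ _ := by gcongr; linarith
  have h2 : ω z * ∫ w in closedBall z (ρ z / 4), ‖f w‖ * Real.exp (-φ w) ≤
      B * 2 ^ k * (π + 4 * ∫ w, Y w) * ρ z ^ 2 := by
    rw [← integral_const_mul]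
    have : IsFiniteMeasure (volume.restrict (closedBall z (ρ z / 4))) :=
      ⟨by rw [Measure.restrict_apply_univ]; exact measure_closedBall_lt_top⟩
    have iY : IntegrableOn Y (closedBall z (ρ z / 4)) := hYi.integrableOn
    have c1 := hφ.continuous
    have c2 := hfd.continuous
    calc _ ≤ ∫ w in closedBall z (ρ z / 4), B * 2 ^ k * (1 + 4 * ρ z ^ 2 * Y w) := by
          refine setIntegral_mono_on ?_ ?_ measurableSet_closedBall hb
          · exact (by fun_prop : Continuous fun w => ω z * (‖f w‖ * Real.exp (-φ w))).continuousOn.integrableOn_compact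
              (isCompact_closedBall z (ρ z / 4))
          · exact (((integrable_const _).add (iY.const_mul _)).const_mul _)
      _ = B * 2 ^ k * (π * (ρ z / 4) ^ 2 + 4 * ρ z ^ 2 * ∫ w in closedBall z (ρ z / 4), Y w) := by
          rw [integral_const_mul, integral_add (integrable_const _) (iY.const_mul _),
            integral_const_mul, setIntegral_const, Measure.real, Complex.volume_closedBall]
          simp [ENNReal.toReal_ofReal (by positivity : 0 ≤ ρ z / 4)]
          left; ring
      _ ≤ B * 2 ^ k * (π * ρ z ^ 2 + 4 * ρ z ^ 2 * ∫ w, Y w) := by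
          have i1 := setIntegral_le_integral (s := closedBall z (ρ z / 4)) hYi (Eventually.of_forall hY0)
          gcongr
          linarith
      _ = _ := by ring
  have h3 : ω z * ‖f z‖ * Real.exp (-φ z) * ρ z ^ 2 ≤
      Cp * (B * 2 ^ k * (π + 4 * ∫ w, Y w)) * ρ z ^ 2 := by
    calc _ = ω z * (‖f z‖ * Real.exp (-φ z) * ρ z ^ 2) := by ring
      _ ≤ ω z * (Cp * ∫ w in closedBall z (ρ z / 4), ‖f w‖ * Real.exp (-φ w)) := by
        have := hωp z
        gcongr
      _ = Cp * (ω z * ∫ w in closedBall z (ρ z / 4), ‖f w‖ * Real.exp (-φ w)) := by ring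
      _ ≤ Cp * (B * 2 ^ k * (π + 4 * ∫ w, Y w) * ρ z ^ 2) := by gcongr
      _ = _ := by ring
  exact le_of_mul_le_mul_right h3 (by positivity)

theorem ii_unif {φ : ℂ → ℝ} (hφc : Continuous φ) {ρ ω : ℂ → ℝ} {p : ℝ≥0∞} (hp : 1 ≤ p)
    (hω : ∀ z, 0 < ω z) (hlow : ∀ S : ℝ, ∃ c > 0, ∀ z, ‖z‖ ≤ S → c ≤ ω z)
    (hsup : ∀ f, MemF p φ ω ρ f → ∃ C : ℝ, ∀ z, ω z * ‖f z‖ * Real.exp (-φ z) ≤ C)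
    {Λ : Set ℂ} (hΛ : IsInterpolating p φ ω ρ Λ) : ∃ C0 : ℝ, 0 < C0 ∧ ∀ l ∈ Λ, ∃ f : ℂ → ℂ,
      Differentiable ℂ f ∧ f l = ((Real.exp (φ l) / ω l : ℝ) : ℂ) ∧ (∀ l' ∈ Λ, l' ≠ l → f l' = 0) ∧
      ∀ z, ω z * ‖f z‖ * Real.exp (-φ z) ≤ C0 := by
  set W : ℂ → ℝ := fun z => ω z * Real.exp (-φ z) with hW
  have hW0 : ∀ z, 0 < W z := fun z => mul_pos (hω z) (Real.exp_pos _)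
  have hWinv : ∀ z, (W z)⁻¹ = Real.exp (φ z) / ω z := fun z => by
    rw [hW]; simp only; rw [mul_inv, Real.exp_neg, inv_inv]; ring
  let X : Submodule ℂ (lp (fun _ : ℂ => ℂ) ∞ × lp (fun _ : Λ => ℂ) 1) :=
    { carrier := {x | ∃ f : ℂ → ℂ, Differentiable ℂ f ∧ (∀ z, x.1 z = (W z : ℂ) * f z) ∧
        ∀ l : Λ, x.2 l = (W l : ℂ) * f l}
      zero_mem' := ⟨fun _ => 0, differentiable_const _, fun z => by simp, fun l => by simp⟩
      add_mem' := by
        rintro x y ⟨f, hf, hf1, hf2⟩ ⟨g, hg, hg1, hg2⟩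
        refine ⟨fun z => f z + g z, hf.add hg, fun z => ?_, fun l => ?_⟩
        · simp [hf1, hg1]; ring
        · simp [hf2, hg2]; ring
      smul_mem' := by
        rintro c x ⟨f, hf, hf1, hf2⟩
        refine ⟨fun z => c * f z, hf.const_mul c, fun z => ?_, fun l => ?_⟩
        · simp [hf1]; ring
        · simp [hf2]; ring }
  have hXc : IsClosed (X : Set (lp (fun _ : ℂ => ℂ) ∞ × lp (fun _ : Λ => ℂ) 1)) := by
    refine IsSeqClosed.isClosed ?_
    intro xs x hxs hx
    have hx1 : Tendsto (fun n => (xs n).1) atTop (𝓝 x.1) := (continuous_fst.tendsto x).comp hx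
    have hx2 : Tendsto (fun n => (xs n).2) atTop (𝓝 x.2) := (continuous_snd.tendsto x).comp hx
    have pt1 : ∀ z, Tendsto (fun n => (xs n).1 z) atTop (𝓝 (x.1 z)) := fun z => by
      rw [tendsto_iff_norm_sub_tendsto_zero] at hx1 ⊢
      refine squeeze_zero (fun _ => norm_nonneg _) (fun n => ?_) hx1
      exact lp.norm_apply_le_norm ENNReal.top_ne_zero ((xs n).1 - x.1) z
    have pt2 : ∀ l, Tendsto (fun n => (xs n).2 l) atTop (𝓝 (x.2 l)) := fun z => by
      rw [tendsto_iff_norm_sub_tendsto_zero] at hx2 ⊢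
      refine squeeze_zero (fun _ => norm_nonneg _) (fun n => ?_) hx2
      exact lp.norm_apply_le_norm one_ne_zero ((xs n).2 - x.2) z
    choose f hf hf1 hf2 using hxs
    set F : ℂ → ℂ := fun z => (W z : ℂ)⁻¹ * x.1 z with hF
    have hWc : ∀ z, (W z : ℂ) ≠ 0 := fun z => by exact_mod_cast (hW0 z).ne'
    have hfe : ∀ n z, f n z = (W z : ℂ)⁻¹ * (xs n).1 z := fun n z => by
      rw [hf1 n z, inv_mul_cancel_left₀ (hWc z)]
    have hlim : TendstoLocallyUniformlyOn f F atTop univ := by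
      rw [tendstoLocallyUniformlyOn_iff_forall_isCompact isOpen_univ]
      intro K _ hK
      obtain ⟨S, hS⟩ := hK.isBounded.subset_closedBall 0
      obtain ⟨c, hc, hcl⟩ := hlow S
      obtain ⟨B, hB⟩ := hK.exists_bound_of_continuousOn hφc.continuousOn
      have hinv : ∀ z ∈ K, (W z)⁻¹ ≤ Real.exp B / c := by
        intro z hz
        rw [hWinv]
        have h1 := hcl z (by simpa using hS hz)
        have h2 := (le_abs_self _).trans (hB z hz)
        gcongr
      rw [Metric.tendstoUniformlyOn_iff]
      intro e he
      have hn : Tendsto (fun n => Real.exp B / c * ‖(xs n).1 - x.1‖) atTop (𝓝 0) := by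
        have := (tendsto_iff_norm_sub_tendsto_zero.1 hx1).const_mul (Real.exp B / c)
        simpa using this
      filter_upwards [hn.eventually (gt_mem_nhds he)] with n hn z hz
      refine lt_of_le_of_lt ?_ hn
      rw [dist_comm, dist_eq_norm, hfe, hF]
      simp only
      rw [← mul_sub, norm_mul, norm_inv, Complex.norm_real, Real.norm_of_nonneg (hW0 z).le]
      have := lp.norm_apply_le_norm ENNReal.top_ne_zero ((xs n).1 - x.1) z
      have h3 := hinv z hz
      have h4 : ‖(xs n).1 z - x.1 z‖ ≤ ‖(xs n).1 - x.1‖ := this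
      have := (inv_pos.2 (hW0 z)).le
      gcongr
    have hFd : Differentiable ℂ F := by
      rw [← differentiableOn_univ]
      exact hlim.differentiableOn (Eventually.of_forall fun n => (hf n).differentiableOn) isOpen_univ
    refine ⟨F, hFd, fun z => ?_, fun l => ?_⟩
    · rw [hF]; simp only; rw [mul_inv_cancel_left₀ (hWc z)]
    · rw [hF]; simp only; rw [mul_inv_cancel_left₀ (hWc _)]
      refine tendsto_nhds_unique (pt2 l) ((pt1 l).congr fun n => ?_)
      rw [hf1, hf2]
  have : CompleteSpace X := hXc.completeSpace_coe
  let T : X →L[ℂ] lp (fun _ : Λ => ℂ) 1 := (ContinuousLinearMap.snd ℂ _ _).comp X.subtypeL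
  have hT : Function.Surjective T := by
    intro v
    set d : ℂ → ℂ := fun z => if h : z ∈ Λ then (W z : ℂ)⁻¹ * v ⟨z, h⟩ else 0 with hd
    have hdv : ∀ l : Λ, ‖d l‖ = (W l)⁻¹ * ‖v l‖ := fun l => by
      rw [hd]; simp [abs_of_pos (hW0 l)]
    have hdfin : lnorm p φ ω Λ d < ∞ := by
      rw [lnorm]
      split_ifs with hpt
      · refine lt_of_le_of_lt (iSup_le fun l => ?_) (ENNReal.ofReal_lt_top (r := ‖v‖))
        refine ENNReal.ofReal_le_ofReal ?_
        have : ω l.1 * ‖d l‖ * Real.exp (-φ l.1) = ‖v l‖ := by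
          rw [hdv]
          have : ω l.1 * ((W l.1)⁻¹ * ‖v l‖) * Real.exp (-φ l.1) = W l.1 * (W l.1)⁻¹ * ‖v l‖ := by
            rw [hW]; ring
          rw [this, mul_inv_cancel₀ (hW0 _).ne', one_mul]
        rw [this]
        exact lp.norm_apply_le_norm one_ne_zero v l
      · have hq : 0 < p.toReal := ENNReal.toReal_pos (by
          intro h; rw [h] at hp; simp at hp) hpt
        have hs : Summable fun l => ‖v l‖ ^ p.toReal :=
          ((lp.memℓp v).of_exponent_ge hp).summable hq
        refine (ENNReal.rpow_lt_top_iff_of_pos (by positivity)).2 ?_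
        have e : ∀ l : Λ, ω l.1 ^ p.toReal * ‖d l.1‖ ^ p.toReal * Real.exp (-(p.toReal * φ l.1)) =
            ‖v l‖ ^ p.toReal := by
          intro l
          have e1 : Real.exp (-(p.toReal * φ l.1)) = Real.exp (-φ l.1) ^ p.toReal := by
            rw [← Real.exp_mul]; congr 1; ring
          rw [e1, ← Real.mul_rpow (hω _).le (norm_nonneg _),
            ← Real.mul_rpow (mul_nonneg (hω _).le (norm_nonneg _)) (Real.exp_pos _).le]
          congr 1
          rw [hdv]
          have : ω l.1 * ((W l.1)⁻¹ * ‖v l‖) * Real.exp (-φ l.1) = W l.1 * (W l.1)⁻¹ * ‖v l‖ := by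
            rw [hW]; ring
          rw [this, mul_inv_cancel₀ (hW0 _).ne', one_mul]
        simp only [e]
        rw [← ENNReal.ofReal_tsum_of_nonneg (fun l => by positivity) hs]
        exact ENNReal.ofReal_lt_top
    obtain ⟨f, hfF, hfl⟩ := hΛ d hdfin
    obtain ⟨C, hC⟩ := hsup f hfF
    have hmem : Memℓp (fun z : ℂ => (W z : ℂ) * f z) ∞ := memℓp_infty ⟨C, by
      rintro _ ⟨z, rfl⟩
      simp only
      rw [norm_mul, Complex.norm_real, Real.norm_of_nonneg (hW0 z).le]
      refine le_trans (le_of_eq ?_) (hC z)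
      rw [hW]; ring⟩
    have hxm : ((⟨fun z => (W z : ℂ) * f z, hmem⟩ : lp (fun _ : ℂ => ℂ) ∞), v) ∈ X := by
      refine ⟨f, hfF.1, fun z => rfl, fun l => ?_⟩
      show v l = _
      rw [hfl l l.2, hd]
      have hWc : (W l : ℂ) ≠ 0 := by exact_mod_cast (hW0 l).ne'
      simp only [Subtype.coe_prop, dif_pos]
      rw [mul_inv_cancel_left₀ hWc]
    exact ⟨⟨_, hxm⟩, rfl⟩
  obtain ⟨C0, hC0, hpre⟩ := T.exists_preimage_norm_le hT
  refine ⟨C0, hC0, fun l hl => ?_⟩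
  obtain ⟨x, hx, hxn⟩ := hpre (lp.single 1 (⟨l, hl⟩ : Λ) (1 : ℂ))
  rw [lp.norm_single one_pos, norm_one, mul_one] at hxn
  obtain ⟨f, hf, hf1, hf2⟩ := x.2
  have hx' : x.1.2 = lp.single 1 (⟨l, hl⟩ : Λ) (1 : ℂ) := hx
  have hWc : ∀ z, (W z : ℂ) ≠ 0 := fun z => by exact_mod_cast (hW0 z).ne'
  refine ⟨f, hf, ?_, fun l' hl' hne => ?_, fun z => ?_⟩
  · have := hf2 ⟨l, hl⟩
    rw [hx', lp.single_apply_self] at this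
    rw [← hWinv]
    push_cast
    exact eq_inv_of_mul_eq_one_right this.symm
  · have := hf2 ⟨l', hl'⟩
    rw [hx', lp.single_apply_ne _ _ _ (by simpa [Subtype.ext_iff] using hne)] at this
    simpa [hWc] using this.symm
  · have h1 := lp.norm_apply_le_norm ENNReal.top_ne_zero x.1.1 z
    rw [hf1 z, norm_mul, Complex.norm_real, Real.norm_of_nonneg (hW0 z).le] at h1
    have h2 : ‖x.1.1‖ ≤ ‖x‖ := norm_fst_le x.1
    refine le_trans (le_of_eq ?_) (h1.trans (h2.trans hxn))
    rw [hW]; ring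



theorem ii_sep {φ : ℂ → ℝ} {μ : Measure ℂ} (hφ : HasDoublingLaplacian φ μ) {ρ : ℂ → ℝ}
    (hρ : IsRadius μ ρ) {ω : ℂ → ℝ} (hω : ∀ z, 0 < ω z) {B : ℝ} (hB : 1 ≤ B) {k : ℕ}
    (hfl : ∀ z l, ω l ≤ B * (1 + ‖z - l‖ / ρ l) ^ k * ω z) {C0 : ℝ} (hC0 : 0 < C0) {Λ : Set ℂ}
    (hu : ∀ l ∈ Λ, ∃ f : ℂ → ℂ,
      Differentiable ℂ f ∧ f l = ((Real.exp (φ l) / ω l : ℝ) : ℂ) ∧ (∀ l' ∈ Λ, l' ≠ l → f l' = 0) ∧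
      ∀ z, ω z * ‖f z‖ * Real.exp (-φ z) ≤ C0) :
    ∃ δ : ℝ, 0 < δ ∧ ∀ l ∈ Λ, ∀ l' ∈ Λ, l' ≠ l → δ * ρ l ≤ ‖l' - l‖ := by
  obtain ⟨CA, hCA, hloc⟩ := ii_local hφ hρ
  set Q := C0 * Real.exp CA * (B * 2 ^ k) with hQ
  have hQ0 : 0 < Q := by positivity
  refine ⟨min (1 / 2) (Real.exp (-CA) / (4 * Q)), by positivity, fun l hl l' hl' hne => ?_⟩
  obtain ⟨f, hf, hfl1, hfl2, hfb⟩ := hu l hl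
  obtain ⟨h, hh, hhb⟩ := hloc l
  have hr := (hρ l).1
  by_cases hin : l' ∈ ball l (ρ l / 2)
  swap
  · rw [mem_ball, dist_eq_norm, not_lt] at hin
    calc _ ≤ 1 / 2 * ρ l := by gcongr; exact min_le_left _ _
      _ ≤ _ := by linarith
  set G : ℂ → ℂ := fun w => (ω l : ℂ) * (f w * Complex.exp (-h w)) with hG
  have hGn : ∀ w, ‖G w‖ = ω l * (‖f w‖ * Real.exp (-(h w).re)) := fun w => by
    rw [hG]; simp [Complex.norm_exp, abs_of_pos (hω l)]
  have hGb : ∀ w ∈ ball l (ρ l / 2), ‖G w‖ ≤ Q := by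
    intro w hw
    have h1 := (abs_le.1 (hhb w hw)).2
    have hw' : ‖w - l‖ < ρ l / 2 := by rwa [mem_ball, dist_eq_norm] at hw
    have k1 : 1 + ‖w - l‖ / ρ l ≤ 2 := by
      have : ‖w - l‖ / ρ l ≤ 1 := by rw [div_le_one hr]; linarith
      linarith
    have h2 : ω l ≤ B * 2 ^ k * ω w := by
      refine (hfl w l).trans ?_
      have := hω w
      gcongr
    have h3 : Real.exp (-(h w).re) ≤ Real.exp CA * Real.exp (-φ w) := by
      rw [← Real.exp_add]; apply Real.exp_le_exp.2; linarith
    have := hω w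
    rw [hGn]
    calc _ ≤ (B * 2 ^ k * ω w) * (‖f w‖ * (Real.exp CA * Real.exp (-φ w))) := by gcongr
      _ = Real.exp CA * (B * 2 ^ k) * (ω w * ‖f w‖ * Real.exp (-φ w)) := by ring
      _ ≤ Real.exp CA * (B * 2 ^ k) * C0 := by gcongr; exact hfb w
      _ = Q := by rw [hQ]; ring
  have hGl : Real.exp (-CA) ≤ ‖G l‖ := by
    have h1 := (abs_le.1 (hhb l (mem_ball_self (by positivity)))).1
    rw [hGn, hfl1, Complex.norm_real, Real.norm_of_nonneg (by have := hω l; positivity)]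
    have : ω l * (Real.exp (φ l) / ω l * Real.exp (-(h l).re)) = Real.exp (φ l - (h l).re) := by
      rw [sub_eq_add_neg, Real.exp_add]; have := (hω l).ne'; field_simp
    rw [this]; apply Real.exp_le_exp.2; linarith
  have hGl' : G l' = 0 := by rw [hG]; simp [hfl2 l' hl' hne]
  have hGd : DifferentiableOn ℂ G (ball l (ρ l / 2)) :=
    (hf.differentiableOn.mul hh.neg.cexp).const_mul _
  have key := Complex.dist_le_div_mul_dist_of_mapsTo_ball (R₂ := 2 * Q) hGd (fun w hw => by
    rw [mem_closedBall, dist_eq_norm]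
    have := norm_sub_le (G w) (G l)
    have := hGb w hw
    have := hGb l (mem_ball_self (by positivity))
    linarith) hin
  rw [hGl', dist_zero_left, dist_eq_norm] at key
  have k2 : Real.exp (-CA) ≤ 4 * Q / ρ l * ‖l' - l‖ := by
    refine hGl.trans (key.trans (le_of_eq ?_)); field_simp; ring
  calc _ ≤ Real.exp (-CA) / (4 * Q) * ρ l := by gcongr; exact min_le_right _ _
    _ ≤ (4 * Q / ρ l * ‖l' - l‖) / (4 * Q) * ρ l := by gcongr
    _ = _ := by field_simp

theorem ii_scale : ∃ J : ℝ, 0 ≤ J ∧ ∀ (a : ℂ) (r : ℝ), 0 < r →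
    Integrable (fun w : ℂ => 1 / (1 + ‖w - a‖ / r) ^ 4) ∧
    ∫ w : ℂ, 1 / (1 + ‖w - a‖ / r) ^ 4 = J * r ^ 2 := by
  have h0 : Integrable (fun w : ℂ => 1 / (1 + ‖w‖) ^ 4) := by
    have := integrable_one_add_norm (E := ℂ) (μ := volume) (r := 4) (by
      rw [Complex.finrank_real_complex]; norm_num)
    refine this.congr (Eventually.of_forall fun w => ?_)
    simp only
    rw [Real.rpow_neg (by positivity), one_div]
    norm_cast
  refine ⟨∫ w : ℂ, 1 / (1 + ‖w‖) ^ 4, integral_nonneg fun w => by positivity, fun a r hr => ?_⟩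
  have e : ∀ w : ℂ, 1 / (1 + ‖w‖ / r) ^ 4 = 1 / (1 + ‖r⁻¹ • w‖) ^ 4 := fun w => by
    rw [norm_smul, Real.norm_of_nonneg (by positivity)]; ring_nf
  have h1 : Integrable (fun w : ℂ => 1 / (1 + ‖w‖ / r) ^ 4) := by
    simp only [e]
    exact h0.comp_smul (R := r⁻¹) (by positivity)
  refine ⟨h1.comp_sub_right a, ?_⟩
  rw [integral_sub_right_eq_self (fun w : ℂ => 1 / (1 + ‖w‖ / r) ^ 4) a]
  simp only [e]
  rw [Measure.integral_comp_inv_smul_of_nonneg volume (fun w : ℂ => 1 / (1 + ‖w‖) ^ 4) hr.le,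
    Complex.finrank_real_complex, smul_eq_mul, mul_comm]



theorem ii_sum {ρ : ℂ → ℝ} (h0 : ∀ z, 0 < ρ z) (hlip : ∀ z w, ρ z ≤ ρ w + ‖z - w‖)
    {A : ℝ} (hA : 1 ≤ A) {s : ℕ}
    (hE : ∀ z l, ρ l ≤ A * (1 + ‖z - l‖ / ρ l) ^ s * ρ z) {Λ : Set ℂ} {δ : ℝ} (hδ : 0 < δ)
    (hsep : ∀ l ∈ Λ, ∀ l' ∈ Λ, l' ≠ l → δ * ρ l ≤ ‖l' - l‖) :
    ∃ (M : ℕ) (C : ℝ), 0 ≤ C ∧ ∀ (z : ℂ) (t : Finset Λ),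
      ∑ l ∈ t, 1 / (1 + ‖z - l.1‖ / ρ l.1) ^ M ≤ C := by
  obtain ⟨J, hJ, hsc⟩ := ii_scale
  set m := 2 * s + 4 with hm
  set η := min (δ / 2) (1 / 2) with hη
  have hη0 : 0 < η := by positivity
  have hη1 : η ≤ 1 / 2 := min_le_right _ _
  have hη2 : η ≤ δ / 2 := min_le_left _ _
  refine ⟨(s + 1) * m, A ^ (m + 2) * 16 / (π * η ^ 2) * J, by positivity, fun z t => ?_⟩
  obtain ⟨hintg, hval⟩ := hsc z (ρ z) (h0 z)
  have hz := h0 z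
  set g : ℂ → ℝ := fun w => 1 / (1 + ‖w - z‖ / ρ z) ^ 4 with hg
  have hg0 : ∀ w, 0 ≤ g w := fun w => by positivity
  have key : ∀ l : Λ, 1 / (1 + ‖z - l.1‖ / ρ l.1) ^ ((s + 1) * m) ≤
      A ^ (m + 2) * 16 / (π * η ^ 2 * ρ z ^ 2) * ∫ w in ball l.1 (η * ρ l.1), g w := by
    rintro ⟨l, hl⟩
    have hl0 := h0 l
    simp only
    have h1 := ii_K_symm h0 hA hE z l
    have h2 := hE l z
    have hk := ii_K_one hl0 z
    have hk' := ii_K_one hz l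
    set K := 1 + ‖z - l‖ / ρ l with hK
    set T := 1 + ‖l - z‖ / ρ z with hT
    have e1 : T ^ m ≤ A ^ m * K ^ ((s + 1) * m) := by
      rw [pow_mul, ← mul_pow]; gcongr
    have e2 : ρ z ^ 2 ≤ A ^ 2 * T ^ (2 * s) * ρ l ^ 2 := by
      calc ρ z ^ 2 ≤ (A * T ^ s * ρ l) ^ 2 := by gcongr
        _ = _ := by ring
    have e3 : π * η ^ 2 * ρ l ^ 2 / (16 * T ^ 4) ≤ ∫ w in ball l (η * ρ l), g w := by
      have hb : ∀ w ∈ ball l (η * ρ l), 1 / (16 * T ^ 4) ≤ g w := by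
        intro w hw
        rw [mem_ball, dist_eq_norm] at hw
        have t1 : ‖w - z‖ ≤ ‖w - l‖ + ‖l - z‖ := norm_sub_le_norm_sub_add_norm_sub w l z
        have t2 := hlip l z
        have t3 : 1 + ‖w - z‖ / ρ z ≤ 2 * T := by
          have : T * ρ z = ρ z + ‖l - z‖ := by rw [hT]; field_simp
          have t4 : ‖w - z‖ ≤ (2 * T - 1) * ρ z := by
            have : η * ρ l ≤ 1 / 2 * ρ l := by gcongr
            nlinarith [norm_nonneg (l - z)]
          have := (div_le_iff₀ hz).2 t4
          linarith
        rw [hg]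
        simp only
        have : 16 * T ^ 4 = (2 * T) ^ 4 := by ring
        rw [this]
        gcongr
      have hc : ∫ w in ball l (η * ρ l), 1 / (16 * T ^ 4) = π * η ^ 2 * ρ l ^ 2 / (16 * T ^ 4) := by
        rw [setIntegral_const, Measure.real, Complex.volume_ball]
        simp [ENNReal.toReal_ofReal (by positivity : 0 ≤ η), ENNReal.toReal_ofReal hl0.le,
          ENNReal.ofReal_mul hη0.le]
        ring
      rw [← hc]
      refine setIntegral_mono_on ?_ hintg.integrableOn measurableSet_ball hb
      exact integrableOn_const measure_ball_lt_top.ne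
    calc 1 / K ^ ((s + 1) * m) ≤ A ^ m / T ^ m := by
          rw [div_le_div_iff₀ (by positivity) (by positivity)]; linarith
      _ = A ^ m / T ^ m * (ρ z ^ 2 / ρ z ^ 2) := by field_simp
      _ ≤ A ^ m / T ^ m * (A ^ 2 * T ^ (2 * s) * ρ l ^ 2 / ρ z ^ 2) := by gcongr
      _ = A ^ (m + 2) * 16 / (π * η ^ 2 * ρ z ^ 2) * (π * η ^ 2 * ρ l ^ 2 / (16 * T ^ 4)) := by
          have := Real.pi_pos
          rw [hm, pow_add T (2 * s) 4, pow_add A (2 * s + 4) 2]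
          field_simp
      _ ≤ _ := by gcongr
  have hdisj : Set.Pairwise (t : Set Λ) (Function.onFun Disjoint fun l : Λ => ball l.1 (η * ρ l.1)) := by
    intro l _ l' _ hne
    refine ball_disjoint_ball ?_
    have hne' : l'.1 ≠ l.1 := fun h => hne (Subtype.ext h.symm)
    have a1 := hsep l.1 l.2 l'.1 l'.2 hne'
    have a2 := hsep l'.1 l'.2 l.1 l.2 hne'.symm
    rw [norm_sub_rev] at a1
    rw [dist_eq_norm]
    have b1 : η * ρ l.1 ≤ δ / 2 * ρ l.1 := by have := h0 l.1; gcongr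
    have b2 : η * ρ l'.1 ≤ δ / 2 * ρ l'.1 := by have := h0 l'.1; gcongr
    linarith
  have hun := integral_biUnion_finset (μ := volume) (f := g) t (s := fun l : Λ => ball l.1 (η * ρ l.1))
    (fun _ _ => measurableSet_ball) hdisj (fun _ _ => hintg.integrableOn)
  calc _ ≤ ∑ l ∈ t, A ^ (m + 2) * 16 / (π * η ^ 2 * ρ z ^ 2) * ∫ w in ball l.1 (η * ρ l.1), g w :=
        Finset.sum_le_sum fun l _ => key l
    _ = A ^ (m + 2) * 16 / (π * η ^ 2 * ρ z ^ 2) * ∫ w in ⋃ l ∈ t, ball l.1 (η * ρ l.1), g w := by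
        rw [← Finset.mul_sum, hun]
    _ ≤ A ^ (m + 2) * 16 / (π * η ^ 2 * ρ z ^ 2) * ∫ w, g w := by
        refine mul_le_mul_of_nonneg_left ?_ (by positivity)
        exact setIntegral_le_integral hintg (Eventually.of_forall hg0)
    _ = _ := by rw [hval]; have := Real.pi_pos; field_simp



theorem ii_holder {ι : Type*} (k a : ι → ℝ≥0∞) {q : ℝ} (hq : 1 ≤ q) {S : ℝ≥0∞}
    (hk : ∀ t : Finset ι, ∑ i ∈ t, k i ≤ S) :
    (∑' i, k i * a i) ^ q ≤ S ^ (q - 1) * ∑' i, k i * a i ^ q := by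
  have hq0 : 0 < q := by linarith
  have h1 : ∑' i, k i * a i ≤ S ^ (1 - q⁻¹) * (∑' i, k i * a i ^ q) ^ q⁻¹ := by
    rw [ENNReal.tsum_eq_iSup_sum (f := fun i => k i * a i)]
    refine iSup_le fun t => (ENNReal.inner_le_weight_mul_Lp_of_nonneg t hq k a).trans ?_
    have : 0 ≤ 1 - q⁻¹ := by have := inv_le_one_of_one_le₀ hq; linarith
    refine mul_le_mul' (ENNReal.rpow_le_rpow (hk t) this) (ENNReal.rpow_le_rpow ?_ (by positivity))
    exact ENNReal.sum_le_tsum t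
  refine (ENNReal.rpow_le_rpow h1 hq0.le).trans (le_of_eq ?_)
  rw [ENNReal.mul_rpow_of_nonneg _ _ hq0.le, ← ENNReal.rpow_mul, ← ENNReal.rpow_mul,
    inv_mul_cancel₀ hq0.ne', ENNReal.rpow_one]
  congr 2
  field_simp

theorem ii_Kcmp {ρ : ℂ → ℝ} (h0 : ∀ z, 0 < ρ z) (hlip : ∀ z w, ρ z ≤ ρ w + ‖z - w‖)
    {A : ℝ} (hA : 1 ≤ A) {s : ℕ}
    (hE : ∀ z l, ρ l ≤ A * (1 + ‖z - l‖ / ρ l) ^ s * ρ z) {R : ℝ} (hR : 0 ≤ R) :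
    ∃ D : ℝ, 0 < D ∧ ∀ z l, ‖z‖ ≤ R →
      1 + ‖0 - l‖ / ρ l ≤ D * (1 + ‖z - l‖ / ρ l) ^ ((s + 1) ^ 2) := by
  have hr := h0 0
  refine ⟨A * ((1 + R / ρ 0) * A) ^ (s + 1), by positivity, fun z l hz => ?_⟩
  have h1 := ii_K_symm h0 hA hE z l
  have h2 := ii_K_symm h0 hA hE l 0
  have hz0 := h0 z
  have hk := ii_K_one (h0 l) z
  set K := 1 + ‖z - l‖ / ρ l with hK
  set T := 1 + ‖l - z‖ / ρ z with hT
  have hT1 : 1 ≤ T := ii_K_one hz0 l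
  have h3 : 1 + ‖l - 0‖ / ρ 0 ≤ (1 + R / ρ 0) * T := by
    have e1 : ‖l - z‖ = (T - 1) * ρ z := by rw [hT]; field_simp; ring
    have e2 : ‖l‖ ≤ ‖l - z‖ + ‖z‖ := by simpa using norm_add_le (l - z) z
    have e3 := hlip z 0
    rw [sub_zero] at e3 ⊢
    have e4 : ‖l‖ ≤ ((1 + R / ρ 0) * T - 1) * ρ 0 := by
      have : ((1 + R / ρ 0) * T - 1) * ρ 0 = (T - 1) * (ρ 0 + R) + R := by field_simp; ring
      rw [this]
      have : (T - 1) * ρ z ≤ (T - 1) * (ρ 0 + R) :=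
        mul_le_mul_of_nonneg_left (by linarith) (by linarith)
      linarith
    have := (div_le_iff₀ hr).2 e4
    linarith
  have hs : 1 ≤ 1 + ‖l - 0‖ / ρ 0 := ii_K_one hr l
  calc 1 + ‖0 - l‖ / ρ l ≤ A * (1 + ‖l - 0‖ / ρ 0) ^ (s + 1) := h2
    _ ≤ A * ((1 + R / ρ 0) * (A * K ^ (s + 1))) ^ (s + 1) := by
        have : 1 + ‖l - 0‖ / ρ 0 ≤ (1 + R / ρ 0) * (A * K ^ (s + 1)) := h3.trans (by gcongr)
        gcongr
    _ = _ := by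
        rw [← mul_assoc, mul_pow _ (K ^ (s + 1)), ← pow_mul, sq]
        ring



theorem ii_final {ρ : ℂ → ℝ} (h0 : ∀ z, 0 < ρ z) (hlip : ∀ z w, ρ z ≤ ρ w + ‖z - w‖)
    {A : ℝ} (hA : 1 ≤ A) {s : ℕ}
    (hE : ∀ z l, ρ l ≤ A * (1 + ‖z - l‖ / ρ l) ^ s * ρ z) {Λ : Set ℂ} {M0 : ℕ} {Cs : ℝ}
    (hCs : 0 ≤ Cs) (hsum : ∀ (z : ℂ) (t : Finset Λ),
      ∑ l ∈ t, 1 / (1 + ‖z - l.1‖ / ρ l.1) ^ M0 ≤ Cs)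
    {ρ' : ℂ → ℝ} (hρ'0 : ∀ z, 0 < ρ' z) {B : ℝ} (hB : 0 < B) (hρ' : ∀ z, ρ z ≤ B * ρ' z)
    {ψ ω : ℂ → ℝ} (hψ : Continuous ψ) (hω : ∀ z, 0 < ω z)
    (hlow : ∀ S : ℝ, ∃ c > 0, ∀ z, ‖z‖ ≤ S → c ≤ ω z)
    {C : ℝ} (hC : 0 ≤ C) {u : Λ → ℂ → ℂ} (hud : ∀ l, Differentiable ℂ (u l))
    (hu1 : ∀ l, u l l.1 = 1) (hu0 : ∀ l l' : Λ, l' ≠ l → u l l'.1 = 0)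
    (hub : ∀ (l : Λ) z, ω z * ‖u l z‖ * Real.exp (-ψ z) *
      (1 + ‖z - l.1‖ / ρ l.1) ^ ((s + 1) ^ 2 * M0 + (2 * s + 4)) ≤
        C * (ω l.1 * Real.exp (-ψ l.1)))
    {p : ℝ≥0∞} (hp : 1 ≤ p) : IsInterpolating p ψ ω ρ' Λ := by
  intro v hv
  set M := (s + 1) ^ 2 * M0 + (2 * s + 4) with hM
  set a : Λ → ℝ := fun l => ω l.1 * ‖v l.1‖ * Real.exp (-ψ l.1) with ha
  have ha0 : ∀ l, 0 ≤ a l := fun l => by have := hω l.1; positivity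
  set K : ℂ → Λ → ℝ := fun z l => 1 + ‖z - l.1‖ / ρ l.1 with hK
  have hK1 : ∀ z l, 1 ≤ K z l := fun z l => ii_K_one (h0 l.1) z
  have hK0 : ∀ z l, 0 < K z l := fun z l => one_pos.trans_le (hK1 z l)
  have hMM : M0 ≤ M := by
    have : 1 * M0 ≤ (s + 1) ^ 2 * M0 := Nat.mul_le_mul_right _ (Nat.one_le_pow _ _ (by omega))
    omega
  have hsum' : ∀ (z : ℂ) (t : Finset Λ), ∑ l ∈ t, 1 / K z l ^ M ≤ Cs := fun z t => by
    refine le_trans (Finset.sum_le_sum fun l _ => ?_) (hsum z t)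
    exact one_div_le_one_div_of_le (pow_pos (hK0 z l) _) (pow_le_pow_right₀ (hK1 z l) hMM)
  have hsumm0 : ∀ z, Summable fun l => 1 / K z l ^ M0 := fun z =>
    summable_of_sum_le (fun l => by have := hK0 z l; positivity) (hsum z)
  have hsumm : ∀ z, Summable fun l => 1 / K z l ^ M := fun z =>
    summable_of_sum_le (fun l => by have := hK0 z l; positivity) (hsum' z)
  have hcount : Countable Λ := by
    have := (hsumm 0).countable_support
    have e : Function.support (fun l => 1 / K 0 l ^ M) = univ := by
      ext l
      simp only [Function.mem_support, mem_univ, iff_true]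
      have := hK0 0 l; positivity
    rw [e] at this
    exact countable_univ_iff.1 this
  -- termwise bound
  have hterm : ∀ l z, ω z * Real.exp (-ψ z) * ‖v l.1 * u l z‖ ≤ C * (a l / K z l ^ M) := by
    intro l z
    have h1 := hub l z
    have hk := pow_pos (hK0 z l) M
    rw [← mul_div_assoc, le_div_iff₀ hk, norm_mul]
    calc _ = ‖v l.1‖ * (ω z * ‖u l z‖ * Real.exp (-ψ z) * K z l ^ M) := by ring
      _ ≤ ‖v l.1‖ * (C * (ω l.1 * Real.exp (-ψ l.1))) := mul_le_mul_of_nonneg_left h1 (norm_nonneg _)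
      _ = _ := by rw [ha]; ring
  -- boundedness of the coefficients
  have habd : ∃ Aa : ℝ, 0 ≤ Aa ∧ ∀ l, a l ≤ Aa := by
    rw [lnorm] at hv
    split_ifs at hv with hpt
    · refine ⟨_, ENNReal.toReal_nonneg, fun l => (ENNReal.ofReal_le_iff_le_toReal hv.ne).1
        (le_iSup (fun l : Λ => ENNReal.ofReal (ω l.1 * ‖v l.1‖ * Real.exp (-ψ l.1))) l)⟩
    · have hq1 : 1 ≤ p.toReal := by
        rw [← ENNReal.toReal_one]
        exact (ENNReal.toReal_le_toReal ENNReal.one_ne_top hpt).2 hp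
      have hv' := (ENNReal.rpow_lt_top_iff_of_pos (by positivity)).1 hv
      refine ⟨1 + (∑' l : Λ, ENNReal.ofReal
          (ω l.1 ^ p.toReal * ‖v l.1‖ ^ p.toReal * Real.exp (-(p.toReal * ψ l.1)))).toReal,
        add_nonneg zero_le_one ENNReal.toReal_nonneg, fun l => ?_⟩
      have h1 := (ENNReal.ofReal_le_iff_le_toReal hv'.ne).1 (ENNReal.le_tsum (f := fun l : Λ => ENNReal.ofReal
          (ω l.1 ^ p.toReal * ‖v l.1‖ ^ p.toReal * Real.exp (-(p.toReal * ψ l.1)))) l)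
      have e : a l ^ p.toReal = ω l.1 ^ p.toReal * ‖v l.1‖ ^ p.toReal * Real.exp (-(p.toReal * ψ l.1)) := by
        rw [ha]
        simp only
        rw [Real.mul_rpow (by have := hω l.1; positivity) (by positivity),
          Real.mul_rpow (hω l.1).le (norm_nonneg _), ← Real.exp_mul]
        congr 2; ring
      rw [← e] at h1
      rcases le_total (a l) 1 with h | h
      · exact h.trans (le_add_of_nonneg_right ENNReal.toReal_nonneg)
      · exact ((Real.self_le_rpow_of_one_le h hq1).trans h1).trans (by linarith)
  obtain ⟨Aa, hAa0, hAa⟩ := habd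
  have hsa : ∀ z, Summable fun l => a l / K z l ^ M := fun z => by
    refine Summable.of_nonneg_of_le (fun l => by have := hK0 z l; have := ha0 l; positivity)
      (fun l => ?_) ((hsumm z).mul_left Aa)
    rw [div_eq_mul_one_div]
    exact mul_le_mul_of_nonneg_right (hAa l) (by have := hK0 z l; positivity)
  set f : ℂ → ℂ := fun z => ∑' l : Λ, v l.1 * u l z with hf
  have hW0 : ∀ z, 0 < ω z * Real.exp (-ψ z) := fun z => mul_pos (hω z) (Real.exp_pos _)
  have hfs : ∀ z, Summable fun l : Λ => ‖v l.1 * u l z‖ := fun z => by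
    have : Summable fun l : Λ => ω z * Real.exp (-ψ z) * ‖v l.1 * u l z‖ :=
      Summable.of_nonneg_of_le (fun l => mul_nonneg (hW0 z).le (norm_nonneg _))
        (fun l => hterm l z) ((hsa z).mul_left C)
    exact (summable_mul_left_iff (hW0 z).ne').1 this
  have hfb : ∀ z, ω z * ‖f z‖ * Real.exp (-ψ z) ≤ C * ∑' l, a l / K z l ^ M := fun z => by
    calc _ = ω z * Real.exp (-ψ z) * ‖f z‖ := by ring
      _ ≤ ω z * Real.exp (-ψ z) * ∑' l : Λ, ‖v l.1 * u l z‖ :=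
          mul_le_mul_of_nonneg_left (norm_tsum_le_tsum_norm (hfs z)) (hW0 z).le
      _ = ∑' l : Λ, ω z * Real.exp (-ψ z) * ‖v l.1 * u l z‖ := tsum_mul_left.symm
      _ ≤ ∑' l, C * (a l / K z l ^ M) :=
          Summable.tsum_le_tsum (fun l => hterm l z) ((hfs z).mul_left _) ((hsa z).mul_left C)
      _ = _ := tsum_mul_left
  -- holomorphy
  have hfd : Differentiable ℂ f := by
    intro z0
    set R := ‖z0‖ + 1 with hR
    have hR0 : 0 ≤ R := by positivity
    obtain ⟨D, hD, hcmp⟩ := ii_Kcmp h0 hlip hA hE hR0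
    obtain ⟨c, hc, hcl⟩ := hlow R
    obtain ⟨Bψ, hBψ⟩ := (isCompact_closedBall (0:ℂ) R).exists_bound_of_continuousOn hψ.continuousOn
    have hd : DifferentiableOn ℂ f (ball 0 R) := by
      refine Complex.differentiableOn_tsum_of_summable_norm
        (u := fun l : Λ => Real.exp Bψ / c * (C * (Aa * (D ^ M0 * (1 / K 0 l ^ M0)))))
        ((((hsumm0 0).mul_left _).mul_left _).mul_left _ |>.mul_left _)
        (fun l => ((hud l).const_mul _).differentiableOn) isOpen_ball (fun l w hw => ?_)
      have hw' : ‖w‖ ≤ R := by simpa using (mem_ball_zero_iff.1 hw).le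
      have h1 := hterm l w
      have h2 := hcl w hw'
      have h3 := (le_abs_self _).trans (hBψ w (by simpa using hw'))
      have h4 : c * Real.exp (-Bψ) ≤ ω w * Real.exp (-ψ w) := by
        exact mul_le_mul h2 (Real.exp_le_exp.2 (neg_le_neg h3)) (Real.exp_pos _).le (hω w).le
      have hkw := hK0 w l
      have hk0 := hK0 0 l
      have h5 : 1 / K w l ^ M ≤ D ^ M0 * (1 / K 0 l ^ M0) := by
        have e1 : K 0 l ^ M0 ≤ D ^ M0 * K w l ^ M := by
          calc K 0 l ^ M0 ≤ (D * K w l ^ ((s + 1) ^ 2)) ^ M0 := by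
                have := hcmp w l.1 hw'
                exact pow_le_pow_left₀ hk0.le this M0
            _ = D ^ M0 * K w l ^ ((s + 1) ^ 2 * M0) := by rw [mul_pow, ← pow_mul]
            _ ≤ _ := by
                refine mul_le_mul_of_nonneg_left ?_ (by positivity)
                exact pow_le_pow_right₀ (hK1 w l) (by omega)
        rw [mul_one_div, div_le_div_iff₀ (by positivity) (by positivity)]
        linarith
      have h6 : C * (a l / K w l ^ M) ≤ C * (Aa * (D ^ M0 * (1 / K 0 l ^ M0))) := by
        rw [div_eq_mul_one_div]
        have := hAa l
        have := ha0 l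
        gcongr
      have h7 : c * Real.exp (-Bψ) * ‖v l.1 * u l w‖ ≤ C * (Aa * (D ^ M0 * (1 / K 0 l ^ M0))) :=
        (mul_le_mul_of_nonneg_right h4 (norm_nonneg _)).trans (h1.trans h6)
      rw [div_mul_eq_mul_div, le_div_iff₀ hc]
      calc ‖v l.1 * u l w‖ * c = Real.exp Bψ * (c * Real.exp (-Bψ) * ‖v l.1 * u l w‖) := by
            rw [Real.exp_neg]; field_simp
        _ ≤ _ := mul_le_mul_of_nonneg_left h7 (Real.exp_pos _).le
    exact hd.differentiableAt (isOpen_ball.mem_nhds (by rw [mem_ball_zero_iff, hR]; linarith))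
  refine ⟨f, ⟨hfd, ?_⟩, fun l hl => ?_⟩
  swap
  · rw [hf]
    simp only
    rw [tsum_eq_single (⟨l, hl⟩ : Λ)]
    · have := hu1 ⟨l, hl⟩
      simp only at this
      rw [this, mul_one]
    · intro b hb
      have := hu0 b ⟨l, hl⟩ hb.symm
      simp only at this
      rw [this, mul_zero]
  -- norm
  rw [lnorm] at hv
  rw [Fnorm]
  split_ifs at hv ⊢ with hpt
  · refine lt_of_le_of_lt (iSup_le fun z => ENNReal.ofReal_le_ofReal ?_)
      (ENNReal.ofReal_lt_top (r := C * (Aa * Cs)))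
    refine (hfb z).trans (mul_le_mul_of_nonneg_left ?_ hC)
    calc _ ≤ ∑' l, Aa * (1 / K z l ^ M) := by
          refine Summable.tsum_le_tsum (fun l => ?_) (hsa z) ((hsumm z).mul_left Aa)
          rw [div_eq_mul_one_div]
          exact mul_le_mul_of_nonneg_right (hAa l) (by have := hK0 z l; positivity)
      _ = Aa * ∑' l, 1 / K z l ^ M := tsum_mul_left
      _ ≤ _ := by
          refine mul_le_mul_of_nonneg_left ?_ hAa0
          exact (hsumm z).tsum_le_of_sum_le (hsum' z)
  · set q := p.toReal with hq
    have hq1 : 1 ≤ q := by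
      rw [hq, ← ENNReal.toReal_one]
      exact (ENNReal.toReal_le_toReal ENNReal.one_ne_top hpt).2 hp
    have hq0 : 0 < q := by linarith
    have hv' := (ENNReal.rpow_lt_top_iff_of_pos (by positivity)).1 hv
    refine (ENNReal.rpow_lt_top_iff_of_pos (by positivity)).2 ?_
    have ea : ∀ l : Λ, ω l.1 ^ q * ‖v l.1‖ ^ q * Real.exp (-(q * ψ l.1)) = a l ^ q := by
      intro l
      rw [ha]
      simp only
      rw [Real.mul_rpow (by have := hω l.1; positivity) (by positivity),
        Real.mul_rpow (hω l.1).le (norm_nonneg _), ← Real.exp_mul]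
      congr 2; ring
    simp only [ea] at hv'
    obtain ⟨J, hJ, hsc⟩ := ii_scale
    set H : ℝ≥0∞ := ENNReal.ofReal (C ^ q) * (ENNReal.ofReal Cs ^ (q - 1)) *
      ENNReal.ofReal (B ^ 2 * A ^ 2) with hH
    have hHt : H ≠ ∞ := by
      rw [hH]
      refine ENNReal.mul_ne_top (ENNReal.mul_ne_top ENNReal.ofReal_ne_top ?_) ENNReal.ofReal_ne_top
      exact ENNReal.rpow_ne_top_of_nonneg (by linarith) ENNReal.ofReal_ne_top
    have hpt : ∀ z, ENNReal.ofReal (‖f z‖ ^ q * Real.exp (-(q * ψ z)) * ω z ^ q / ρ' z ^ 2) ≤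
        H * ∑' l : Λ, ENNReal.ofReal (a l ^ q) *
          ENNReal.ofReal (1 / (1 + ‖z - l.1‖ / ρ l.1) ^ 4 * (1 / ρ l.1 ^ 2)) := by
      intro z
      have hz' := hρ'0 z
      have e1 : ‖f z‖ ^ q * Real.exp (-(q * ψ z)) * ω z ^ q / ρ' z ^ 2 =
          (ω z * ‖f z‖ * Real.exp (-ψ z)) ^ q * (1 / ρ' z ^ 2) := by
        rw [Real.mul_rpow (by have := hω z; positivity) (by positivity),
          Real.mul_rpow (hω z).le (norm_nonneg _), ← Real.exp_mul]
        have : -ψ z * q = -(q * ψ z) := by ring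
        rw [this]; ring
      have hS0 : 0 ≤ ∑' l, a l / K z l ^ M :=
        tsum_nonneg fun l => by have := hK0 z l; have := ha0 l; positivity
      have e2 : (ω z * ‖f z‖ * Real.exp (-ψ z)) ^ q ≤ C ^ q * (∑' l, a l / K z l ^ M) ^ q := by
        rw [← Real.mul_rpow hC hS0]
        exact Real.rpow_le_rpow (by have := hω z; positivity) (hfb z) hq0.le
      have e3 : ENNReal.ofReal ((∑' l, a l / K z l ^ M) ^ q) ≤ ENNReal.ofReal Cs ^ (q - 1) *
          ∑' l, ENNReal.ofReal (1 / K z l ^ M) * ENNReal.ofReal (a l) ^ q := by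
        rw [← ENNReal.ofReal_rpow_of_nonneg hS0 hq0.le, ENNReal.ofReal_tsum_of_nonneg
          (fun l => by have := hK0 z l; have := ha0 l; positivity) (hsa z)]
        have e4 : ∀ l, ENNReal.ofReal (a l / K z l ^ M) =
            ENNReal.ofReal (1 / K z l ^ M) * ENNReal.ofReal (a l) := fun l => by
          rw [← ENNReal.ofReal_mul (by have := hK0 z l; positivity)]; congr 1; ring
        simp only [e4]
        refine ii_holder _ _ hq1 fun t => ?_
        rw [← ENNReal.ofReal_sum_of_nonneg fun l _ => by have := hK0 z l; positivity]
        exact ENNReal.ofReal_le_ofReal (hsum' z t)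
      have e5 : ∀ l : Λ, 1 / K z l ^ M * (1 / ρ' z ^ 2) ≤
          B ^ 2 * A ^ 2 * (1 / K z l ^ 4 * (1 / ρ l.1 ^ 2)) := by
        intro l
        have hk := hK0 z l
        have hl := h0 l.1
        have g1 : ρ l.1 ≤ A * K z l ^ s * ρ z := hE z l.1
        have g2 : ρ l.1 ≤ A * K z l ^ s * (B * ρ' z) :=
          g1.trans (mul_le_mul_of_nonneg_left (hρ' z) (by positivity))
        have g3 : ρ l.1 ^ 2 ≤ B ^ 2 * A ^ 2 * K z l ^ (2 * s) * ρ' z ^ 2 := by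
          calc ρ l.1 ^ 2 ≤ (A * K z l ^ s * (B * ρ' z)) ^ 2 := by gcongr
            _ = _ := by ring
        have g4 : K z l ^ (2 * s) * K z l ^ 4 ≤ K z l ^ M := by
          rw [← pow_add]; exact pow_le_pow_right₀ (hK1 z l) (by omega)
        have g5 : ρ l.1 ^ 2 * K z l ^ 4 ≤ B ^ 2 * A ^ 2 * (K z l ^ M * ρ' z ^ 2) := by
          calc _ ≤ (B ^ 2 * A ^ 2 * K z l ^ (2 * s) * ρ' z ^ 2) * K z l ^ 4 := by gcongr
            _ = B ^ 2 * A ^ 2 * (K z l ^ (2 * s) * K z l ^ 4 * ρ' z ^ 2) := by ring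
            _ ≤ _ := by gcongr
        have : 1 / K z l ^ M * (1 / ρ' z ^ 2) = 1 / (K z l ^ M * ρ' z ^ 2) := by field_simp
        rw [this]
        have : B ^ 2 * A ^ 2 * (1 / K z l ^ 4 * (1 / ρ l.1 ^ 2)) =
          B ^ 2 * A ^ 2 / (ρ l.1 ^ 2 * K z l ^ 4) := by field_simp
        rw [this, div_le_div_iff₀ (by positivity) (by positivity)]
        linarith
      calc _ ≤ ENNReal.ofReal (C ^ q * (∑' l, a l / K z l ^ M) ^ q * (1 / ρ' z ^ 2)) := by
            rw [e1]
            exact ENNReal.ofReal_le_ofReal (mul_le_mul_of_nonneg_right e2 (by positivity))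
        _ = ENNReal.ofReal (C ^ q) * ENNReal.ofReal ((∑' l, a l / K z l ^ M) ^ q) *
            ENNReal.ofReal (1 / ρ' z ^ 2) := by
            rw [ENNReal.ofReal_mul (by positivity), ENNReal.ofReal_mul (by positivity)]
        _ ≤ ENNReal.ofReal (C ^ q) * (ENNReal.ofReal Cs ^ (q - 1) *
          ∑' l, ENNReal.ofReal (1 / K z l ^ M) * ENNReal.ofReal (a l) ^ q) *
            ENNReal.ofReal (1 / ρ' z ^ 2) := by gcongr
        _ = ENNReal.ofReal (C ^ q) * ENNReal.ofReal Cs ^ (q - 1) *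
            ∑' l, ENNReal.ofReal (a l ^ q) * ENNReal.ofReal (1 / K z l ^ M * (1 / ρ' z ^ 2)) := by
            rw [← mul_assoc, mul_assoc, ← ENNReal.tsum_mul_right]
            congr 2
            funext l
            rw [ENNReal.ofReal_rpow_of_nonneg (ha0 l) hq0.le,
              ENNReal.ofReal_mul (p := 1 / K z l ^ M) (by have := hK0 z l; positivity)]
            ring
        _ ≤ ENNReal.ofReal (C ^ q) * ENNReal.ofReal Cs ^ (q - 1) *
            ∑' l : Λ, ENNReal.ofReal (a l ^ q) * (ENNReal.ofReal (B ^ 2 * A ^ 2) *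
              ENNReal.ofReal (1 / K z l ^ 4 * (1 / ρ l.1 ^ 2))) := by
            refine mul_le_mul_right (ENNReal.tsum_le_tsum fun l => mul_le_mul_right ?_ _) _
            rw [← ENNReal.ofReal_mul (by positivity)]
            exact ENNReal.ofReal_le_ofReal (e5 l)
        _ = _ := by
            rw [hH, ← ENNReal.tsum_mul_left, ← ENNReal.tsum_mul_left]
            refine tsum_congr fun l => ?_
            rw [hK]
            ring
    have hone : ∀ l : Λ, ∫⁻ z, ENNReal.ofReal (1 / (1 + ‖z - l.1‖ / ρ l.1) ^ 4 * (1 / ρ l.1 ^ 2)) =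
        ENNReal.ofReal J := fun l => by
      have hl := h0 l.1
      obtain ⟨i1, i2⟩ := hsc l.1 (ρ l.1) hl
      rw [← ofReal_integral_eq_lintegral_ofReal (i1.mul_const _)
        (Eventually.of_forall fun z => by positivity), integral_mul_const, i2]
      congr 1
      field_simp
    calc _ ≤ ∫⁻ z, H * ∑' l : Λ, ENNReal.ofReal (a l ^ q) *
          ENNReal.ofReal (1 / (1 + ‖z - l.1‖ / ρ l.1) ^ 4 * (1 / ρ l.1 ^ 2)) := lintegral_mono hpt
      _ = H * ∑' l : Λ, ENNReal.ofReal (a l ^ q) * ENNReal.ofReal J := by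
          rw [lintegral_const_mul' _ _ hHt, lintegral_tsum]
          · congr 2
            funext l
            rw [lintegral_const_mul' _ _ ENNReal.ofReal_ne_top, hone]
          · intro l
            have : Measurable fun z : ℂ => 1 / (1 + ‖z - l.1‖ / ρ l.1) ^ 4 * (1 / ρ l.1 ^ 2) := by
              fun_prop
            exact (this.ennreal_ofReal.const_mul _).aemeasurable
      _ = H * ((∑' l : Λ, ENNReal.ofReal (a l ^ q)) * ENNReal.ofReal J) := by
          rw [ENNReal.tsum_mul_right]
      _ < ∞ := ENNReal.mul_lt_top hHt.lt_top (ENNReal.mul_lt_top hv' ENNReal.ofReal_lt_top)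



theorem ii_low {ρ ω : ℂ → ℝ} (h0 : ∀ z, 0 < ρ z) (hω : ∀ z, 0 < ω z) {B : ℝ} (hB : 1 ≤ B) {k : ℕ}
    (hfl : ∀ z l, ω l ≤ B * (1 + ‖z - l‖ / ρ l) ^ k * ω z) (S : ℝ) :
    ∃ c > 0, ∀ z, ‖z‖ ≤ S → c ≤ ω z := by
  have h1 := h0 0
  have h2 := hω 0
  refine ⟨ω 0 / (B * (1 + |S| / ρ 0) ^ k), by positivity, fun z hz => ?_⟩
  rw [div_le_iff₀ (by positivity)]
  have h3 := hfl z 0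
  rw [sub_zero] at h3
  have h4 := hz.trans (le_abs_self S)
  have h5 := hω z
  calc ω 0 ≤ B * (1 + ‖z‖ / ρ 0) ^ k * ω z := h3
    _ ≤ B * (1 + |S| / ρ 0) ^ k * ω z := by gcongr
    _ = _ := by ring

/-- Inclusions between spaces of interpolating sequences: an interpolating sequence
for `F^p_{φ,ω}` is interpolating for `F^{p'}_{(1+ε)φ,ω̃}` for every `ε > 0`, every
exponent `p'` and every flat weight `ω̃`. -/
theorem interpolating_inclusions
    (φ : ℂ → ℝ) (μ : Measure ℂ) (hφ : HasDoublingLaplacian φ μ)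
    (ρ : ℂ → ℝ) (hρ : IsRadius μ ρ)
    (ε : ℝ) (hε : 0 < ε)
    (p p' : ℝ≥0∞) (hp : 1 ≤ p) (hp' : 1 ≤ p')
    (ω ω' : ℂ → ℝ) (hω : IsFlatWeight ρ ω) (hω' : IsFlatWeight ρ ω')
    (ρ' : ℂ → ℝ) (hρ' : IsRadius (ENNReal.ofReal (1 + ε) • μ) ρ')
    (Λ : Set ℂ) (hΛ : IsInterpolating p φ ω ρ Λ) :
    IsInterpolating p' (fun z => (1 + ε) * φ z) ω' ρ' Λ := by
  obtain ⟨Cd, -, hD⟩ := hφ.doubling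
  have h0 : ∀ z, 0 < ρ z := fun z => (hρ z).1
  have hlip := ii_lip hD hρ
  have hρc := ii_rho_cont hD hρ
  obtain ⟨A, hA, s, hE⟩ := ii_E hD hρ
  obtain ⟨B1, hB1, k1, hfl⟩ := ii_flat hρc h0 hA hE hω
  obtain ⟨B2, hB2, k2, hfl'⟩ := ii_flat hρc h0 hA hE hω'
  obtain ⟨Br, hBr, hrr⟩ := ii_rho' hD hρ hε hρ'
  obtain ⟨C0, hC0, hu⟩ := ii_unif hφ.continuous hp hω.1
    (ii_low h0 hω.1 hB1 fun z l => (hfl z l).2) (fun f hf => ii_sup hφ hρ hp hω hf) hΛ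
  obtain ⟨δ, hδ, hsep⟩ := ii_sep hφ hρ hω.1 hB1 (fun z l => (hfl z l).2) hC0 hu
  obtain ⟨M0, Cs, hCs, hsum⟩ := ii_sum h0 hlip hA hE hδ hsep
  set M := (s + 1) ^ 2 * M0 + (2 * s + 4) with hM
  obtain ⟨Bp, hBp, hpk⟩ := ii_peak hφ hρ hε (M + k1 + k2)
  choose P hPd hP1 hPb using hpk
  choose g hgd hg1 hg0 hgb using fun l : Λ => hu l.1 l.2
  have hω0 := hω.1
  have hω'0 := hω'.1
  refine ii_final h0 hlip hA hE hCs hsum (fun z => (hρ' z).1) hBr hrr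
    (hφ.continuous.const_mul (1 + ε) : Continuous fun z => (1 + ε) * φ z) hω'0
    (ii_low h0 hω'0 hB2 fun z l => (hfl' z l).2)
    (C := C0 * B1 * B2 * Bp) (by positivity)
    (u := fun l z => ((ω l.1 * Real.exp (-φ l.1) : ℝ) : ℂ) * (g l z * P l.1 z)) (fun l => ?_)
    (fun l => ?_) (fun l l' hne => ?_) (fun l z => ?_) hp'
  · exact ((hgd l).mul (hPd l.1)).const_mul _
  · rw [hg1, hP1, mul_one, ← Complex.ofReal_mul, Real.exp_neg]
    have := (hω0 l.1).ne'
    have : ω l.1 * (Real.exp (φ l.1))⁻¹ * (Real.exp (φ l.1) / ω l.1) = 1 := by field_simp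
    rw [this, Complex.ofReal_one]
  · rw [hg0 l l'.1 l'.2 (fun h => hne (Subtype.ext h)), zero_mul, mul_zero]
  · have hl := hω0 l.1
    have hl' := hω'0 l.1
    have hz := hω0 z
    have hz' := hω'0 z
    have hk := ii_K_one (h0 l.1) z
    have a1 := (hfl z l.1).2
    have a2 := (hfl' z l.1).1
    have a3 := hPb l.1 z
    have a4 := hgb l z
    rw [norm_mul, norm_mul, Complex.norm_real,
      Real.norm_of_nonneg (by positivity : 0 ≤ ω l.1 * Real.exp (-φ l.1))]
    set K := 1 + ‖z - l.1‖ / ρ l.1 with hK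
    have ez : Real.exp (-((1 + ε) * φ z)) = Real.exp (-φ z) * Real.exp (-(ε * φ z)) := by
      rw [← Real.exp_add]; congr 1; ring
    have el : Real.exp (-((1 + ε) * φ l.1)) = Real.exp (-φ l.1) * Real.exp (-(ε * φ l.1)) := by
      rw [← Real.exp_add]; congr 1; ring
    have ed : Real.exp (ε * (φ z - φ l.1)) * Real.exp (-(ε * φ z)) = Real.exp (-(ε * φ l.1)) := by
      rw [← Real.exp_add]; congr 1; ring
    rw [ez, el, ← ed]
    calc ω' z * (ω l.1 * Real.exp (-φ l.1) * (‖g l z‖ * ‖P l.1 z‖)) *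
          (Real.exp (-φ z) * Real.exp (-(ε * φ z))) * K ^ M
        ≤ (B2 * K ^ k2 * ω' l.1) * ((B1 * K ^ k1 * ω z) * Real.exp (-φ l.1) *
          (‖g l z‖ * ‖P l.1 z‖)) * (Real.exp (-φ z) * Real.exp (-(ε * φ z))) * K ^ M := by gcongr
      _ = B1 * B2 * ω' l.1 * Real.exp (-φ l.1) * Real.exp (-(ε * φ z)) *
          ((ω z * ‖g l z‖ * Real.exp (-φ z)) * (‖P l.1 z‖ * K ^ (M + k1 + k2))) := by
          rw [pow_add, pow_add]; ring
      _ ≤ B1 * B2 * ω' l.1 * Real.exp (-φ l.1) * Real.exp (-(ε * φ z)) *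
          (C0 * (Bp * Real.exp (ε * (φ z - φ l.1)))) := by gcongr
      _ = _ := by ring



end
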